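/- Let K be a number field and D a central division K-algebra of degree d > 2. Then the genus of D is nontrivial: there exists a central division K-algebra D' of degree d with the same maximal subfields as D but with D' not isomorphic to D. (For instance, one may take D' = D^op, since over a number field the exponent of D equals its degree d > 2.) -/

import Mathlib

/-- A central division algebra of degree `d` over a field `K`. -/
structure CentralDivisionAlgebra (K : Type) [Field K] (d : ℕ) where
  carrier : Type
  [divisionRing : DivisionRing carrier]
  [algebra : Algebra K carrier]
  central : Algebra.IsCentral K carrier
  finite : FiniteDimensional K carrier
  deg : Module.finrank K carrier = d ^ 2

attribute [instance] CentralDivisionAlgebra.divisionRing CentralDivisionAlgebra.algebra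

section

universe u

open WithZero IsLocalRing IsDedekindDomain NumberField Module
open scoped TensorProduct

set_option linter.unusedSectionVars false

/-- Nonzero elements that are squares up to a factor `1 + 4 * ε` with `ε` small. -/
def localSquares {K : Type*} [Field K] (w : Valuation K ℤᵐ⁰) : Subgroup Kˣ where
  carrier := {x | ∃ ε y : K, w ε < 1 ∧ (x : K) * (1 + 4 * ε) = y ^ 2}
  one_mem' := ⟨0, 1, by simp, by simp⟩
  mul_mem' := by
    rintro x x' ⟨ε, y, h, e⟩ ⟨ε', y', h', e'⟩
    refine ⟨ε + ε' + 4 * ε * ε', y * y', ?_, ?_⟩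
    · refine (w.map_add _ _).trans_lt (max_lt ((w.map_add _ _).trans_lt (max_lt h h')) ?_)
      have h4 : w 4 ≤ 1 := by
        have := w.map_add_le (x := 2) (y := 2) (g := 1) ?_ ?_ <;> norm_num at * <;> try exact this
        all_goals
          have := w.map_add_le (x := 1) (y := 1) (g := 1) (by simp) (by simp)
          norm_num at this; exact this
      rw [map_mul, map_mul]
      calc w 4 * w ε * w ε' ≤ 1 * 1 * w ε' := by gcongr
        _ < 1 := by simpa
    · push_cast
      rw [mul_pow, ← e, ← e']; ring
  inv_mem' := by
    rintro x ⟨ε, y, h, e⟩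
    exact ⟨ε, y / x, h, by rw [div_pow, ← e]; push_cast; field_simp [x.ne_zero]⟩

theorem Valuation.map_two_le_one {K : Type*} [Field K] (w : Valuation K ℤᵐ⁰) : w 2 ≤ 1 := by
  have := w.map_add_le (x := 1) (y := 1) (g := 1) (by simp) (by simp)
  norm_num at this; exact this

theorem Valuation.map_four {K : Type*} [Field K] (w : Valuation K ℤᵐ⁰) : w 4 = w 2 ^ 2 := by
  rw [← map_pow]; norm_num

theorem Valuation.map_four_le_one {K : Type*} [Field K] (w : Valuation K ℤᵐ⁰) : w 4 ≤ 1 := by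
  rw [w.map_four]; exact pow_le_one₀ zero_le w.map_two_le_one

/-- Nonzero elements that are norms `y ^ 2 - b * z ^ 2` up to a factor `1 + 4 * ε` with `ε`
small. -/
def localNorms {K : Type*} [Field K] (w : Valuation K ℤᵐ⁰) (b : K) : Subgroup Kˣ where
  carrier := {x | ∃ ε y z : K, w ε < 1 ∧ (x : K) * (1 + 4 * ε) = y ^ 2 - b * z ^ 2}
  one_mem' := ⟨0, 1, 0, by simp, by simp⟩
  mul_mem' := by
    rintro x x' ⟨ε, y, z, h, e⟩ ⟨ε', y', z', h', e'⟩
    refine ⟨ε + ε' + 4 * ε * ε', y * y' + b * z * z', y * z' + z * y', ?_, ?_⟩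
    · refine (w.map_add _ _).trans_lt (max_lt ((w.map_add _ _).trans_lt (max_lt h h')) ?_)
      rw [map_mul, map_mul]
      calc w 4 * w ε * w ε' ≤ 1 * 1 * w ε' := by gcongr; exact w.map_four_le_one
        _ < 1 := by simpa
    · push_cast
      linear_combination (x' : K) * (1 + 4 * ε') * e + (y ^ 2 - b * z ^ 2) * e'
  inv_mem' := by
    rintro x ⟨ε, y, z, h, e⟩
    refine ⟨ε, y / x, z / x, h, ?_⟩
    rw [div_pow, div_pow, ← mul_div_assoc, ← sub_div, ← e]; push_cast; field_simp [x.ne_zero]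

section Basic
variable {K : Type*} [Field K] {w : Valuation K ℤᵐ⁰}

theorem localSquares_le_localNorms (b : K) : localSquares w ≤ localNorms w b := by
  rintro x ⟨ε, y, h, e⟩
  exact ⟨ε, y, 0, h, by simpa using e⟩

theorem sq_mem_localSquares (x : Kˣ) : x ^ 2 ∈ localSquares w :=
  ⟨0, x, by simp, by simp⟩

theorem mul_self_mem_localSquares (x : Kˣ) : x * x ∈ localSquares w :=
  sq x ▸ sq_mem_localSquares x

theorem mem_localNorms_of_eq {x : Kˣ} {b y z : K} (h : (x : K) = y ^ 2 - b * z ^ 2) :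
    x ∈ localNorms w b := ⟨0, y, z, by simp, by simpa using h⟩

/-- An element close to `y ^ 2` is a local square. -/
theorem mem_localSquares_of_lt [CharZero K] {x : Kˣ} {y : K} (h : w (y ^ 2 - x) < w 4 * w x) :
    x ∈ localSquares w := by
  refine ⟨(y ^ 2 - x) / (4 * x), y, ?_, ?_⟩
  · rw [map_div₀, map_mul]
    exact (div_lt_one₀ (zero_le.trans_lt h)).2 h
  · field_simp [x.ne_zero]; ring

theorem mem_localNorms_of_lt [CharZero K] {x : Kˣ} {b y z : K}
    (h : w (y ^ 2 - b * z ^ 2 - x) < w 4 * w x) : x ∈ localNorms w b := by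
  refine ⟨(y ^ 2 - b * z ^ 2 - x) / (4 * x), y, z, ?_, ?_⟩
  · rw [map_div₀, map_mul]
    exact (div_lt_one₀ (zero_le.trans_lt h)).2 h
  · field_simp [x.ne_zero]; ring

theorem map_one_add_four_mul {ε : K} (h : w ε < 1) : w (1 + 4 * ε) = 1 := by
  have : w (4 * ε) < 1 := by
    rw [map_mul]
    calc w 4 * w ε ≤ 1 * w ε := by gcongr; exact w.map_four_le_one
      _ < 1 := by simpa
  rw [w.map_add_eq_of_lt_left (by simpa using this), map_one]

end Basic

section Residue
variable {K : Type*} [Field K] {w : Valuation K ℤᵐ⁰}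

theorem residue_eq_zero_iff_map_lt_one (x : w.valuationSubring) :
    residue w.valuationSubring x = 0 ↔ w (x : K) < 1 := by
  rw [residue_eq_zero_iff, w.isEquiv_valuation_valuationSubring.lt_one_iff_lt_one]
  exact w.valuationSubring.valuation_lt_one_iff x

theorem residue_eq_iff_map_sub_lt_one (x y : w.valuationSubring) :
    residue w.valuationSubring x = residue w.valuationSubring y ↔ w (x - y : K) < 1 := by
  rw [← sub_eq_zero, ← map_sub, residue_eq_zero_iff_map_lt_one]; rfl

/-- In a local field with finite residue field, some Artin-Schreier polynomial has no root
modulo the maximal ideal. -/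
theorem exists_artinSchreier [Finite (ResidueField w.valuationSubring)] :
    ∃ ρ : K, w ρ ≤ 1 ∧ ∀ x : K, w x ≤ 1 → w (x ^ 2 + x - ρ) = 1 := by
  let k := ResidueField w.valuationSubring
  have : ¬ Function.Surjective (fun x : k => x ^ 2 + x) := fun h => by
    have := (Finite.injective_iff_surjective.2 h) (a₁ := 0) (a₂ := -1) (by ring)
    simp at this
  simp only [Function.Surjective, not_forall, not_exists] at this
  obtain ⟨r, hr⟩ := this
  obtain ⟨ρ, rfl⟩ := residue_surjective r
  refine ⟨ρ, ρ.2, fun x hx => ?_⟩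
  have h1 : w (x ^ 2 + x - ρ) ≤ 1 := by
    have := (⟨x, hx⟩ ^ 2 + ⟨x, hx⟩ - ρ : w.valuationSubring).2
    exact this
  refine h1.eq_of_not_lt fun hlt => hr (residue w.valuationSubring ⟨x, hx⟩) ?_
  rw [← map_pow, ← map_add, residue_eq_iff_map_sub_lt_one]
  exact hlt

/-- The valuation of the norm form of the unramified quadratic extension. -/
theorem map_artinSchreier_form {ρ : K} (hρ : ∀ x : K, w x ≤ 1 → w (x ^ 2 + x - ρ) = 1)
    (hρ1 : w ρ ≤ 1) (X Y : K) : w (X ^ 2 + X * Y - ρ * Y ^ 2) = max (w X) (w Y) ^ 2 := by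
  by_cases hXY : w X ≤ w Y
  · rw [max_eq_right hXY]
    by_cases hY : Y = 0
    · subst hY
      have : X = 0 := by simpa using hXY
      simp [this]
    have := hρ (X / Y) (by rw [map_div₀]; exact div_le_one_of_le₀ hXY zero_le)
    rw [show X ^ 2 + X * Y - ρ * Y ^ 2 = ((X / Y) ^ 2 + X / Y - ρ) * Y ^ 2 by field_simp,
      map_mul, this, one_mul, map_pow]
  · push Not at hXY
    rw [max_eq_left hXY.le]
    have hX : X ≠ 0 := by rintro rfl; simp at hXY
    have h1 : w (Y / X) < 1 := by
      rw [map_div₀]; exact (div_lt_one₀ (zero_le.trans_lt hXY)).2 hXY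
    have h2 : w (Y / X - ρ * (Y / X) ^ 2) < 1 := by
      refine (w.map_sub _ _).trans_lt (max_lt h1 ?_)
      rw [map_mul, map_pow]
      calc w ρ * w (Y / X) ^ 2 ≤ 1 * w (Y / X) ^ 2 := by gcongr
        _ < 1 := by rw [one_mul]; exact pow_lt_one₀ zero_le h1 two_ne_zero
    rw [show X ^ 2 + X * Y - ρ * Y ^ 2 = (1 + (Y / X - ρ * (Y / X) ^ 2)) * X ^ 2 by
      field_simp; ring, map_mul, map_pow, w.map_add_eq_of_lt_left (by simpa using h2), map_one,
      one_mul]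

theorem map_sq_sub_artinSchreier {ρ : K} (hρ : ∀ x : K, w x ≤ 1 → w (x ^ 2 + x - ρ) = 1)
    (hρ1 : w ρ ≤ 1) (y z : K) :
    w (y ^ 2 - (1 + 4 * ρ) * z ^ 2) = max (w (y - z)) (w (2 * z)) ^ 2 := by
  rw [← map_artinSchreier_form hρ hρ1]; ring_nf

theorem artinSchreier_congr {ρ ρ' : K} (hρ : ∀ x : K, w x ≤ 1 → w (x ^ 2 + x - ρ) = 1)
    (h : w (ρ' - ρ) < 1) : ∀ x : K, w x ≤ 1 → w (x ^ 2 + x - ρ') = 1 := fun x hx => by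
  rw [← hρ x hx, show x ^ 2 + x - ρ' = (x ^ 2 + x - ρ) - (ρ' - ρ) by ring,
    w.map_sub_eq_of_lt_left]
  rwa [hρ x hx]

theorem le_one_congr {ρ ρ' : K} (hρ : w ρ ≤ 1) (h : w (ρ' - ρ) < 1) : w ρ' ≤ 1 := by
  rw [show ρ' = ρ' - ρ + ρ by ring]
  exact w.map_add_le h.le hρ

theorem map_artinSchreier_disc {ρ : K} (hρ : ∀ x : K, w x ≤ 1 → w (x ^ 2 + x - ρ) = 1)
    (hρ1 : w ρ ≤ 1) : w (1 + 4 * ρ) = 1 := by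
  have := map_sq_sub_artinSchreier hρ hρ1 0 1
  rw [show (0 : K) ^ 2 - (1 + 4 * ρ) * 1 ^ 2 = -(1 + 4 * ρ) by ring, w.map_neg] at this
  rw [this]
  simp [max_eq_left w.map_two_le_one]

theorem isSquare_map_of_mem_localNorms_disc {ρ : K}
    (hρ : ∀ x : K, w x ≤ 1 → w (x ^ 2 + x - ρ) = 1)
    (hρ1 : w ρ ≤ 1) {x : Kˣ} (h : x ∈ localNorms w (1 + 4 * ρ)) : IsSquare (w (x : K)) := by
  obtain ⟨ε, y, z, h, e⟩ := h
  refine ⟨max (w (y - z)) (w (2 * z)), ?_⟩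
  have := congrArg w e
  rwa [map_mul, map_one_add_four_mul h, mul_one, map_sq_sub_artinSchreier hρ hρ1, sq] at this

/-- The unramified discriminant is not a norm from an extension with `b` of odd valuation. -/
theorem artinSchreier_disc_not_mem_localNorms [CharZero K] {ρ b : K}
    (hρ : ∀ x : K, w x ≤ 1 → w (x ^ 2 + x - ρ) = 1) (hρ1 : w ρ ≤ 1) (hb : ¬ IsSquare (w b))
    {x : Kˣ} (hx : (x : K) = 1 + 4 * ρ) : x ∉ localNorms w b := by
  rintro ⟨ε, y, z, h, e⟩
  set ρ' := ρ + ε * (1 + 4 * ρ) with hρ'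
  have hd : w (ρ' - ρ) < 1 := by
    rw [hρ', add_sub_cancel_left, map_mul, map_artinSchreier_disc hρ hρ1, mul_one]; exact h
  have e' : b * z ^ 2 = y ^ 2 - (1 + 4 * ρ') * 1 ^ 2 := by
    rw [hx] at e; rw [hρ']; linear_combination e
  have hs := map_sq_sub_artinSchreier (artinSchreier_congr hρ hd) (le_one_congr hρ1 hd) y 1
  rw [← e', map_mul, map_pow] at hs
  have hpos : max (w (y - 1)) (w (2 * 1)) ≠ 0 := by
    intro h0
    have h2 : w (2 * 1) ≤ 0 := h0 ▸ le_max_right _ _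
    simp at h2
  have hz : w z ≠ 0 := fun hz => hpos (by simpa [hz] using hs.symm)
  refine hb ⟨max (w (y - 1)) (w (2 * 1)) / w z, ?_⟩
  rw [div_mul_div_comm, ← sq, ← hs, ← sq]
  field_simp
end Residue

theorem not_isSquare_exp_neg_one : ¬ IsSquare (exp (-1 : ℤ) : ℤᵐ⁰) := by
  rintro ⟨a, ha⟩
  have h0 : a ≠ 0 := by rintro rfl; simp at ha
  have := congrArg log ha
  rw [log_mul h0 h0, log_exp] at this
  omega

theorem WithZero.sq_lt_sq_iff' {a b : ℤᵐ⁰} : a ^ 2 < b ^ 2 ↔ a < b :=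
  pow_lt_pow_iff_left₀ zero_le zero_le two_ne_zero

theorem localNorms_mul_sq {K : Type*} [Field K] {w : Valuation K ℤᵐ⁰} (b : K) {y : K} (hy : y ≠ 0) :
    localNorms w (b * y ^ 2) = localNorms w b := by
  ext x
  constructor
  · rintro ⟨ε, s, t, h, e⟩
    exact ⟨ε, s, y * t, h, by rw [e]; ring⟩
  · rintro ⟨ε, s, t, h, e⟩
    exact ⟨ε, s, t / y, h, by rw [e]; field_simp⟩

section
variable {K : Type*} [Field K] [CharZero K] {w : Valuation K ℤᵐ⁰}

theorem exists_best_square_approximation (hw : Function.Surjective w) {b : Kˣ}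
    (hb : b ∉ localSquares w) (hs : IsSquare (w (b : K))) :
    ∃ y : K, w y ^ 2 = w b ∧ w 4 ≤ w (b / y ^ 2 - 1) ∧ w (b / y ^ 2 - 1) ≤ 1 ∧
      ∀ y' : K, w y' ^ 2 = w b → w (b / y ^ 2 - 1) ≤ w (b / y' ^ 2 - 1) := by
  have hbv : w (b : K) ≠ 0 := by simp
  have key : ∀ y : K, w y ^ 2 = w b → w 4 ≤ w (b / y ^ 2 - 1) ∧ w (b / y ^ 2 - 1) ≤ 1 := by
    intro y hy
    have hy0 : y ≠ 0 := by rintro rfl; exact hbv (by simp [← hy])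
    constructor
    · by_contra! hlt
      refine hb (mem_localSquares_of_lt (y := y) ?_)
      rw [w.map_sub_swap, ← hy, show (b : K) - y ^ 2 = (b / y ^ 2 - 1) * y ^ 2 by field_simp,
        map_mul, map_pow]
      have : 0 < w y ^ 2 := pow_pos (by simpa [zero_lt_iff] using hy0) 2
      gcongr
    · refine (w.map_sub _ _).trans (max_le ?_ (by simp))
      rw [map_div₀, map_pow, hy, div_self hbv]
  obtain ⟨t, ht⟩ := hs
  obtain ⟨y0, hy0⟩ := hw t
  let f : {y : K // w y ^ 2 = w b} → ℕ := fun y => (log (w (b / y.1 ^ 2 - 1)) - log (w 4)).toNat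
  obtain ⟨y, -, hy⟩ := (measure f).wf.has_min Set.univ ⟨⟨y0, by rw [hy0, ht, sq]⟩, trivial⟩
  have h4 : w 4 ≠ 0 := by simp
  refine ⟨y, y.2, (key y y.2).1, (key y y.2).2, fun y' hy' => ?_⟩
  by_contra! hlt
  refine hy ⟨y', hy'⟩ trivial ?_
  change (log (w (b / y' ^ 2 - 1)) - log (w 4)).toNat < (log (w (b / y.1 ^ 2 - 1)) - log (w 4)).toNat
  have h1 : w (b / y' ^ 2 - 1) ≠ 0 := fun h0 => h4 (by
    have := (key y' hy').1; rwa [h0, le_zero_iff] at this)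
  have h2 := (log_lt_log h1 (fun h0 => by simp [h0] at hlt)).2 hlt
  have h3 := (log_le_log h4 h1).2 (key y' hy').1
  omega

theorem exists_residue_sq {K : Type*} [Field K] {w : Valuation K ℤᵐ⁰}
    [Finite (ResidueField w.valuationSubring)] (h2 : w 2 < 1) {u : K}
    (hu : w u ≤ 1) : ∃ s : K, w s ≤ 1 ∧ w (u - s ^ 2) < 1 := by
  let k := ResidueField w.valuationSubring
  have h20 : (2 : k) = 0 := by
    rw [show (2 : k) = residue w.valuationSubring 2 from (map_ofNat (residue _) 2).symm, residue_eq_zero_iff_map_lt_one]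
    exact h2
  have hinj : Function.Injective (fun x : k => x ^ 2) := fun a b (h : a ^ 2 = b ^ 2) => by
    have : (a - b) ^ 2 = 0 := by linear_combination h + (b ^ 2 - a * b) * h20
    exact sub_eq_zero.1 (pow_eq_zero_iff two_ne_zero |>.1 this)
  obtain ⟨r, hr⟩ := (Finite.injective_iff_surjective.1 hinj) (residue w.valuationSubring ⟨u, hu⟩)
  obtain ⟨s, rfl⟩ := residue_surjective r
  refine ⟨s, s.2, ?_⟩
  have := (residue_eq_iff_map_sub_lt_one ⟨u, hu⟩ (s ^ 2)).1 (by rw [map_pow]; exact hr.symm)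
  exact this

/-- A discriminant `1 + δ` with `w δ` odd: the element `1 - 4 * ρ / δ` is not a norm. -/
theorem not_mem_localNorms_of_odd {ρ δ : K} (hρ : ∀ x : K, w x ≤ 1 → w (x ^ 2 + x - ρ) = 1)
    (hρ1 : w ρ ≤ 1) (hδ : ¬ IsSquare (w δ)) (hδ1 : w δ < 1) (h4 : w 4 < w δ) {x : Kˣ}
    (hx : (x : K) = 1 - 4 * ρ / δ) : x ∉ localNorms w (1 + δ) := by
  rintro ⟨ε, y, z, h, e⟩
  have hδ0 : δ ≠ 0 := by rintro rfl; simp at h4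
  have hwδ : w δ ≠ 0 := by simpa using hδ0
  have hβ : w (4 * ρ / δ) < 1 := by
    rw [map_div₀, map_mul]
    refine (div_lt_one₀ (zero_lt_iff.2 hwδ)).2 (lt_of_le_of_lt ?_ h4)
    exact mul_le_of_le_one_right' hρ1
  have hx1 : w (x : K) = 1 := by
    rw [hx, sub_eq_add_neg, w.map_add_eq_of_lt_left, map_one]
    rwa [w.map_neg, map_one]
  set ρ' := ρ - ε * δ * x with hρ'
  have hd : w (ρ' - ρ) < 1 := by
    rw [hρ', sub_sub_cancel_left, w.map_neg, map_mul, hx1, mul_one, map_mul]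
    exact mul_lt_one_of_nonneg_of_lt_one_left zero_le h hδ1.le
  have hρ2 := artinSchreier_congr hρ hd
  have hρ3 := le_one_congr hρ1 hd
  -- `y0 = -δ * (x * (1 + 4 * ε))` is a norm of `m + n √(1 + δ)`
  have e1 : (x : K) * (1 + 4 * ε) * δ = δ - 4 * ρ' := by
    rw [hρ']
    have : (x : K) * δ = δ - 4 * ρ := by rw [hx]; field_simp
    linear_combination this
  obtain ⟨m, hm⟩ : ∃ m, m = y + (1 + δ) * z := ⟨_, rfl⟩
  obtain ⟨n, hn⟩ : ∃ n, n = y + z := ⟨_, rfl⟩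
  have e2 : m ^ 2 - (1 + δ) * n ^ 2 = 4 * ρ' - δ := by
    rw [hm, hn]; linear_combination δ * e - e1
  have hX : w (1 + δ) = 1 := by rw [w.map_add_eq_of_lt_left, map_one]; rwa [map_one]
  have hβ' : w (4 * ρ') < w δ := by
    rw [map_mul]; exact lt_of_le_of_lt (mul_le_of_le_one_right' hρ3) h4
  have hy0 : w (4 * ρ' - δ) = w δ := by
    rw [w.map_sub_swap, w.map_sub_eq_of_lt_left hβ']
  have hid : (1 + 4 * ρ') * m ^ 2 = ((1 + δ) * n + (4 * ρ' - δ)) ^ 2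
      + (1 + δ) * (4 * ρ' - δ) * (1 - n) ^ 2 := by
    linear_combination (1 + 4 * ρ') * e2
  have hs := map_sq_sub_artinSchreier hρ2 hρ3 ((1 + δ) * n + (4 * ρ' - δ)) m
  rw [hid, sub_add_cancel_left, w.map_neg, map_mul, map_mul, hX, hy0, one_mul, map_pow] at hs
  by_cases hn1 : w (1 - n) = 0
  · have hn1' : n = 1 := by rw [Valuation.zero_iff, sub_eq_zero] at hn1; exact hn1.symm
    rw [hn1, zero_pow two_ne_zero, mul_zero] at hs
    have h0 := (pow_eq_zero_iff two_ne_zero).1 hs.symm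
    have h1 : w ((1 + δ) * n + (4 * ρ' - δ) - m) ≤ 0 := h0 ▸ le_max_left _ _
    have h2 : w (2 * m) ≤ 0 := h0 ▸ le_max_right _ _
    have hm0 : m = 0 := by simpa using h2
    rw [hn1', hm0, le_zero_iff, Valuation.zero_iff] at h1
    have h3 := map_artinSchreier_disc hρ2 hρ3
    rw [show 1 + 4 * ρ' = (1 + δ) * 1 + (4 * ρ' - δ) - 0 by ring, h1, map_zero] at h3
    exact zero_ne_one h3
  · refine hδ ⟨max (w ((1 + δ) * n + (4 * ρ' - δ) - m)) (w (2 * m)) / w (1 - n), ?_⟩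
    rw [div_mul_div_comm, ← sq, ← hs, ← sq]
    field_simp

/-- Local nondegeneracy of the norm residue symbol: a nonsquare admits a non-norm. -/
theorem exists_not_mem_localNorms (hw : Function.Surjective w)
    [Finite (ResidueField w.valuationSubring)] {b : Kˣ} (hb : b ∉ localSquares w) :
    ∃ x : Kˣ, x ∉ localNorms w (b : K) := by
  obtain ⟨ρ, hρ1, hρ⟩ := exists_artinSchreier (w := w)
  by_cases hs : IsSquare (w (b : K))
  swap
  · have h1 : 1 + 4 * ρ ≠ 0 := by
      intro h; have := map_artinSchreier_disc hρ hρ1; simp [h] at this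
    exact ⟨Units.mk0 _ h1, artinSchreier_disc_not_mem_localNorms hρ hρ1 hs rfl⟩
  obtain ⟨y, hy, h4, h1, hmin⟩ := exists_best_square_approximation hw hb hs
  have hy0 : y ≠ 0 := by rintro rfl; simp at hy; exact b.ne_zero (by simpa using hy.symm)
  set δ := (b : K) / y ^ 2 - 1 with hδ
  have hbδ : (b : K) = (1 + δ) * y ^ 2 := by rw [hδ]; field_simp; ring
  have hunit : w (1 + δ) = 1 := by
    rw [hδ, add_sub_cancel, map_div₀, map_pow, hy]; exact div_self (by simp)
  have hmin' : ∀ s : K, w s = 1 → w δ ≤ w (1 + δ - s ^ 2) := by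
    intro s hs
    have := hmin (y * s) (by rw [map_mul, hs, mul_one, hy])
    rw [show (b : K) / (y * s) ^ 2 - 1 = (1 + δ - s ^ 2) / s ^ 2 by
      have : s ≠ 0 := by rintro rfl; simp at hs
      rw [hbδ]; field_simp] at this
    simpa [map_div₀, hs] using this
  rw [hbδ, localNorms_mul_sq _ hy0]
  rcases h4.eq_or_lt with h4 | h4
  · -- unramified case
    have hσ1 : w (δ / 4) = 1 := by rw [map_div₀, ← h4]; exact div_self (by simp)
    have hσ : ∀ x : K, w x ≤ 1 → w (x ^ 2 + x - δ / 4) = 1 := by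
      intro x hx
      have hle : w (x ^ 2 + x - δ / 4) ≤ 1 := by
        refine (w.map_sub _ _).trans (max_le ((w.map_add _ _).trans (max_le ?_ hx)) hσ1.le)
        rw [map_pow]; exact pow_le_one₀ zero_le hx
      refine hle.eq_of_not_lt fun hlt => ?_
      have e : 1 + δ - (1 + 2 * x) ^ 2 = -(4 * (x ^ 2 + x - δ / 4)) := by ring
      have hlt' : w (1 + δ - (1 + 2 * x) ^ 2) < w 4 := by
        rw [e, w.map_neg, map_mul]
        exact mul_lt_of_lt_one_right (by simp [zero_lt_iff]) hlt
      have h3 : w (1 + 2 * x) = 1 := by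
        have : w ((1 + 2 * x) ^ 2) = 1 := by
          rw [← hunit, ← w.map_sub_eq_of_lt_left (x := 1 + δ) (y := 1 + δ - (1 + 2 * x) ^ 2),
            sub_sub_cancel]
          rw [hunit]; exact hlt'.trans_le w.map_four_le_one
        rw [map_pow] at this
        exact (pow_eq_one_iff_of_nonneg zero_le two_ne_zero).1 this
      exact absurd (hmin' _ h3) (not_le.2 (h4 ▸ hlt'))
    obtain ⟨π, hπ⟩ := hw (exp (-1))
    have hπ0 : π ≠ 0 := by rintro rfl; rw [map_zero] at hπ; exact exp_ne_zero hπ.symm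
    refine ⟨Units.mk0 π hπ0, fun hm => not_isSquare_exp_neg_one ?_⟩
    rw [← hπ]
    refine isSquare_map_of_mem_localNorms_disc hσ hσ1.le (x := Units.mk0 π hπ0) ?_
    rwa [mul_div_cancel₀ δ (by norm_num : (4 : K) ≠ 0)]
  · -- ramified case
    have h2 : w 2 < 1 := by
      by_contra! h; rw [w.map_four] at h4
      have h2 : w 2 = 1 := le_antisymm w.map_two_le_one h
      rw [h2, one_pow] at h4
      exact absurd h1 (not_le.2 h4)
    have hδo : ¬ IsSquare (w δ) := by
      rintro ⟨t', ht'⟩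
      obtain ⟨t, rfl⟩ := hw t'
      have hδ0 : 0 < w δ := zero_le.trans_lt h4
      have ht0 : w t ≠ 0 := by intro h; simp [ht', h] at hδ0
      obtain ⟨s, hs1, hs⟩ := exists_residue_sq h2 (u := δ / t ^ 2) (by
        rw [map_div₀, map_pow, ht', ← sq]; exact (div_self (pow_ne_zero 2 ht0)).le)
      have hlt : w (1 + δ - (1 + t * s) ^ 2) < w δ := by
        have ht : t ≠ 0 := by simpa using ht0
        rw [show 1 + δ - (1 + t * s) ^ 2 = (δ / t ^ 2 - s ^ 2) * t ^ 2 - 2 * t * s by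
          field_simp; ring]
        refine (w.map_sub _ _).trans_lt (max_lt ?_ ?_)
        · rw [map_mul, map_pow, sq (w t), ← ht']
          exact mul_lt_of_lt_one_left hδ0 hs
        · rw [map_mul, map_mul]
          refine lt_of_le_of_lt (mul_le_of_le_one_right' hs1) ?_
          rw [ht']
          refine mul_lt_mul_of_pos_right ?_ (zero_lt_iff.2 ht0)
          rw [← WithZero.sq_lt_sq_iff', ← w.map_four, sq, ← ht']; exact h4
      have h3 : w (1 + t * s) = 1 := by
        have : w ((1 + t * s) ^ 2) = 1 := by
          rw [← hunit, ← w.map_sub_eq_of_lt_left (x := 1 + δ) (y := 1 + δ - (1 + t * s) ^ 2),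
            sub_sub_cancel]
          rw [hunit]; exact hlt.trans_le h1
        rw [map_pow] at this
        exact (pow_eq_one_iff_of_nonneg zero_le two_ne_zero).1 this
      exact absurd (hmin' _ h3) (not_le.2 hlt)
    have hδ1 : w δ < 1 := h1.lt_of_ne fun h => hδo (h ▸ IsSquare.one)
    have hx0 : 1 - 4 * ρ / δ ≠ 0 := by
      intro h0
      have : w (4 * ρ / δ) < 1 := by
        rw [map_div₀, map_mul]
        refine (div_lt_one₀ (zero_le.trans_lt h4)).2 (lt_of_le_of_lt ?_ h4)
        exact mul_le_of_le_one_right' hρ1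
      rw [← sub_eq_zero.1 h0, map_one] at this
      exact lt_irrefl _ this
    exact ⟨Units.mk0 _ hx0, not_mem_localNorms_of_odd hρ hρ1 hδo hδ1 h4 rfl⟩
end

section
variable {K : Type*} [Field K] [CharZero K] {w : Valuation K ℤᵐ⁰}

theorem mem_localSquares_of_odd_of_lt (h2 : w 2 = 1) {u : Kˣ} (hu : w (u : K) = 1) {y : K}
    (h : w (y ^ 2 - u) < 1) : u ∈ localSquares w :=
  mem_localSquares_of_lt (y := y) (by rw [w.map_four, h2, hu, mul_one, one_pow]; exact h)

theorem residue_isSquare_iff (h2 : w 2 = 1) {u : Kˣ} (hu : w (u : K) = 1) :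
    IsSquare (residue w.valuationSubring ⟨u, hu.le⟩) ↔ u ∈ localSquares w := by
  constructor
  · rintro ⟨r, hr⟩
    obtain ⟨y, rfl⟩ := residue_surjective r
    refine mem_localSquares_of_odd_of_lt h2 hu (y := y) ?_
    have := (residue_eq_iff_map_sub_lt_one (y ^ 2) (⟨u, hu.le⟩ : w.valuationSubring)).1 (by rw [map_pow, hr, sq])
    exact this
  · rintro ⟨ε, y, hε, e⟩
    have hy : w y = 1 := by
      have := congrArg w e
      rw [map_mul, map_one_add_four_mul hε, hu, one_mul, map_pow] at this
      exact (pow_eq_one_iff_of_nonneg zero_le two_ne_zero).1 this.symm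
    refine ⟨residue w.valuationSubring ⟨y, hy.le⟩, ?_⟩
    rw [← sq, ← map_pow, residue_eq_iff_map_sub_lt_one]
    change w (u - y ^ 2) < 1
    rw [← e, show (u : K) - u * (1 + 4 * ε) = - (u * 4 * ε) by ring, w.map_neg, map_mul, map_mul,
      w.map_four, h2, hu]
    simpa using hε

theorem mul_mem_localSquares_of_odd [Finite (ResidueField w.valuationSubring)] (h2 : w 2 = 1)
    {u v : Kˣ} (hu : w (u : K) = 1) (hv : w (v : K) = 1) (hu' : u ∉ localSquares w)
    (hv' : v ∉ localSquares w) : u * v ∈ localSquares w := by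
  have : Fintype (ResidueField w.valuationSubring) := Fintype.ofFinite _
  classical
  rw [← residue_isSquare_iff h2 hu] at hu'
  rw [← residue_isSquare_iff h2 hv] at hv'
  have huv : w ((u * v : Kˣ) : K) = 1 := by rw [Units.val_mul, map_mul, hu, hv, one_mul]
  rw [← residue_isSquare_iff h2 huv]
  have e : residue w.valuationSubring ⟨(u * v : Kˣ), huv.le⟩ =
      residue w.valuationSubring ⟨u, hu.le⟩ * residue w.valuationSubring ⟨v, hv.le⟩ := by
    rw [← map_mul]; rfl
  have hc : ringChar (ResidueField w.valuationSubring) ≠ 2 := by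
    intro hc
    have h20 : (2 : ResidueField w.valuationSubring) = 0 := by
      have := ringChar.Nat.cast_ringChar (R := ResidueField w.valuationSubring)
      rw [hc] at this; exact_mod_cast this
    rw [show (2 : ResidueField w.valuationSubring) = residue w.valuationSubring 2 from
      (map_ofNat (residue _) 2).symm, residue_eq_zero_iff_map_lt_one] at h20
    exact h20.ne h2
  rw [e]
  have hne : ∀ x, ¬ IsSquare x → quadraticChar (ResidueField w.valuationSubring) x = -1 :=
    fun x hx => quadraticChar_neg_one_iff_not_isSquare.2 hx
  have hmul : quadraticChar (ResidueField w.valuationSubring)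
      (residue w.valuationSubring ⟨u, hu.le⟩ * residue w.valuationSubring ⟨v, hv.le⟩) = 1 := by
    rw [map_mul, hne _ hu', hne _ hv']; norm_num
  refine (quadraticChar_one_iff_isSquare ?_).1 hmul
  intro h0
  rw [h0, quadraticChar_zero] at hmul
  exact zero_ne_one hmul

theorem mem_localNorms_of_units [Finite (ResidueField w.valuationSubring)] (h2 : w 2 = 1)
    {a : Kˣ} {b : K} (ha : w (a : K) = 1) (hb : w b = 1) : a ∈ localNorms w b := by
  have : Fintype (ResidueField w.valuationSubring) := Fintype.ofFinite _
  let k := ResidueField w.valuationSubring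
  let A : k := residue w.valuationSubring ⟨a, ha.le⟩
  let B : k := residue w.valuationSubring ⟨b, hb.le⟩
  have hB : B ≠ 0 := fun h0 => by
    rw [residue_eq_zero_iff_map_lt_one] at h0
    exact h0.ne hb
  have hodd : Fintype.card k % 2 = 1 := by
    apply FiniteField.odd_card_of_char_ne_two
    intro hc
    have h20 : (2 : ResidueField w.valuationSubring) = 0 := by
      have := ringChar.Nat.cast_ringChar (R := ResidueField w.valuationSubring)
      rw [hc] at this; exact_mod_cast this
    rw [show (2 : ResidueField w.valuationSubring) = residue w.valuationSubring 2 from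
      (map_ofNat (residue _) 2).symm, residue_eq_zero_iff_map_lt_one] at h20
    exact h20.ne h2
  obtain ⟨y, z, hyz⟩ := FiniteField.exists_root_sum_quadratic (R := k)
    (f := Polynomial.X ^ 2) (g := Polynomial.C (-B) * Polynomial.X ^ 2 + Polynomial.C (-A))
    (by simp) (by
      rw [Polynomial.degree_add_C]
      · rw [Polynomial.degree_C_mul_X_pow 2 (neg_ne_zero.2 hB)]; rfl
      · rw [Polynomial.degree_C_mul_X_pow 2 (neg_ne_zero.2 hB)]; norm_num) hodd
  simp only [Polynomial.eval_pow, Polynomial.eval_X, Polynomial.eval_add, Polynomial.eval_mul,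
    Polynomial.eval_C] at hyz
  obtain ⟨y, rfl⟩ := residue_surjective y
  obtain ⟨z, rfl⟩ := residue_surjective z
  refine mem_localNorms_of_lt (y := y) (z := z) ?_
  rw [w.map_four, h2, ha, one_pow, mul_one]
  have := (residue_eq_zero_iff_map_lt_one (y ^ 2 - ⟨b, hb.le⟩ * z ^ 2 - ⟨a, ha.le⟩)).1 (by
    rw [map_sub, map_sub, map_mul, map_pow, map_pow, ← hyz]; ring)
  exact this

theorem WithZero.sq_ne_mul_sq {a b c : ℤᵐ⁰} (hb : ¬ IsSquare b) (hc : c ≠ 0) :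
    a ^ 2 ≠ b * c ^ 2 := by
  intro h
  refine hb ⟨a / c, ?_⟩
  rw [div_mul_div_comm, ← sq, ← sq, h]
  field_simp

theorem not_mem_localNorms_of_not_isSquare (h2 : w 2 = 1) {u : Kˣ} {b : K} (hu : w (u : K) = 1)
    (hu' : u ∉ localSquares w) (hb : ¬ IsSquare (w b)) : u ∉ localNorms w b := by
  rintro ⟨ε, y, z, hε, e⟩
  have he := congrArg w e
  rw [map_mul, map_one_add_four_mul hε, hu, one_mul] at he
  have key : w (y ^ 2 - u) < 1 → False := fun h =>
    hu' (mem_localSquares_of_odd_of_lt h2 hu h)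
  have hε4 : w (u * (4 * ε)) < 1 := by
    rw [map_mul, map_mul, w.map_four, h2, hu]; simpa using hε
  have hb0 : w (b * z ^ 2) < 1 → False := by
    intro h
    refine key ?_
    rw [show y ^ 2 - u = b * z ^ 2 + u * (4 * ε) by linear_combination -e]
    exact w.map_add_lt h hε4
  by_cases hz : w z = 0
  · exact hb0 (by simp [hz])
  have hne := WithZero.sq_ne_mul_sq (a := w y) hb hz
  rw [← map_pow, ← map_pow, ← map_mul] at hne
  rcases lt_or_gt_of_ne hne with h | h
  · rw [w.map_sub_eq_of_lt_right h, map_mul, map_pow] at he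
    exact WithZero.sq_ne_mul_sq (a := 1) hb hz (by simpa using he)
  · rw [w.map_sub_eq_of_lt_left h] at he
    exact hb0 (he ▸ h)

theorem isSquare_map_of_mem_localNorms (h2 : w 2 = 1) {x b : Kˣ} (hb : IsSquare (w (b : K)))
    (hb' : b ∉ localSquares w) (hx : x ∈ localNorms w (b : K)) : IsSquare (w (x : K)) := by
  obtain ⟨ε, y, z, hε, e⟩ := hx
  have he := congrArg w e
  rw [map_mul, map_one_add_four_mul hε, mul_one] at he
  obtain ⟨t, ht⟩ := hb
  rw [he]
  by_cases hyz : w (y ^ 2) = w (b * z ^ 2)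
  · by_cases hz : z = 0
    · subst hz; simp at hyz; simp [hyz]
    have hz' : w z ≠ 0 := by simpa using hz
    have : w (y ^ 2 - b * z ^ 2) = w (b * z ^ 2) := by
      refine le_antisymm ((w.map_sub _ _).trans (max_le hyz.le le_rfl)) ?_
      by_contra! hlt
      refine hb' (mem_localSquares_of_lt (y := y / z) ?_)
      rw [show (y / z) ^ 2 - (b : K) = (y ^ 2 - b * z ^ 2) / z ^ 2 by field_simp, w.map_four, h2,
        one_pow, one_mul, map_div₀, map_pow, div_lt_iff₀ (pow_pos (zero_lt_iff.2 hz') 2), ← map_pow, ← map_mul]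
      exact hlt
    rw [this]
    exact ⟨t * w z, by rw [map_mul, map_pow, ht, sq, mul_mul_mul_comm]⟩
  · rcases lt_or_gt_of_ne hyz with h | h
    · rw [w.map_sub_eq_of_lt_right h]
      exact ⟨t * w z, by rw [map_mul, map_pow, ht, sq, mul_mul_mul_comm]⟩
    · rw [w.map_sub_eq_of_lt_left h]
      exact ⟨w y, by rw [map_pow, sq]⟩
end

section
variable {K : Type*} [Field K] [NumberField K] (v : HeightOneSpectrum (𝓞 K))

theorem exists_integer_valuation_sub_lt {x : K} (hx : v.valuation K x ≤ 1) {γ : ℤᵐ⁰}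
    (hγ : γ ≠ 0) : ∃ r : 𝓞 K, v.valuation K (algebraMap (𝓞 K) K r - x) < γ :=
  v.exists_valuation_sub_lt_of_integer hx (Units.mk0 γ hγ)

instance finite_residueField_valuation : Finite (ResidueField (v.valuation K).valuationSubring) := by
  let f : 𝓞 K → ResidueField (v.valuation K).valuationSubring :=
    fun r => residue _ ⟨algebraMap (𝓞 K) K r, v.valuation_le_one r⟩
  refine Finite.of_surjective (fun q : 𝓞 K ⧸ v.asIdeal => f (Quotient.out q)) fun y => ?_
  obtain ⟨x, rfl⟩ := residue_surjective y
  obtain ⟨r, hr⟩ := exists_integer_valuation_sub_lt v x.2 one_ne_zero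
  refine ⟨Ideal.Quotient.mk _ r, ?_⟩
  simp only [f]
  rw [residue_eq_iff_map_sub_lt_one]
  have h1 : Quotient.out (Ideal.Quotient.mk v.asIdeal r) - r ∈ v.asIdeal := by
    rw [← Ideal.Quotient.eq]; exact Quotient.out_eq _
  rw [← v.valuation_lt_one_iff_mem (K := K)] at h1
  have h1' : v.valuation K (algebraMap _ K (Quotient.out (Ideal.Quotient.mk v.asIdeal r)) -
      algebraMap _ K r) < 1 := by rw [← map_sub]; exact h1
  have := (v.valuation K).map_add_lt h1' hr
  rwa [sub_add_sub_cancel] at this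

theorem valuation_le_exp_iff_mem (r : 𝓞 K) (n : ℕ) :
    v.valuation K (algebraMap (𝓞 K) K r) ≤ exp (-(n : ℤ)) ↔ r ∈ v.asIdeal ^ n := by
  rw [v.valuation_of_algebraMap]; exact v.intValuation_le_pow_iff_mem r n

theorem exists_valuation_two : ∃ n : ℕ, v.valuation K 2 = exp (-(n : ℤ)) ∧
    Ideal.absNorm (v.maxPowDividing (Ideal.span {(2 : 𝓞 K)})) = Ideal.absNorm v.asIdeal ^ n := by
  refine ⟨_, ?_, map_pow _ _ _⟩
  rw [← v.intValuation_if_neg (two_ne_zero), ← v.valuation_of_algebraMap (K := K)]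
  exact (congrArg _ (map_ofNat (algebraMap (𝓞 K) K) 2)).symm

/-- The number of square roots of one modulo a power of a prime. -/
theorem card_sqrt_one_le {n : ℕ} (hn : v.valuation K 2 = exp (-(n : ℤ))) :
    Nat.card (powMonoidHom 2 : (𝓞 K ⧸ v.asIdeal ^ (2 * n + 1))ˣ →* _).ker ≤
      2 * Ideal.absNorm v.asIdeal ^ n := by
  let I := v.asIdeal ^ (2 * n + 1)
  let J := v.asIdeal ^ (n + 1)
  have hIJ : I ≤ J := Ideal.pow_le_pow_right (by omega)
  have hv0 : v.asIdeal ≠ ⊥ := v.ne_bot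
  have : Finite (𝓞 K ⧸ I) := Ideal.finiteQuotientOfFreeOfNeBot _ (pow_ne_zero _ hv0)
  have : Finite (𝓞 K ⧸ J) := Ideal.finiteQuotientOfFreeOfNeBot _ (pow_ne_zero _ hv0)
  let φ : 𝓞 K ⧸ I →+* 𝓞 K ⧸ J := Ideal.Quotient.factor hIJ
  have hφ : Function.Surjective φ := Ideal.Quotient.factor_surjective hIJ
  let ψ := φ.toAddMonoidHom
  have hψ : Nat.card ψ.ker = Ideal.absNorm v.asIdeal ^ n := by
    have h1 := AddSubgroup.card_mul_index ψ.ker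
    have hr : ψ.range = ⊤ := AddMonoidHom.range_eq_top.2 hφ
    rw [AddSubgroup.index_ker, hr, AddSubgroup.card_top] at h1
    change _ * Submodule.cardQuot J = Submodule.cardQuot I at h1
    rw [← Ideal.absNorm_apply, ← Ideal.absNorm_apply, map_pow, map_pow,
      show 2 * n + 1 = n + (n + 1) by ring, pow_add _ n (n + 1)] at h1
    refine Nat.eq_of_mul_eq_mul_right (pow_pos ?_ _) h1
    exact Nat.pos_of_ne_zero (by rwa [Ne, Ideal.absNorm_eq_zero_iff])
  have key : ∀ x : 𝓞 K ⧸ I, x ^ 2 = 1 → φ x = 1 ∨ φ x = -1 := by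
    intro x hx
    obtain ⟨r, rfl⟩ := Ideal.Quotient.mk_surjective x
    rw [← map_pow, ← map_one (Ideal.Quotient.mk I), Ideal.Quotient.eq] at hx
    have h1 := (valuation_le_exp_iff_mem v _ _).2 hx
    by_contra! hne
    have e1 : φ (Ideal.Quotient.mk I r) = Ideal.Quotient.mk J r := rfl
    rw [e1, ← map_one (Ideal.Quotient.mk J), ← map_neg, Ne, Ne, Ideal.Quotient.eq,
      Ideal.Quotient.eq, ← valuation_le_exp_iff_mem (K := K), ← valuation_le_exp_iff_mem (K := K),
      not_le, not_le] at hne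
    obtain ⟨h2, h3⟩ := hne
    have hp : v.valuation K (algebraMap _ K (r ^ 2 - 1)) =
        v.valuation K (algebraMap _ K (r - 1)) * v.valuation K (algebraMap _ K (r - -1)) := by
      rw [← map_mul, ← map_mul]; ring_nf
    have hd : v.valuation K (algebraMap _ K (r - -1) - algebraMap _ K (r - 1)) =
        exp (-(n : ℤ)) := by
      rw [← hn]; congr 1; simp; ring
    rw [hp] at h1
    have h20 : v.valuation K (algebraMap _ K (r - 1)) ≠ 0 := fun h => by
      rw [h] at h2; exact not_lt_zero h2
    have h30 : v.valuation K (algebraMap _ K (r - -1)) ≠ 0 := fun h => by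
      rw [h] at h3; exact not_lt_zero h3
    have hd' := (v.valuation K).map_sub (algebraMap _ K (r - -1)) (algebraMap _ K (r - 1))
    rw [hd] at hd'
    generalize v.valuation K (algebraMap _ K (r - 1)) = a at *
    generalize v.valuation K (algebraMap _ K (r - -1)) = b at *
    rw [← exp_log h20, ← exp_log h30, ← exp_add, exp_le_exp] at h1
    rw [← exp_log h20, exp_lt_exp] at h2
    rw [← exp_log h30, exp_lt_exp] at h3
    rw [← exp_log h20, ← exp_log h30, le_max_iff, exp_le_exp, exp_le_exp] at hd'
    push_cast at *
    omega
  classical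
  let g : (powMonoidHom 2 : (𝓞 K ⧸ I)ˣ →* _).ker → Bool × ψ.ker := fun x =>
    if h : φ x.1 = 1 then (true, ⟨x.1 - 1, by
      change φ _ = 0; rw [map_sub, h, map_one, sub_self]⟩)
    else (false, ⟨x.1 + 1, by
      change φ _ = 0
      have hx : (x.1 : 𝓞 K ⧸ I) ^ 2 = 1 := by
        have := x.2; rw [MonoidHom.mem_ker] at this
        have h2 := congrArg Units.val this
        simpa using h2
      rw [map_add, (key _ hx).resolve_left h, map_one, neg_add_cancel]⟩)
  have hg : Function.Injective g := by
    intro x y hxy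
    simp only [g] at hxy
    apply Subtype.ext; apply Units.ext
    split_ifs at hxy <;> simp at hxy <;> exact hxy
  calc _ ≤ Nat.card (Bool × ψ.ker) := Nat.card_le_card_of_injective g hg
    _ = _ := by rw [Nat.card_prod, hψ]; simp

theorem mul_inv_mem_localSquares {x y : Kˣ} (w : Valuation K ℤᵐ⁰)
    (h : w (x - y : K) < w 4 * w y) : x * y⁻¹ ∈ localSquares w := by
  refine (localSquares w).inv_mem_iff.1 ⟨(x - y) / (4 * y), 1, ?_, ?_⟩
  · rw [map_div₀, map_mul]
    exact (div_lt_one₀ (zero_le.trans_lt h)).2 h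
  · push_cast
    field_simp [x.ne_zero, y.ne_zero]; ring

theorem exp_lt_map_four {n : ℕ} (hn : v.valuation K 2 = exp (-(n : ℤ))) :
    exp (-((2 * n + 1 : ℕ) : ℤ)) < v.valuation K 4 := by
  rw [(v.valuation K).map_four, hn, sq, ← exp_add, exp_lt_exp]
  push_cast; omega

/-- The group of local square classes at a finite place is finite, of explicitly bounded order. -/
theorem index_localSquares_le :
    (localSquares (v.valuation K)).index ≠ 0 ∧ (localSquares (v.valuation K)).index ≤
      4 * Ideal.absNorm (v.maxPowDividing (Ideal.span {(2 : 𝓞 K)})) := by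
  obtain ⟨n, hn, hn'⟩ := exists_valuation_two v
  rw [hn']
  set w := v.valuation K with hw
  let I := v.asIdeal ^ (2 * n + 1)
  have hfin : Finite (𝓞 K ⧸ I) := Ideal.finiteQuotientOfFreeOfNeBot _ (pow_ne_zero _ v.ne_bot)
  have hIv : I ≤ v.asIdeal := Ideal.pow_le_self (by omega)
  have hI1 : ∀ r : 𝓞 K, r ∈ I → w (algebraMap _ K r) < w 4 := fun r hr =>
    ((valuation_le_exp_iff_mem v r _).2 hr).trans_lt (exp_lt_map_four v hn)
  have hunit : ∀ g : (𝓞 K ⧸ I)ˣ, w (algebraMap _ K (Quotient.out g.1)) = 1 := by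
    intro g
    refine le_antisymm (v.valuation_le_one _) (not_lt.1 fun h => ?_)
    have h1 : Quotient.out g.1 ∈ v.asIdeal := (v.valuation_lt_one_iff_mem (K := K) _).1 h
    obtain ⟨g', hg'⟩ := g.isUnit.exists_right_inv
    have e1 : Ideal.Quotient.mk I (Quotient.out g.1 * Quotient.out g') = Ideal.Quotient.mk I 1 := by
      rw [map_mul, map_one, ← hg']
      exact congrArg₂ _ (Quotient.out_eq _) (Quotient.out_eq _)
    rw [Ideal.Quotient.eq] at e1
    have e2 := v.asIdeal.sub_mem (v.asIdeal.mul_mem_right (Quotient.out g') h1) (hIv e1)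
    rw [sub_sub_cancel] at e2
    exact v.isPrime.ne_top ((Ideal.eq_top_iff_one _).2 e2)
  have hne : ∀ g : (𝓞 K ⧸ I)ˣ, algebraMap _ K (Quotient.out g.1) ≠ 0 := fun g h => by
    have := hunit g
    rw [h, map_zero] at this; exact zero_ne_one this
  let s : (𝓞 K ⧸ I)ˣ → Kˣ := fun g => Units.mk0 _ (hne g)
  let Sq := localSquares w
  have hs : ∀ (g : (𝓞 K ⧸ I)ˣ) (r : 𝓞 K), Ideal.Quotient.mk I r = g → ∀ x : Kˣ,
      (x : K) = algebraMap _ K r → (QuotientGroup.mk x : Kˣ ⧸ Sq) = QuotientGroup.mk (s g) := by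
    intro g r hr x hx
    rw [QuotientGroup.eq, mul_comm, ← inv_mem_iff (H := Sq), mul_inv_rev, inv_inv]
    apply mul_inv_mem_localSquares
    have e1 : Ideal.Quotient.mk I r = Ideal.Quotient.mk I (Quotient.out g.1) :=
      hr.trans (Quotient.out_eq _).symm
    rw [Ideal.Quotient.eq] at e1
    have h1 := hI1 _ e1
    rw [map_sub, ← hx] at h1
    change w (x - s g : K) < w 4 at h1
    have h2 : w (x : K) = 1 := by
      have h3 : w (s g : K) = 1 := hunit g
      rw [show (x : K) = s g + (x - s g) by ring, w.map_add_eq_of_lt_left, h3]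
      rw [h3]; exact h1.trans_le w.map_four_le_one
    have h3 : w (s g : K) = 1 := hunit g
    rwa [h3, mul_one]
  let φ : (𝓞 K ⧸ I)ˣ →* Kˣ ⧸ Sq :=
    MonoidHom.mk' (fun g => QuotientGroup.mk (s g)) fun g h => by
      rw [← QuotientGroup.mk_mul]
      refine (hs (g * h) (Quotient.out g.1 * Quotient.out h.1) ?_ _ ?_).symm
      · rw [map_mul]
        exact congrArg₂ _ (Quotient.out_eq _) (Quotient.out_eq _)
      · simp [s]
  have hφ2 : (powMonoidHom 2 : (𝓞 K ⧸ I)ˣ →* _).range ≤ φ.ker := by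
    rintro _ ⟨g, rfl⟩
    rw [MonoidHom.mem_ker, powMonoidHom_apply, map_pow]
    change (QuotientGroup.mk (s g) : Kˣ ⧸ Sq) ^ 2 = 1
    rw [← QuotientGroup.mk_pow, QuotientGroup.eq_one_iff]
    exact sq_mem_localSquares _
  have hcard : Nat.card φ.range ≤ 2 * Ideal.absNorm v.asIdeal ^ n := by
    rw [← Subgroup.index_ker]
    refine le_trans ?_ (card_sqrt_one_le v hn)
    refine (Subgroup.index_antitone hφ2).trans_eq ?_
    · have h1 := Subgroup.card_mul_index (powMonoidHom 2 : (𝓞 K ⧸ I)ˣ →* _).ker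
      have h2 := Subgroup.card_mul_index (powMonoidHom 2 : (𝓞 K ⧸ I)ˣ →* _).range
      rw [Subgroup.index_ker] at h1
      have h0 : 0 < Nat.card (powMonoidHom 2 : (𝓞 K ⧸ I)ˣ →* _).range := Nat.card_pos
      refine Nat.eq_of_mul_eq_mul_left h0 ?_
      rw [h2, ← h1, mul_comm]
  have hval : ∀ x : Kˣ, w (x : K) = 1 → (QuotientGroup.mk x : Kˣ ⧸ Sq) ∈ φ.range := by
    intro x hx
    obtain ⟨r, hr⟩ := exists_integer_valuation_sub_lt v hx.le (exp_ne_zero (a := -((2 * n + 1 : ℕ) : ℤ)))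
    obtain ⟨r', hr'⟩ := exists_integer_valuation_sub_lt v (x := (x⁻¹ : Kˣ)) (by simp [← hw, hx])
      (exp_ne_zero (a := -((2 * n + 1 : ℕ) : ℤ)))
    rw [← hw] at hr hr'
    have h1 : w (algebraMap _ K r * algebraMap _ K r' - 1) ≤ exp (-((2 * n + 1 : ℕ) : ℤ)) := by
      have e : algebraMap _ K r * algebraMap _ K r' - 1 = algebraMap _ K r * (algebraMap _ K r' - (x⁻¹ : Kˣ))
          + (algebraMap _ K r - x) * (x⁻¹ : Kˣ) := by
        have := x.ne_zero
        push_cast; field_simp; ring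
      rw [e]
      refine w.map_add_le ?_ ?_
      · rw [map_mul]
        exact (mul_le_of_le_one_left' (v.valuation_le_one r)).trans hr'.le
      · rw [map_mul]
        refine (mul_le_of_le_one_right' ?_).trans hr.le
        simp [hx]
    rw [← map_mul, ← map_one (algebraMap (𝓞 K) K), ← map_sub, hw, valuation_le_exp_iff_mem,
      ← Ideal.Quotient.eq, map_mul, map_one] at h1
    let g : (𝓞 K ⧸ I)ˣ := Units.mkOfMulEqOne _ _ h1
    refine ⟨g, ?_⟩
    change (QuotientGroup.mk (s g) : Kˣ ⧸ Sq) = _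
    have hr0 : w (x - algebraMap _ K r : K) < w 4 := by
      rw [w.map_sub_swap]; exact hr.trans (exp_lt_map_four v hn)
    have hr1 : w (algebraMap _ K r) = 1 := by
      rw [show algebraMap _ K r = x - (x - algebraMap _ K r) by ring, w.map_sub_eq_of_lt_left, hx]
      rw [hx]; exact hr0.trans_le w.map_four_le_one
    have hrn : algebraMap _ K r ≠ 0 := fun h => by
      rw [h, map_zero] at hr1; exact zero_ne_one hr1
    rw [← hs g r rfl (Units.mk0 _ hrn) rfl, QuotientGroup.eq, mul_comm]
    apply mul_inv_mem_localSquares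
    simpa [hr1] using hr0
  obtain ⟨π, hπ⟩ := v.valuation_exists_uniformizer K
  rw [← hw] at hπ
  have hπ0 : π ≠ 0 := fun h => by rw [h, map_zero] at hπ; exact exp_ne_zero hπ.symm
  let p : Kˣ ⧸ Sq := QuotientGroup.mk (Units.mk0 π hπ0)
  have hfinφ : Finite φ.range := Finite.of_surjective _ φ.rangeRestrict_surjective
  have hmk : ∀ a t : Kˣ, (QuotientGroup.mk (a * t ^ 2) : Kˣ ⧸ Sq) = QuotientGroup.mk a := by
    intro a t
    rw [QuotientGroup.mk_mul, (QuotientGroup.eq_one_iff _).2 (sq_mem_localSquares t)]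
    exact mul_one (QuotientGroup.mk a : Kˣ ⧸ Sq)
  let F : Bool × φ.range → Kˣ ⧸ Sq := fun z => (if z.1 then p else 1) * z.2
  have hF : Function.Surjective F := by
    intro y
    obtain ⟨x, rfl⟩ := QuotientGroup.mk_surjective y
    have hwx : w (x : K) ≠ 0 := by simp
    rcases Int.even_or_odd' (log (w (x : K))) with ⟨m, hm | hm⟩
    · have h1 := hval (x * (Units.mk0 π hπ0 ^ m) ^ 2) (by
        push_cast
        rw [map_mul, map_pow, map_zpow₀, Units.val_mk0, hπ, ← exp_log hwx, hm, ← exp_zsmul,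
          ← exp_nsmul, ← exp_add, ← exp_zero]
        congr 1; simp)
      refine ⟨(false, ⟨_, h1⟩), ?_⟩
      simp only [F, Bool.false_eq_true, if_false]
      rw [hmk]; exact one_mul (QuotientGroup.mk x : Kˣ ⧸ Sq)
    · have h1 := hval (x * (Units.mk0 π hπ0)⁻¹ * (Units.mk0 π hπ0 ^ (m+1)) ^ 2) (by
        push_cast
        rw [map_mul, map_mul, map_pow, map_zpow₀, map_inv₀, Units.val_mk0, hπ, ← exp_log hwx, hm, ← exp_zsmul,
          ← exp_nsmul, ← exp_neg, ← exp_add, ← exp_add, ← exp_zero]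
        congr 1; simp; ring)
      refine ⟨(true, ⟨_, h1⟩), ?_⟩
      simp only [F, if_true, p]
      rw [hmk, ← QuotientGroup.mk_mul]
      congr 1
      rw [mul_comm, mul_assoc, inv_mul_cancel, mul_one]
  have hfinQ : Finite (Kˣ ⧸ Sq) := Finite.of_surjective F hF
  refine ⟨Subgroup.index_ne_zero_of_finite, ?_⟩
  calc Nat.card (Kˣ ⧸ Sq) ≤ Nat.card (Bool × φ.range) := Nat.card_le_card_of_surjective F hF
    _ = 2 * Nat.card φ.range := by rw [Nat.card_prod]; simp
    _ ≤ 2 * (2 * Ideal.absNorm v.asIdeal ^ n) := by gcongr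
    _ = _ := by ring

end

section
variable {K : Type*} [Field K] [NumberField K]

theorem prod_absNorm_maxPowDividing_two_le (S : Finset (HeightOneSpectrum (𝓞 K))) :
    ∏ v ∈ S, Ideal.absNorm (v.maxPowDividing (Ideal.span {(2 : 𝓞 K)})) ≤
      2 ^ Module.finrank ℚ K := by
  classical
  have h2 : Ideal.span {(2 : 𝓞 K)} ≠ 0 := by simp
  obtain ⟨T, hT⟩ : ∃ T : Finset (HeightOneSpectrum (𝓞 K)),
      (Function.mulSupport fun v : HeightOneSpectrum (𝓞 K) => v.maxPowDividing (Ideal.span {(2 : 𝓞 K)})) ⊆ T :=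
    (show Set.Finite _ from Ideal.hasFiniteMulSupport h2).exists_finset_coe.imp fun _ h => h.ge
  have h1 := Ideal.finprod_heightOneSpectrum_factorization h2
  rw [finprod_eq_prod_of_mulSupport_subset (s := T ∪ S) _ (by
    rw [Finset.coe_union]; exact hT.trans Set.subset_union_left)] at h1
  have h3 := congrArg Ideal.absNorm h1
  have h4 : Algebra.norm ℤ (2 : 𝓞 K) = 2 ^ Module.finrank ℚ K := by
    rw [show (2 : 𝓞 K) = algebraMap ℤ (𝓞 K) 2 by simp, Algebra.norm_algebraMap,
      RingOfIntegers.rank]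
  rw [map_prod, Ideal.absNorm_span_singleton, h4, Int.natAbs_pow] at h3
  refine (Finset.prod_le_prod_of_subset_of_one_le' Finset.subset_union_right ?_).trans_eq h3
  intro v _ _
  refine Nat.one_le_iff_ne_zero.2 ?_
  rw [HeightOneSpectrum.maxPowDividing, map_pow]
  exact pow_ne_zero _ (by rw [Ne, Ideal.absNorm_eq_zero_iff]; exact v.ne_bot)

theorem prod_index_localSquares_le (S : Finset (HeightOneSpectrum (𝓞 K))) :
    ∏ v ∈ S, (localSquares (v.valuation K)).index ≤ 4 ^ S.card * 2 ^ Module.finrank ℚ K := by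
  refine (Finset.prod_le_prod' fun v _ => (index_localSquares_le v).2).trans ?_
  rw [Finset.prod_mul_distrib, Finset.prod_const]
  exact Nat.mul_le_mul_left _ (prod_absNorm_maxPowDividing_two_le S)

end

section
variable {K : Type*} [Field K] {w : Valuation K ℤᵐ⁰}

/-- A quadratic form with integral values and polar values on a family is given on integral
combinations by an integral polynomial of degree at most two. -/
theorem QuadraticForm.exists_integral_polynomial {V : Type*} [AddCommGroup V] [Module K V]
    (Q : QuadraticForm K V) {σ : Type*} (f : σ → V) (hQ : ∀ i, w (Q (f i)) ≤ 1)
    (hB : ∀ i j, w (QuadraticMap.polar Q (f i) (f j)) ≤ 1) (s : Finset σ) :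
    ∃ p : MvPolynomial σ w.valuationSubring, p.totalDegree ≤ 2 ∧
      ∀ t : σ → w.valuationSubring, Q (∑ i ∈ s, (t i : K) • f i) = (MvPolynomial.eval t p :) := by
  classical
  induction s using Finset.induction_on with
  | empty => exact ⟨0, by simp, by simp⟩
  | insert a s ha ih =>
    obtain ⟨p, hp, he⟩ := ih
    let A : w.valuationSubring := ⟨Q (f a), hQ a⟩
    let B : σ → w.valuationSubring := fun i => ⟨QuadraticMap.polar Q (f a) (f i), hB a i⟩
    refine ⟨MvPolynomial.C A * MvPolynomial.X a ^ 2 +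
      (MvPolynomial.X a * ∑ i ∈ s, MvPolynomial.C (B i) * MvPolynomial.X i) + p, ?_, ?_⟩
    · refine (MvPolynomial.totalDegree_add _ _).trans (max_le ((MvPolynomial.totalDegree_add _ _).trans
        (max_le ?_ ?_)) hp)
      · refine (MvPolynomial.totalDegree_mul _ _).trans ?_
        rw [MvPolynomial.totalDegree_C, zero_add]
        exact (MvPolynomial.totalDegree_pow _ _).trans (by simp)
      · refine (MvPolynomial.totalDegree_mul _ _).trans ?_
        rw [MvPolynomial.totalDegree_X]
        have : (∑ i ∈ s, MvPolynomial.C (B i) * MvPolynomial.X i).totalDegree ≤ 1 := by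
          refine MvPolynomial.totalDegree_finsetSum_le fun i _ => ?_
          refine (MvPolynomial.totalDegree_mul _ _).trans ?_
          simp
        omega
    · intro t
      rw [Finset.sum_insert ha, QuadraticMap.map_add Q, he t, QuadraticMap.map_smul,
        QuadraticMap.polar_smul_left, ← QuadraticMap.polarBilin_apply_apply, map_sum]
      simp only [map_smul, QuadraticMap.polarBilin_apply_apply, map_add, map_mul, map_pow, map_sum,
        MvPolynomial.eval_C, MvPolynomial.eval_X]
      push_cast
      simp only [A, B, smul_eq_mul]
      have : ∀ i, (t i : K) * QuadraticMap.polar Q (f a) (f i) =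
        QuadraticMap.polar Q (f a) (f i) * t i := fun i => mul_comm _ _
      simp only [this]
      ring

theorem QuadraticForm.exists_primitive_map_lt_one [Finite (ResidueField w.valuationSubring)]
    {V : Type*} [AddCommGroup V] [Module K V]
    (Q : QuadraticForm K V) {σ : Type*} [Fintype σ] (hσ : 2 < Fintype.card σ)
    (f : σ → V) (hQ : ∀ i, w (Q (f i)) ≤ 1)
    (hB : ∀ i j, w (QuadraticMap.polar Q (f i) (f j)) ≤ 1) :
    ∃ t : σ → K, (∀ i, w (t i) ≤ 1) ∧ (∃ i, w (t i) = 1) ∧ w (Q (∑ i, t i • f i)) < 1 := by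
  classical
  obtain ⟨p, hp, he⟩ := Q.exists_integral_polynomial f hQ hB Finset.univ
  let k := ResidueField w.valuationSubring
  have : Fintype k := Fintype.ofFinite k
  obtain ⟨l, hl⟩ := CharP.exists k
  let p' : MvPolynomial σ k := MvPolynomial.map (residue _) p
  have hp' : p'.totalDegree < Fintype.card σ :=
    ((Finset.sup_mono (MvPolynomial.support_map_subset _ _)).trans hp).trans_lt hσ
  have hd := char_dvd_card_solutions l hp'
  have hl1 : 1 < l := (CharP.char_is_prime k l).one_lt
  have hev : ∀ t : σ → w.valuationSubring, MvPolynomial.eval (fun i => residue _ (t i)) p' =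
      residue _ (MvPolynomial.eval t p) := fun t => by
    rw [MvPolynomial.eval_map, MvPolynomial.eval, MvPolynomial.coe_eval₂Hom,
      MvPolynomial.eval₂_comp_left]
    rfl
  have h0 : MvPolynomial.eval (0 : σ → k) p' = 0 := by
    have h1 := hev 0
    have h2 := he 0
    simp only [Pi.zero_apply, ZeroMemClass.coe_zero, zero_smul, Finset.sum_const_zero,
      QuadraticMap.map_zero] at h2
    rw [show MvPolynomial.eval 0 p = 0 from Subtype.ext h2.symm, map_zero] at h1
    simpa using h1
  have hc : 1 < Fintype.card {x : σ → k // MvPolynomial.eval x p' = 0} :=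
    hl1.trans_le (Nat.le_of_dvd (Fintype.card_pos_iff.2 ⟨⟨0, h0⟩⟩) hd)
  obtain ⟨x, hx⟩ := Fintype.exists_ne_of_one_lt_card hc ⟨0, h0⟩
  have hx0 : x.1 ≠ 0 := fun h => hx (Subtype.ext h)
  choose t ht using fun i => residue_surjective (x.1 i)
  refine ⟨fun i => t i, fun i => (t i).2, ?_, ?_⟩
  · obtain ⟨i, hi⟩ := Function.ne_iff.1 hx0
    refine ⟨i, le_antisymm (t i).2 (not_lt.1 fun h => hi ?_)⟩
    rw [← ht]; exact (residue_eq_zero_iff_map_lt_one _).2 h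
  · rw [he t, ← residue_eq_zero_iff_map_lt_one, ← hev]
    simp only [ht]; exact x.2

end

section
variable {K : Type*} [Field K] {w : Valuation K ℤᵐ⁰}

theorem WithZero.le_exp_sub_one_of_lt {x : ℤᵐ⁰} {m : ℤ} (h : x < exp m) : x ≤ exp (m - 1) := by
  rcases eq_or_ne x 0 with rfl | hx
  · exact zero_le
  · rw [← exp_log hx] at h ⊢
    rw [exp_lt_exp] at h
    rw [exp_le_exp]; omega

/-- A weak Cauchy-Schwarz inequality for an ultrametric quadratic form implies the strong one. -/
theorem QuadraticForm.map_polar_sq_le {V : Type*} [AddCommGroup V] [Module K V]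
    (Q : QuadraticForm K V) (m : ℕ)
    (h : ∀ x y, exp (-(m : ℤ)) * w (QuadraticMap.polar Q x y) ^ 2 ≤ w (Q x) * w (Q y)) (x y : V) :
    w (QuadraticMap.polar Q x y) ^ 2 ≤ w (Q x) * w (Q y) := by
  induction m with
  | zero => simpa using h x y
  | succ m ih =>
    refine ih fun x y => ?_
    by_contra! hlt
    set B := QuadraticMap.polar Q x y with hB
    have hB0 : B ≠ 0 := fun h0 => by rw [h0] at hlt; simp at hlt
    have hwB : w B ≠ 0 := by simpa using hB0
    set k := Q x * Q y / B ^ 2 with hk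
    have hwk : w k < exp (-(m : ℤ)) := by
      rw [hk, map_div₀, map_mul, map_pow]
      exact (div_lt_iff₀ (pow_pos (zero_lt_iff.2 hwB) 2)).2 hlt
    have hk1 : w k < 1 := hwk.trans_le (by rw [← exp_zero, exp_le_exp]; simp)
    have e1 : Q (x - (Q x / B) • y) = Q x * k := by
      rw [sub_eq_add_neg, ← neg_smul, QuadraticMap.map_add Q, QuadraticMap.map_smul,
        QuadraticMap.polar_smul_right, ← hB, hk]
      simp only [smul_eq_mul]
      field_simp; ring
    have e2 : QuadraticMap.polar Q (x - (Q x / B) • y) y = B * (1 - 2 * k) := by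
      rw [sub_eq_add_neg, ← neg_smul, QuadraticMap.polar_add_left, QuadraticMap.polar_smul_left,
        ← hB, QuadraticMap.polar_self, hk]
      simp only [smul_eq_mul]
      field_simp; ring
    have h1 := h (x - (Q x / B) • y) y
    have h2k : w (1 - 2 * k) = 1 := by
      rw [w.map_sub_eq_of_lt_left, map_one]
      rw [map_one, map_mul]
      exact (mul_le_of_le_one_left' w.map_two_le_one).trans_lt hk1
    rw [e1, e2, map_mul, h2k, mul_one, map_mul, mul_right_comm,
      show w (Q x) * w (Q y) = w k * w B ^ 2 by
        rw [← map_mul w, ← map_pow, ← map_mul w, hk]; congr 1; field_simp,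
      mul_right_comm, ← sq] at h1
    have h2 : exp (-((m + 1 : ℕ) : ℤ)) ≤ w k ^ 2 :=
      le_of_mul_le_mul_right h1 (pow_pos (zero_lt_iff.2 hwB) 2)
    have h3 := WithZero.le_exp_sub_one_of_lt hwk
    have h4 : w k ^ 2 ≤ exp (-(m : ℤ) - 1) ^ 2 := pow_le_pow_left₀ zero_le h3 2
    have h5 := h2.trans h4
    rw [← exp_nsmul, exp_le_exp] at h5
    push_cast at h5
    simp at h5
    omega

theorem Matrix.det_update_smul_sum {ι : Type*} [Fintype ι] [DecidableEq ι] (f : Matrix ι ι K)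
    (p : ι → Prop) [DecidablePred p] (t : {i // p i} → K) (j : {i // p i}) (c : K) :
    (f.updateRow j (c • ∑ i, t i • f i)).det = c * t j * f.det := by
  have : c • ∑ i, t i • f i = ∑ i : ι, (if h : p i then c * t ⟨i, h⟩ else 0) • f i := by
    rw [Finset.smul_sum, ← Fintype.sum_subtype_add_sum_subtype p,
      Finset.sum_eq_zero (s := (Finset.univ : Finset {i // ¬ p i})), add_zero]
    · refine Finset.sum_congr rfl fun i _ => ?_
      rw [dif_pos i.2, mul_smul]
    · intro i _
      rw [dif_neg i.2, zero_smul]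
  rw [this, Matrix.det_updateRow_sum]
  simp [j.2]

theorem Valuation.map_det_le {ι : Type*} [Fintype ι] [DecidableEq ι] (f : Matrix ι ι K)
    {M : ℤᵐ⁰} (h : ∀ i j, w (f i j) ≤ M) : w f.det ≤ M ^ Fintype.card ι := by
  rw [Matrix.det_apply']
  refine w.map_sum_le fun s _ => ?_
  rw [map_mul, map_prod]
  have h1 : w ((Equiv.Perm.sign s : ℤ) : K) = 1 := by
    rcases Int.units_eq_one_or (Equiv.Perm.sign s) with h | h <;> simp [h]
  rw [h1, one_mul]
  exact (Finset.prod_le_prod' fun i _ => h _ _).trans_eq (by simp)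

/-- Over a local field with finite residue field, a quadratic form in more than four variables has
vectors of arbitrarily small value. -/
theorem QuadraticForm.exists_map_lt [Finite (ResidueField w.valuationSubring)]
    (hw : Function.Surjective w) {ι : Type*} [Fintype ι] (hι : 4 < Fintype.card ι)
    (Q : QuadraticForm K (ι → K)) {δ : ℤᵐ⁰} (hδ : δ ≠ 0)
    (hB : ∀ x y : ι → K, ∃ i j, δ * w (QuadraticMap.polar Q x y) ≤ w (x i) * w (y j))
    {γ : ℤᵐ⁰} (hγ : γ ≠ 0) :
    ∃ (x : ι → K) (i : ι), w (Q x) < γ * w (x i) ^ 2 := by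
  classical
  by_contra! hQ
  wlog hγ1 : γ ≤ 1 generalizing γ
  · refine this one_ne_zero (fun x i => le_trans ?_ (hQ x i)) le_rfl
    exact mul_le_mul_left (not_le.1 hγ1).le _
  have hpol : ∀ x y, w (QuadraticMap.polar Q x y) ^ 2 ≤ w (Q x) * w (Q y) := by
    have hc : δ ^ 2 * γ ^ 2 ≠ 0 := mul_ne_zero (pow_ne_zero _ hδ) (pow_ne_zero _ hγ)
    have h1 : exp (-((log (δ ^ 2 * γ ^ 2)).natAbs : ℤ)) ≤ δ ^ 2 * γ ^ 2 := by
      rw [← exp_log hc, exp_le_exp, log_exp]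
      omega
    refine Q.map_polar_sq_le _ fun x y => (mul_le_mul_left h1 _).trans ?_
    obtain ⟨i, j, hij⟩ := hB x y
    calc δ ^ 2 * γ ^ 2 * w (QuadraticMap.polar Q x y) ^ 2
        = γ ^ 2 * (δ * w (QuadraticMap.polar Q x y)) ^ 2 := by rw [mul_pow, ← mul_assoc, mul_comm (γ ^ 2)]
      _ ≤ γ ^ 2 * (w (x i) * w (y j)) ^ 2 := by gcongr
      _ = (γ * w (x i) ^ 2) * (γ * w (y j) ^ 2) := by
        rw [mul_pow, sq γ, mul_mul_mul_comm]
      _ ≤ _ := mul_le_mul' (hQ x i) (hQ y j)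
  have hbd : ∀ x : ι → K, w (Q x) ≤ 1 → ∀ i, w (x i) ≤ γ⁻¹ := by
    intro x hx i
    by_contra! h
    have h1 := (hQ x i).trans hx
    have h2 : 1 < γ * w (x i) := by
      have := mul_lt_mul_of_pos_left h (zero_lt_iff.2 hγ)
      rwa [mul_inv_cancel₀ hγ] at this
    have h3 : 1 < w (x i) := (one_le_inv₀ (zero_lt_iff.2 hγ)).2 hγ1 |>.trans_lt h
    have h4 : 1 < γ * w (x i) ^ 2 := by
      rw [sq, ← mul_assoc]; exact one_lt_mul'' h2 h3
    exact absurd h1 (not_le.2 h4)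
  let Good : Matrix ι ι K → Prop := fun f => (∀ i, w (Q (f i)) ≤ 1) ∧ f.det ≠ 0
  let A : Matrix ι ι K → Finset ι := fun f => Finset.univ.filter fun i => w (Q (f i)) < 1
  let m : Matrix ι ι K → ℤ := fun f => (Fintype.card ι + 1) * log (w f.det) + (A f).card
  have hmem : ∀ f i, i ∈ A f ↔ w (Q (f i)) < 1 := fun f i => by simp [A]
  have hex : ∃ z : ℤ, ∃ f, Good f ∧ m f = z := by
    let c : ι → K := fun i => if w (Q (Pi.single i 1)) ≤ 1 then 1 else (Q (Pi.single i 1))⁻¹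
    have hc : ∀ i, c i ≠ 0 := fun i => by
      simp only [c]; split_ifs with h
      · exact one_ne_zero
      · refine inv_ne_zero fun h0 => h ?_
        rw [h0]; simp
    refine ⟨_, Matrix.diagonal c, ⟨fun i => ?_, ?_⟩, rfl⟩
    · have : Matrix.diagonal c i = c i • (Pi.single i 1 : ι → K) := by
        ext j; simp [Matrix.diagonal, Pi.single_apply, eq_comm]
      rw [this, QuadraticMap.map_smul]
      simp only [c, smul_eq_mul]; split_ifs with h
      · simpa using h
      · have h0 : w (Q (Pi.single i 1)) ≠ 0 := fun h0 => h (by rw [h0]; exact zero_le_one)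
        rw [map_mul, map_mul, map_inv₀, mul_assoc, inv_mul_cancel₀ h0, mul_one]
        exact inv_le_one_of_one_le₀ (not_le.1 h).le
    · rw [Matrix.det_diagonal]; exact Finset.prod_ne_zero_iff.2 fun i _ => hc i
  have hbdd : ∃ b : ℤ, ∀ z : ℤ, (∃ f, Good f ∧ m f = z) → z ≤ b := by
    refine ⟨(Fintype.card ι + 1) * log ((γ⁻¹) ^ Fintype.card ι) + Fintype.card ι, ?_⟩
    rintro _ ⟨f, hf, rfl⟩
    refine add_le_add (mul_le_mul_of_nonneg_left ?_ (by positivity)) ?_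
    · rw [log_le_log (by simpa using hf.2) (pow_ne_zero _ (inv_ne_zero hγ))]
      exact w.map_det_le f fun i j => hbd _ (hf.1 i) j
    · exact_mod_cast Finset.card_le_univ _
  obtain ⟨z, ⟨f, hf, rfl⟩, hmax⟩ := Int.exists_greatest_of_bdd hbdd hex
  have hpol1 : ∀ i j, w (QuadraticMap.polar Q (f i) (f j)) ≤ 1 := fun i j => by
    refine (pow_le_one_iff_of_nonneg zero_le two_ne_zero).1 ((hpol _ _).trans ?_)
    exact mul_le_one' (hf.1 i) (hf.1 j)
  by_cases hA : (A f).card ≤ 2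
  · have hσ : 2 < Fintype.card {i // i ∉ A f} := by
      have := Fintype.card_subtype_compl (fun i => i ∈ A f)
      rw [Fintype.card_coe] at this
      omega
    obtain ⟨t, ht, ⟨j, hj⟩, hQt⟩ := Q.exists_primitive_map_lt_one hσ (fun i => f i)
      (fun i => hf.1 i) (fun i j => hpol1 i j)
    let f' := f.updateRow j ((1 : K) • ∑ i, t i • f i)
    have hd : f'.det = _ := Matrix.det_update_smul_sum f (fun i => i ∉ A f) t j 1
    rw [one_mul] at hd
    have ht0 : t j ≠ 0 := fun h => by rw [h] at hj; simp at hj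
    have hlt : m f < m f' := by
      have hw' : w f'.det = w f.det := by rw [hd, map_mul, hj, one_mul]
      have hsub : insert j.1 (A f) ⊆ A f' := by
        intro i hi
        rw [hmem]
        by_cases hij : i = j
        · subst hij; simp only [f', Matrix.updateRow_self, one_smul]; exact hQt
        · simp only [f', Matrix.updateRow_ne hij]
          exact (hmem f i).1 (Finset.mem_of_mem_insert_of_ne hi hij)
      have := Finset.card_le_card hsub
      rw [Finset.card_insert_of_notMem j.2] at this
      simp only [m, hw']
      omega
    refine absurd (hmax _ ⟨f', ⟨fun i => ?_, ?_⟩, rfl⟩) (not_le.2 hlt)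
    · by_cases hij : i = j
      · subst hij; simp only [f', Matrix.updateRow_self, one_smul]; exact hQt.le
      · simp only [f', Matrix.updateRow_ne hij]; exact hf.1 i
    · rw [hd]; exact mul_ne_zero ht0 hf.2
  · have hσ : 2 < Fintype.card {i // i ∈ A f} := by
      rw [Fintype.card_coe]; omega
    obtain ⟨π, hπ⟩ := hw (exp (-1))
    have hπ0 : π ≠ 0 := fun h => by rw [h, map_zero] at hπ; exact exp_ne_zero hπ.symm
    have hA1 : ∀ i ∈ A f, w (Q (f i)) ≤ exp (-1) := fun i hi => by
      have h1 : w (Q (f i)) < exp 0 := (hmem f i).1 hi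
      exact WithZero.le_exp_sub_one_of_lt h1
    have hinv : (exp (-1 : ℤ))⁻¹ * exp (-1 : ℤ) = 1 := inv_mul_cancel₀ exp_ne_zero
    have hs : ∀ x, (π⁻¹ • Q) x = π⁻¹ * Q x := fun _ => rfl
    have hs' : ⇑(π⁻¹ • Q) = π⁻¹ • ⇑Q := rfl
    obtain ⟨t, ht, ⟨j, hj⟩, hQt⟩ := (π⁻¹ • Q).exists_primitive_map_lt_one hσ (fun i => f i)
      (fun i => by
        rw [hs, map_mul, map_inv₀, hπ, ← hinv]
        gcongr; exact hA1 _ i.2)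
      (fun i j => by
        rw [hs', QuadraticMap.polar_smul, smul_eq_mul, map_mul, map_inv₀, hπ, ← hinv]
        gcongr
        refine (pow_le_pow_iff_left₀ zero_le zero_le two_ne_zero).1 ((hpol _ _).trans ?_)
        rw [sq]; exact mul_le_mul' (hA1 _ i.2) (hA1 _ j.2))
    have hQt' : w (Q (∑ i, t i • f i)) ≤ exp (-2) := by
      rw [hs, map_mul, map_inv₀, hπ] at hQt
      rw [inv_mul_lt_iff₀ (zero_lt_iff.2 exp_ne_zero), mul_one] at hQt
      exact WithZero.le_exp_sub_one_of_lt hQt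
    let f' := f.updateRow j (π⁻¹ • ∑ i, t i • f i)
    have hd : f'.det = π⁻¹ * t j * f.det := by
      rw [← Matrix.det_update_smul_sum f (fun i => i ∈ A f) t j π⁻¹]
      simp only [f']
      congr!
    have ht0 : t j ≠ 0 := fun h => by rw [h] at hj; simp at hj
    have hlt : m f < m f' := by
      have hw0 : w f.det ≠ 0 := by simpa using hf.2
      have hw' : log (w f'.det) = log (w f.det) + 1 := by
        rw [hd, map_mul, map_mul, hj, mul_one, map_inv₀, hπ, ← exp_neg, log_mul exp_ne_zero hw0,
          log_exp]; ring
      have := Finset.card_le_univ (A f)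
      simp only [m, hw']
      rw [mul_add, mul_one]
      omega
    refine absurd (hmax _ ⟨f', ⟨fun i => ?_, ?_⟩, rfl⟩) (not_le.2 hlt)
    · by_cases hij : i = j
      · subst hij; simp only [f', Matrix.updateRow_self]
        rw [QuadraticMap.map_smul, smul_eq_mul, map_mul, map_mul, map_inv₀, hπ, ← exp_neg, ← exp_add]
        calc _ ≤ exp (- -1 + - -1) * exp (-2) := by gcongr
          _ = 1 := by rw [← exp_add, ← exp_zero]; congr 1
      · simp only [f', Matrix.updateRow_ne hij]; exact hf.1 i
    · rw [hd]; exact mul_ne_zero (mul_ne_zero (inv_ne_zero hπ0) ht0) hf.2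

end

section
variable {K : Type*} [Field K] {w : Valuation K ℤᵐ⁰}

theorem Valuation.exists_ne_zero_forall_mul_le_one (w : Valuation K ℤᵐ⁰) {ι : Type*} [Finite ι]
    (g : ι → K) : ∃ δ : ℤᵐ⁰, δ ≠ 0 ∧ ∀ i, δ * w (g i) ≤ 1 := by
  obtain ⟨M, hM⟩ := (Set.finite_range fun i => w (g i)).bddAbove
  have h1 : (0 : ℤᵐ⁰) < max M 1 := lt_max_of_lt_right zero_lt_one
  refine ⟨(max M 1)⁻¹, inv_ne_zero h1.ne', fun i => ?_⟩
  rw [inv_mul_le_iff₀ h1, mul_one]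
  exact (hM ⟨i, rfl⟩).trans (le_max_left _ _)

/-- A diagonal form taking a small value represents every element approximately. -/
theorem exists_diagonal_value_near [CharZero K] {ι : Type*} [Fintype ι] [DecidableEq ι] {α : ι → K} {j : ι}
    (hα : α j ≠ 0) (x : ι → K) (hx : x j ≠ 0) (e : K) : ∃ z : ι → K,
      ∑ i, α i * z i ^ 2 - e = ((e - α j) / (2 * α j) / x j) ^ 2 * ∑ i, α i * x i ^ 2 := by
  set t := (e - α j) / (2 * α j) / x j with ht
  refine ⟨fun i => (Pi.single j 1 : ι → K) i + t * x i, ?_⟩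
  have h1 : ∀ i, α i * ((Pi.single j 1 : ι → K) i + t * x i) ^ 2 =
      (if i = j then α j + 2 * t * α j * x j else 0) + t ^ 2 * (α i * x i ^ 2) := by
    intro i
    rw [Pi.single_apply]
    split_ifs with h
    · subst h; ring
    · ring
  simp only [h1, Finset.sum_add_distrib, Finset.sum_ite_eq', Finset.mem_univ, if_true,
    ← Finset.mul_sum]
  have : α j + 2 * t * α j * x j = e := by
    rw [ht]; field_simp; ring
  rw [this]; ring

theorem exists_local_common_value [CharZero K] [Finite (ResidueField w.valuationSubring)]
    (hw : Function.Surjective w) {α β : Fin 3 → K} (hα : ∀ i, α i ≠ 0) (hβ : ∀ i, β i ≠ 0) :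
    ∃ x y : Fin 3 → K, w (∑ i, α i * x i ^ 2 - ∑ i, β i * y i ^ 2) <
      w 4 * w (∑ i, β i * y i ^ 2) := by
  classical
  let c : Fin 3 ⊕ Fin 3 → K := Sum.elim α (-β)
  let Q : QuadraticForm K (Fin 3 ⊕ Fin 3 → K) := QuadraticMap.weightedSumSquares K c
  have hQ : ∀ z, Q z = ∑ i, α i * z (.inl i) ^ 2 - ∑ i, β i * z (.inr i) ^ 2 := fun z => by
    simp [Q, QuadraticMap.weightedSumSquares_apply, c, sq, sub_eq_add_neg]
  have hpol : ∀ x y, QuadraticMap.polar Q x y = ∑ i, 2 * c i * (x i * y i) := fun x y => by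
    simp only [QuadraticMap.polar, Q, QuadraticMap.weightedSumSquares_apply, smul_eq_mul]
    rw [← Finset.sum_sub_distrib, ← Finset.sum_sub_distrib]
    refine Finset.sum_congr rfl fun i _ => ?_
    simp only [Pi.add_apply]; ring
  obtain ⟨δ, hδ, hδ1⟩ := w.exists_ne_zero_forall_mul_le_one fun i => 2 * c i
  let g : Fin 3 ⊕ Fin 3 → K := Sum.elim
    (fun j => ((β 0 - α j) / (2 * α j)) ^ 2 / (16 * β 0))
    (fun j => ((α 0 - β j) / (2 * β j)) ^ 2 / (16 * α 0))
  obtain ⟨γ, hγ, hγ1⟩ := w.exists_ne_zero_forall_mul_le_one g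
  obtain ⟨z, i, hz⟩ := QuadraticForm.exists_map_lt (w := w) hw (by simp) Q hδ (fun x y => by
    obtain ⟨i, -, hi⟩ := Finset.exists_max_image Finset.univ (fun i => w (2 * c i * (x i * y i)))
      Finset.univ_nonempty
    refine ⟨i, i, ?_⟩
    have h1 : w (QuadraticMap.polar Q x y) ≤ w (2 * c i) * (w (x i) * w (y i)) := by
      rw [hpol, ← map_mul, ← map_mul]
      exact w.map_sum_le fun j hj => hi j hj
    calc _ ≤ δ * (w (2 * c i) * (w (x i) * w (y i))) := mul_le_mul_right h1 _
      _ = (δ * w (2 * c i)) * (w (x i) * w (y i)) := (mul_assoc _ _ _).symm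
      _ ≤ _ := mul_le_of_le_one_left' (hδ1 i)) hγ
  rw [hQ] at hz
  set X := ∑ i, α i * z (.inl i) ^ 2
  set Y := ∑ i, β i * z (.inr i) ^ 2
  by_cases hlt : w (X - Y) < w 4 * w Y
  · exact ⟨_, _, hlt⟩
  rw [not_lt] at hlt
  have h40 : 0 < w 4 := zero_lt_iff.2 (by simp)
  have hY : w 4 * w Y < γ * w (z i) ^ 2 := hlt.trans_lt hz
  have hX : w 4 * w X < γ * w (z i) ^ 2 := by
    rw [show X = X - Y + Y by ring, ← map_mul, mul_add]
    refine (w.map_add _ _).trans_lt (max_lt ?_ (by rwa [map_mul]))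
    rw [map_mul]
    exact (mul_le_of_le_one_left' w.map_four_le_one).trans_lt hz
  have hz0 : z i ≠ 0 := fun h => by simp [h] at hz
  have key : ∀ (s e T : K), γ * w (s ^ 2 / (16 * e)) ≤ 1 → e ≠ 0 → w 4 * w T < γ * w (z i) ^ 2 →
      w ((s / z i) ^ 2 * T) < w 4 * w e := by
    intro s e T h1 he hT
    by_cases hs : s = 0
    · subst hs
      simp only [zero_div, ne_eq, OfNat.ofNat_ne_zero, not_false_eq_true, zero_pow, zero_mul,
        map_zero]
      exact mul_pos h40 (zero_lt_iff.2 (by simpa using he))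
    have h2 : w (s / z i) ^ 2 * (w 4 * w T) < w (s / z i) ^ 2 * (γ * w (z i) ^ 2) :=
      mul_lt_mul_of_pos_left hT (pow_pos (zero_lt_iff.2 (by simp [hs, hz0])) 2)
    have h3 : w (s / z i) ^ 2 * (γ * w (z i) ^ 2) = γ * w (s ^ 2 / (16 * e)) * (w 4 * (w 4 * w e)) := by
      rw [mul_left_comm, ← mul_pow, ← map_mul, ← map_pow, mul_assoc γ, ← map_mul, ← map_mul, ← map_mul]
      congr 2
      field_simp; norm_num
    rw [h3] at h2
    have h4 : w 4 * w ((s / z i) ^ 2 * T) < w 4 * (w 4 * w e) := by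
      rw [map_mul, map_pow, mul_left_comm]
      exact h2.trans_le (mul_le_of_le_one_left' h1)
    exact lt_of_mul_lt_mul_left h4 zero_le
  rcases i with j | j
  · obtain ⟨x, hx⟩ := exists_diagonal_value_near (hα j) (fun i => z (.inl i)) hz0 (β 0)
    refine ⟨x, Pi.single 0 1, ?_⟩
    have e : ∑ i, β i * (Pi.single 0 1 : Fin 3 → K) i ^ 2 = β 0 := by
      simp [Fin.sum_univ_three]
    rw [e, hx]
    exact key _ _ _ (hγ1 (.inl j)) (hβ 0) hX
  · obtain ⟨y, hy⟩ := exists_diagonal_value_near (hβ j) (fun i => z (.inr i)) hz0 (α 0)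
    refine ⟨Pi.single 0 1, y, ?_⟩
    have e : ∑ i, α i * (Pi.single 0 1 : Fin 3 → K) i ^ 2 = α 0 := by
      simp [Fin.sum_univ_three]
    have h1 := key _ _ _ (hγ1 (.inr j)) (hα 0) hY
    rw [← hy] at h1
    rw [e, w.map_sub_swap]
    have h2 : w (∑ i, β i * y i ^ 2) = w (α 0) := by
      rw [show ∑ i, β i * y i ^ 2 = α 0 + (∑ i, β i * y i ^ 2 - α 0) by ring,
        w.map_add_eq_of_lt_left]
      exact h1.trans_le (mul_le_of_le_one_left' w.map_four_le_one)
    rwa [h2]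

end

section

theorem AddSubgroup.index_range_nsmul_eq_card_ker {B : Type*} [AddCommGroup B] [Finite B] (n : ℕ) :
    (nsmulAddMonoidHom (α := B) n).range.index = Nat.card (nsmulAddMonoidHom (α := B) n).ker := by
  have h1 := (nsmulAddMonoidHom (α := B) n).range.card_mul_index
  have h2 := (nsmulAddMonoidHom (α := B) n).ker.card_mul_index
  rw [AddSubgroup.index_ker] at h2
  have h3 : Nat.card (nsmulAddMonoidHom (α := B) n).range ≠ 0 := Nat.card_pos.ne'
  rw [← h2, mul_comm] at h1
  exact Nat.eq_of_mul_eq_mul_right (Nat.pos_of_ne_zero h3) h1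

/-- The index of the multiples of `n` in a finitely generated abelian group. -/
theorem AddSubgroup.index_range_nsmul_of_finite (G : Type*) [AddCommGroup G] [Module.Finite ℤ G]
    {n : ℕ} (hn : n ≠ 0) :
    (nsmulAddMonoidHom (α := G) n).range.index =
      n ^ finrank ℤ G * Nat.card (nsmulAddMonoidHom (α := G) n).ker := by
  obtain ⟨m, ι, _, p, hpp, e, ⟨f⟩⟩ := AddCommGroup.equiv_free_prod_directSum_zmod (G := G)
    (hG := Module.Finite.iff_addGroup_fg.1 inferInstance)
  classical
  have hp : ∀ i, NeZero (p i ^ e i) := fun i => ⟨pow_ne_zero _ (hpp i).ne_zero⟩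
  set B := DirectSum ι fun i => ZMod (p i ^ e i) with hB
  have : Finite B := Finite.of_equiv _ (DirectSum.addEquivProd (fun i => ZMod (p i ^ e i))).symm.toEquiv
  have h1 : (nsmulAddMonoidHom (α := G) n).range.index =
      (nsmulAddMonoidHom (α := (Fin m →₀ ℤ) × B) n).range.index := by
    rw [← AddSubgroup.index_map_equiv _ f]
    congr 1
    exact AddEquiv.map_range_nsmulAddMonoidHom ..
  have h2 : (nsmulAddMonoidHom (α := (Fin m →₀ ℤ) × B) n).range =
      (nsmulAddMonoidHom (α := (Fin m →₀ ℤ)) n).range.prod (nsmulAddMonoidHom (α := B) n).range := by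
    ext ⟨x, y⟩
    simp [AddSubgroup.mem_prod, Prod.ext_iff]
  have h3 : Nat.card (nsmulAddMonoidHom (α := G) n).ker = Nat.card (nsmulAddMonoidHom (α := B) n).ker := by
    refine Nat.card_congr ⟨fun x => ⟨(f x).2, ?_⟩, fun y => ⟨f.symm (0, y), ?_⟩, fun x => ?_, fun y => ?_⟩
    · have := congrArg (fun t => (f t).2) x.2
      simpa using this
    · have := y.2
      simp only [AddMonoidHom.mem_ker, nsmulAddMonoidHom_apply] at this ⊢
      rw [← map_nsmul, Prod.smul_mk, this, smul_zero]
      exact map_zero f.symm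
    · have := congrArg (fun t => (f t).1) x.2
      have h0 : (f (x : G)).1 = 0 := by
        have h : n • (f (x : G)).1 = 0 := by simpa using this
        simpa [hn] using h
      ext
      apply f.injective
      simp only [AddEquiv.apply_symm_apply]
      exact Prod.ext h0.symm rfl
    · ext; simp
  have h4 : finrank ℤ G = m := by
    rw [f.toIntLinearEquiv.finrank_eq]
    have hB0 : finrank ℤ B = 0 := by
      rw [Module.finrank_eq_zero_iff]
      intro x
      exact ⟨Nat.card B, by exact_mod_cast Nat.card_pos.ne', by rw [natCast_zsmul]; exact card_nsmul_eq_zero'⟩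
    have h6 := Submodule.finrank_quotient_add_finrank (LinearMap.ker (LinearMap.fst ℤ (Fin m →₀ ℤ) B))
    rw [← h6, ((LinearMap.fst ℤ (Fin m →₀ ℤ) B).quotKerEquivOfSurjective
      LinearMap.fst_surjective).finrank_eq, LinearMap.ker_fst,
      LinearMap.finrank_range_of_inj LinearMap.inr_injective, hB0]
    simp
  rw [h1, h2, AddSubgroup.index_prod, AddSubgroup.index_range_nsmul, index_range_nsmul_eq_card_ker,
    h3, h4]
  simp

theorem Subgroup.index_range_powMonoidHom (A : Type*) [CommGroup A] [Module.Finite ℤ (Additive A)]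
    {n : ℕ} (hn : n ≠ 0) :
    (powMonoidHom n : A →* A).range.index =
      n ^ finrank ℤ (Additive A) * Nat.card (powMonoidHom n : A →* A).ker :=
  AddSubgroup.index_range_nsmul_of_finite (Additive A) hn

theorem card_ker_powMonoidHom_two {F : Type*} [Field F] [NeZero (2 : F)] (A : Subgroup Fˣ)
    (h : -1 ∈ A) : Nat.card (powMonoidHom 2 : A →* A).ker = 2 := by
  rw [Nat.card_eq_two_iff]
  refine ⟨⟨1, by simp⟩, ⟨⟨-1, h⟩, ?_⟩, ?_, ?_⟩
  · rw [MonoidHom.mem_ker]; ext; simp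
  · intro h
    have := congrArg (fun x : (powMonoidHom 2 : A →* A).ker => (((x : A) : Fˣ) : F)) h
    simp only [OneMemClass.coe_one, Units.val_one, Units.val_neg] at this
    exact NeZero.ne (2 : F) (by linear_combination this)
  · refine Set.eq_univ_of_forall fun x => ?_
    have h1 := x.2
    rw [MonoidHom.mem_ker, powMonoidHom_apply] at h1
    have h2 : (((x : A) : Fˣ) : F) ^ 2 = 1 := by
      have := congrArg (fun x : A => ((x : Fˣ) : F)) h1
      simpa using this
    rcases (by rw [← one_pow 2] at h2; exact sq_eq_sq_iff_eq_or_eq_neg.1 h2 : ((x : A) : Fˣ) = (1 : F) ∨ (((x : A) : Fˣ) : F) = -1) with h3 | h3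
    · left; ext; simpa using h3
    · right; ext; simpa using h3

theorem Subgroup.index_range_sq {F : Type*} [Field F] [NeZero (2 : F)] (A : Subgroup Fˣ)
    (h : -1 ∈ A) [Module.Finite ℤ (Additive A)] :
    (powMonoidHom 2 : A →* A).range.index = 2 ^ (finrank ℤ (Additive A) + 1) := by
  rw [index_range_powMonoidHom A two_ne_zero, card_ker_powMonoidHom_two A h, pow_succ]
end

section
variable {K : Type*} [Field K] [NumberField K]

theorem valuation_eq_exp_of_span_eq {x : 𝓞 K} {v : HeightOneSpectrum (𝓞 K)} {n : ℕ}
    {I : Ideal (𝓞 K)} (h : Ideal.span {x} = v.asIdeal ^ n * I) (hI : ¬ I ≤ v.asIdeal) :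
    v.valuation K (algebraMap (𝓞 K) K x) = exp (-(n : ℤ)) := by
  have h1 : v.valuation K (algebraMap (𝓞 K) K x) ≤ exp (-(n : ℤ)) := by
    rw [valuation_le_exp_iff_mem, ← Ideal.span_singleton_le_iff_mem, h]
    exact Ideal.mul_le_left
  refine h1.antisymm (not_lt.1 fun h2 => hI ?_)
  have h3 : v.valuation K (algebraMap (𝓞 K) K x) ≤ exp (-((n + 1 : ℕ) : ℤ)) := by
    rw [show (-((n + 1 : ℕ) : ℤ)) = -n - 1 by push_cast; ring]
    exact WithZero.le_exp_sub_one_of_lt h2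
  rw [valuation_le_exp_iff_mem, ← Ideal.span_singleton_le_iff_mem, h, ← Ideal.dvd_iff_le,
    pow_succ] at h3
  exact Ideal.le_of_dvd ((mul_dvd_mul_iff_left (pow_ne_zero _ v.ne_bot)).1 h3)

theorem exists_unit_valuation_eq_of_mul_class {v : HeightOneSpectrum (𝓞 K)} {n : ℕ}
    {I : Ideal (𝓞 K)} (hI : I ≠ ⊥) (h : (v.asIdeal ^ n * I).IsPrincipal) (hv : ¬ I ≤ v.asIdeal) :
    ∃ x : Kˣ, v.valuation K (x : K) = exp (-(n : ℤ)) ∧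
      ∀ v' : HeightOneSpectrum (𝓞 K), v' ≠ v → ¬ I ≤ v'.asIdeal → v'.valuation K (x : K) = 1 := by
  obtain ⟨x, hx⟩ := h
  rw [Ideal.submodule_span_eq] at hx
  have hx0 : x ≠ 0 := by
    rintro rfl
    rw [Ideal.span_singleton_zero, Ideal.mul_eq_bot] at hx
    rcases hx with hx | hx
    · exact pow_ne_zero _ v.ne_bot hx
    · exact hI hx
  refine ⟨Units.mk0 (algebraMap (𝓞 K) K x) (by simpa using hx0),
    valuation_eq_exp_of_span_eq hx.symm hv, fun v' h1 h2 => ?_⟩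
  refine (valuation_eq_exp_of_span_eq (n := 0) (I := v.asIdeal ^ n * I) (by simpa using hx.symm)
    fun h3 => ?_).trans (by simp)
  rcases v'.isPrime.mul_le.1 h3 with h4 | h4
  · have h5 := v'.isPrime.le_of_pow_le h4
    exact h1 (HeightOneSpectrum.ext (v.isMaximal.eq_of_le v'.isPrime.ne_top h5).symm)
  · exact h2 h4

theorem exists_generator_pow (v : HeightOneSpectrum (𝓞 K)) :
    ∃ n : ℕ, n ≠ 0 ∧ ∃ x : Kˣ, v.valuation K (x : K) = exp (-(n : ℤ)) ∧
      ∀ v' : HeightOneSpectrum (𝓞 K), v' ≠ v → v'.valuation K (x : K) = 1 := by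
  have h0 : v.asIdeal ∈ nonZeroDivisors (Ideal (𝓞 K)) := mem_nonZeroDivisors_of_ne_zero v.ne_bot
  refine ⟨Nat.card (ClassGroup (𝓞 K)), Nat.card_pos.ne', ?_⟩
  have h1 : ClassGroup.mk0 (⟨v.asIdeal, h0⟩ ^ Nat.card (ClassGroup (𝓞 K))) = 1 := by
    rw [map_pow, pow_card_eq_one']
  rw [ClassGroup.mk0_eq_one_iff] at h1
  obtain ⟨x, h2, h3⟩ := exists_unit_valuation_eq_of_mul_class (v := v) (I := ⊤)
    (n := Nat.card (ClassGroup (𝓞 K))) bot_ne_top.symm (by simpa using h1)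
    (fun h => v.isPrime.ne_top (top_le_iff.1 h))
  exact ⟨x, h2, fun v' hv' => h3 v' hv' fun h => v'.isPrime.ne_top (top_le_iff.1 h)⟩

/-- Away from `S`, the place is odd and every prime has a generator which is an `S`-unit up to
that prime. -/
def IsGoodSet (S : Finset (HeightOneSpectrum (𝓞 K))) : Prop :=
  ∀ v ∉ S, v.valuation K 2 = 1 ∧ ∃ π : Kˣ, v.valuation K (π : K) = exp (-1) ∧
    ∀ v' ∉ S, v' ≠ v → v'.valuation K (π : K) = 1

theorem IsGoodSet.mono {S T : Finset (HeightOneSpectrum (𝓞 K))} (hS : IsGoodSet S) (h : S ⊆ T) :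
    IsGoodSet T := fun v hv => by
  obtain ⟨h1, π, h2, h3⟩ := hS v fun hv' => hv (h hv')
  exact ⟨h1, π, h2, fun v' hv' => h3 v' fun h' => hv' (h h')⟩

theorem finite_setOf_valuation_ne_one (x : Kˣ) :
    {v : HeightOneSpectrum (𝓞 K) | v.valuation K (x : K) ≠ 1}.Finite := by
  have h := (HeightOneSpectrum.Support.finite (𝓞 K) (x : K)).union
    (HeightOneSpectrum.Support.finite (𝓞 K) ((x⁻¹ : Kˣ) : K))
  refine h.subset fun v hv => ?_
  rcases lt_or_gt_of_ne hv with h1 | h1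
  · right
    change 1 < v.valuation K ((x⁻¹ : Kˣ) : K)
    rw [Units.val_inv_eq_inv_val, map_inv₀]
    exact (one_lt_inv₀ (zero_lt_iff.2 (by simp))).2 h1
  · left; exact h1

variable (K) in
theorem exists_isGoodSet : ∃ S : Finset (HeightOneSpectrum (𝓞 K)), IsGoodSet S := by
  classical
  choose I hI using ClassGroup.mk0_surjective (R := 𝓞 K)
  have hfin : (⋃ c, {v : HeightOneSpectrum (𝓞 K) | (I c : Ideal (𝓞 K)) ≤ v.asIdeal}).Finite := by
    refine Set.finite_iUnion fun c => ?_
    refine (Ideal.finite_factors (nonZeroDivisors.ne_zero (I c).2)).subset fun v hv => ?_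
    exact Ideal.dvd_iff_le.2 hv
  have hfin2 := finite_setOf_valuation_ne_one (K := K) (Units.mk0 2 two_ne_zero)
  refine ⟨(hfin.union hfin2).toFinset, fun v hv => ?_⟩
  simp only [Set.Finite.mem_toFinset, Set.mem_union, Set.mem_iUnion, not_or, not_exists,
    Set.mem_ofPred_eq, not_not, Units.val_mk0] at hv ⊢
  refine ⟨hv.2, ?_⟩
  have h0 : v.asIdeal ∈ nonZeroDivisors (Ideal (𝓞 K)) := mem_nonZeroDivisors_of_ne_zero v.ne_bot
  set c := (ClassGroup.mk0 (⟨v.asIdeal, h0⟩ : nonZeroDivisors (Ideal (𝓞 K))))⁻¹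
  have h1 : ClassGroup.mk0 ((⟨v.asIdeal, h0⟩ : nonZeroDivisors (Ideal (𝓞 K))) * I c) = 1 := by
    rw [map_mul, hI, mul_inv_cancel]
  rw [ClassGroup.mk0_eq_one_iff] at h1
  obtain ⟨x, h2, h3⟩ := exists_unit_valuation_eq_of_mul_class (v := v) (I := I c)
    (n := 1) (nonZeroDivisors.ne_zero (I c).2) (by simpa using h1) (hv.1 c)
  exact ⟨x, by simpa using h2, fun v' h4 h5 => h3 v' h5 (h4.1 c)⟩

theorem exists_isGoodSet_superset (T : Finset (HeightOneSpectrum (𝓞 K))) :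
    ∃ S : Finset (HeightOneSpectrum (𝓞 K)), IsGoodSet S ∧ T ⊆ S := by
  classical
  obtain ⟨S, hS⟩ := exists_isGoodSet K
  exact ⟨S ∪ T, hS.mono Finset.subset_union_left, Finset.subset_union_right⟩

/-- The group of `S`-units. -/
noncomputable abbrev sUnits (S : Finset (HeightOneSpectrum (𝓞 K))) : Subgroup Kˣ :=
  Set.unit (S : Set (HeightOneSpectrum (𝓞 K))) K

theorem mem_sUnits {S : Finset (HeightOneSpectrum (𝓞 K))} {x : Kˣ} :
    x ∈ sUnits S ↔ ∀ v ∉ S, v.valuation K (x : K) = 1 := Iff.rfl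

theorem sUnits_mono {S T : Finset (HeightOneSpectrum (𝓞 K))} (h : S ⊆ T) :
    sUnits S ≤ sUnits T := fun x hx => by
  rw [mem_sUnits] at hx ⊢
  exact fun v hv => hx v fun h' => hv (h h')

theorem exists_mem_sUnits (x : Kˣ) : ∃ S : Finset (HeightOneSpectrum (𝓞 K)), x ∈ sUnits S :=
  ⟨(finite_setOf_valuation_ne_one x).toFinset, mem_sUnits.2 fun v hv => by simpa using hv⟩

/-- The valuation vector of an `S`-unit. -/
noncomputable def sUnitsLog (S : Finset (HeightOneSpectrum (𝓞 K))) :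
    Additive (sUnits S) →ₗ[ℤ] (S → ℤ) :=
  AddMonoidHom.toIntLinearMap
    { toFun := fun x v => log (v.1.valuation K ((x.toMul : Kˣ) : K))
      map_zero' := by ext; simp
      map_add' := fun x y => by ext; simp [log_mul] }

theorem sUnitsLog_apply (S : Finset (HeightOneSpectrum (𝓞 K))) (x : Additive (sUnits S)) (v : S) :
    sUnitsLog S x v = log (v.1.valuation K ((x.toMul : Kˣ) : K)) := rfl

/-- The inclusion of the units in the `S`-units. -/
noncomputable def unitsToSUnits (S : Finset (HeightOneSpectrum (𝓞 K))) :
    Additive (𝓞 K)ˣ →ₗ[ℤ] Additive (sUnits S) :=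
  AddMonoidHom.toIntLinearMap (MonoidHom.toAdditive
    ((Units.map (algebraMap (𝓞 K) K : 𝓞 K →* K)).codRestrict (sUnits S) fun x => mem_sUnits.2
      fun v _ => by
        refine (v.valuation_le_one x.1).antisymm ?_
        have := v.valuation_le_one (K := K) x⁻¹.1
        have h : v.valuation K (algebraMap (𝓞 K) K x) * v.valuation K (algebraMap (𝓞 K) K (x⁻¹ : (𝓞 K)ˣ)) = 1 := by
          rw [← map_mul, ← map_mul, Units.mul_inv, map_one, map_one]
        change 1 ≤ v.valuation K (algebraMap (𝓞 K) K x)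
        rw [← h]
        exact mul_le_of_le_one_right' this))

theorem unitsToSUnits_injective (S : Finset (HeightOneSpectrum (𝓞 K))) :
    Function.Injective (unitsToSUnits S) := fun x y h => by
  have := congrArg (fun t => ((t.toMul : Kˣ) : K)) h
  exact Additive.toMul.injective (Units.ext (RingOfIntegers.coe_injective this))

theorem range_unitsToSUnits (S : Finset (HeightOneSpectrum (𝓞 K))) :
    LinearMap.range (unitsToSUnits S) = LinearMap.ker (sUnitsLog S) := by
  ext x
  constructor
  · rintro ⟨u, rfl⟩
    rw [LinearMap.mem_ker]
    ext v
    have := mem_sUnits.1 ((unitsToSUnits ∅ u).toMul).2 v (by simp)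
    rw [sUnitsLog_apply]
    change log (v.1.valuation K (((unitsToSUnits ∅ u).toMul : Kˣ) : K)) = 0
    rw [this, log_one]
  · intro hx
    have h1 : ∀ v : HeightOneSpectrum (𝓞 K), v.valuation K ((x.toMul : Kˣ) : K) = 1 := fun v => by
      by_cases hv : v ∈ S
      · have := congrFun (LinearMap.mem_ker.1 hx) ⟨v, hv⟩
        rw [sUnitsLog_apply] at this
        rw [← exp_log (x := v.valuation K ((x.toMul : Kˣ) : K)) (by simp)]
        rw [show log (v.valuation K ((x.toMul : Kˣ) : K)) = 0 from this, exp_zero]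
      · exact mem_sUnits.1 x.toMul.2 v hv
    obtain ⟨a, ha⟩ := HeightOneSpectrum.mem_integers_of_valuation_le_one K ((x.toMul : Kˣ) : K)
      fun v => (h1 v).le
    obtain ⟨b, hb⟩ := HeightOneSpectrum.mem_integers_of_valuation_le_one K (((x.toMul : Kˣ)⁻¹ : Kˣ) : K)
      fun v => by rw [Units.val_inv_eq_inv_val, map_inv₀, h1 v, inv_one]
    have hab : a * b = 1 := by
      apply RingOfIntegers.coe_injective
      rw [map_mul, ha, hb, map_one, Units.mul_inv]
    refine ⟨Additive.ofMul (Units.mkOfMulEqOne a b hab), ?_⟩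
    exact Additive.toMul.injective (Subtype.ext (Units.ext ha))

theorem finrank_range_sUnitsLog (S : Finset (HeightOneSpectrum (𝓞 K))) :
    finrank ℤ (LinearMap.range (sUnitsLog S)) = S.card := by
  classical
  have h0 : finrank ℤ (S → ℤ) = S.card := by simp
  refine le_antisymm ((Submodule.finrank_le _).trans h0.le) ?_
  choose n hn x hx hx' using exists_generator_pow (K := K)
  have hxS : ∀ v : S, x v ∈ sUnits S := fun v => mem_sUnits.2 fun v' hv' => hx' v v' (by
    rintro rfl; exact hv' v.2)
  have hli : LinearIndependent ℤ fun v : S =>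
      (⟨sUnitsLog S (Additive.ofMul ⟨x v, hxS v⟩), LinearMap.mem_range_self _ _⟩ :
        LinearMap.range (sUnitsLog S)) := by
    rw [Fintype.linearIndependent_iff]
    intro g hg v
    have h1 := congrArg (fun t : LinearMap.range (sUnitsLog S) => (t : S → ℤ) v) hg
    simp only [Submodule.coe_sum, Finset.sum_apply, Submodule.coe_smul, Pi.smul_apply,
      sUnitsLog_apply] at h1
    rw [Finset.sum_eq_single v] at h1
    · simp [hx, hn] at h1
      exact h1
    · intro w _ hwv
      have h2 := hx' w v fun h => hwv (Subtype.ext h.symm)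
      rw [toMul_ofMul, h2, log_one, smul_zero]
    · simp
  have := hli.fintype_card_le_finrank
  simpa using this

instance finite_sUnits (S : Finset (HeightOneSpectrum (𝓞 K))) :
    Module.Finite ℤ (Additive (sUnits S)) := by
  have h1 : Module.Finite ℤ (LinearMap.ker (sUnitsLog S)) := by
    rw [← range_unitsToSUnits]; infer_instance
  have h2 : Module.Finite ℤ (Additive (sUnits S) ⧸ LinearMap.ker (sUnitsLog S)) :=
    Module.Finite.equiv (sUnitsLog S).quotKerEquivRange.symm
  exact Module.Finite.of_submodule_quotient (LinearMap.ker (sUnitsLog S))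

theorem finrank_sUnits (S : Finset (HeightOneSpectrum (𝓞 K))) :
    finrank ℤ (Additive (sUnits S)) = Units.rank K + S.card := by
  rw [← Submodule.finrank_quotient_add_finrank (LinearMap.ker (sUnitsLog S)),
    (sUnitsLog S).quotKerEquivRange.finrank_eq, finrank_range_sUnitsLog, ← range_unitsToSUnits,
    LinearMap.finrank_range_of_inj (unitsToSUnits_injective S), Units.finrank_eq, add_comm]

theorem neg_one_mem_sUnits (S : Finset (HeightOneSpectrum (𝓞 K))) : (-1 : Kˣ) ∈ sUnits S :=
  mem_sUnits.2 fun v _ => by simp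

theorem index_sUnits_sq (S : Finset (HeightOneSpectrum (𝓞 K))) :
    (powMonoidHom 2 : sUnits S →* sUnits S).range.index =
      2 ^ (Fintype.card (InfinitePlace K) + S.card) := by
  rw [Subgroup.index_range_sq _ (neg_one_mem_sUnits S), finrank_sUnits, Units.rank]
  congr 1
  have : 0 < Fintype.card (InfinitePlace K) := Fintype.card_pos
  omega

end

section

/-- `L = K(r)` with `r ^ 2 = c`, and `σ` is the nontrivial automorphism of `L` over `K`. -/
structure IsQuadraticConj {K L : Type*} [Field K] [Field L] [Algebra K L] (c : K)
    (σ : L ≃ₐ[K] L) (r : L) : Prop where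
  sq : r ^ 2 = algebraMap K L c
  conj : σ r = -r
  span : ∀ x, ∃ p q : K, x = algebraMap K L p + algebraMap K L q * r
  ne_zero : r ≠ 0

theorem exists_isQuadraticConj {K : Type u} [Field K] [NumberField K] {c : K} (hc : ¬ IsSquare c) :
    ∃ (L : Type u) (_ : Field L) (_ : Algebra K L) (_ : NumberField L) (σ : L ≃ₐ[K] L) (r : L),
      IsQuadraticConj c σ r := by
  have : Fact (∀ r, r ^ 2 ≠ c + 0 * r) := ⟨fun r h => hc ⟨r, by linear_combination -h⟩⟩
  have h0 : CharZero (QuadraticAlgebra K c 0) := charZero_of_injective_algebraMap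
    (algebraMap K (QuadraticAlgebra K c 0)).injective
  have h1 : FiniteDimensional ℚ (QuadraticAlgebra K c 0) := by
    exact @FiniteDimensional.trans ℚ K (QuadraticAlgebra K c 0) _ _ _ _ _ _
      (IsScalarTower.of_algebraMap_eq fun q => by
        have := RingHom.congr_fun (RingHom.ext_rat (algebraMap ℚ (QuadraticAlgebra K c 0))
          ((algebraMap K (QuadraticAlgebra K c 0)).comp (algebraMap ℚ K))) q
        exact this) _ _
  have h2 : NumberField (QuadraticAlgebra K c 0) := { to_charZero := h0, to_finiteDimensional := h1 }
  refine ⟨QuadraticAlgebra K c 0, inferInstance, inferInstance, h2,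
    AlgEquiv.ofAlgHom
      { toFun := fun z => star z
        map_one' := by simp
        map_mul' := fun x y => by rw [star_mul, mul_comm]
        map_zero' := by simp
        map_add' := fun x y => star_add x y
        commutes' := fun x => by ext <;> simp }
      { toFun := fun z => star z
        map_one' := by simp
        map_mul' := fun x y => by rw [star_mul, mul_comm]
        map_zero' := by simp
        map_add' := fun x y => star_add x y
        commutes' := fun x => by ext <;> simp }
      (by ext <;> simp) (by ext <;> simp), ⟨0, 1⟩, ?_, ?_, ?_, ?_⟩
  · ext <;> simp [pow_two]
  · ext
    · change (star (⟨0, 1⟩ : QuadraticAlgebra K c 0)).re = _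
      simp
    · change (star (⟨0, 1⟩ : QuadraticAlgebra K c 0)).im = _
      simp
  · intro x
    exact ⟨x.re, x.im, by ext <;> simp⟩
  · intro h
    simpa using congrArg QuadraticAlgebra.im h

variable {K L : Type*} [Field K] [Field L] [NumberField K] [NumberField L] [Algebra K L]

theorem IsQuadraticConj.conj_conj {c : K} {σ : L ≃ₐ[K] L} {r : L} (h : IsQuadraticConj c σ r)
    (x : L) : σ (σ x) = x := by
  obtain ⟨p, q, rfl⟩ := h.span x
  simp [h.conj]

theorem IsQuadraticConj.exists_of_fixed {c : K} {σ : L ≃ₐ[K] L} {r : L} (h : IsQuadraticConj c σ r)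
    {x : L} (hx : σ x = x) : ∃ p : K, x = algebraMap K L p := by
  obtain ⟨p, q, rfl⟩ := h.span x
  refine ⟨p, ?_⟩
  simp only [map_add, map_mul, AlgEquiv.commutes, h.conj] at hx
  have h2 : (2 : L) ≠ 0 := two_ne_zero
  have : 2 * (algebraMap K L q * r) = 0 := by linear_combination -hx
  rw [add_eq_left]
  simpa [h2] using this

theorem IsQuadraticConj.mul_conj {c : K} {σ : L ≃ₐ[K] L} {r : L} (h : IsQuadraticConj c σ r)
    (p q : K) : (algebraMap K L p + algebraMap K L q * r) * σ (algebraMap K L p + algebraMap K L q * r)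
      = algebraMap K L (p ^ 2 - c * q ^ 2) := by
  simp only [map_add, map_mul, AlgEquiv.commutes, h.conj, map_sub, map_pow, ← h.sq]
  ring

theorem IsQuadraticConj.finrank_eq {c : K} {σ : L ≃ₐ[K] L} {r : L} (h : IsQuadraticConj c σ r) :
    finrank K L = 2 := by
  have hr : ∀ p : K, r ≠ algebraMap K L p := fun p hp => by
    have := h.conj
    rw [hp, AlgEquiv.commutes, ← hp] at this
    exact h.ne_zero (by
      have h2 : (2 : L) ≠ 0 := two_ne_zero
      have h3 : 2 * r = 0 := by linear_combination this
      simpa [h2] using h3)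
  let f : (Fin 2 → K) →ₗ[K] L := 
    { toFun := fun v => algebraMap K L (v 0) + algebraMap K L (v 1) * r
      map_add' := fun v w => by simp only [Pi.add_apply, map_add]; ring
      map_smul' := fun a v => by
        simp only [Pi.smul_apply, smul_eq_mul, map_mul, RingHom.id_apply, Algebra.smul_def]; ring }
  have hf : Function.Bijective f := by
    constructor
    · rw [injective_iff_map_eq_zero]
      intro v hv
      change algebraMap K L (v 0) + algebraMap K L (v 1) * r = 0 at hv
      have h1 : v 1 = 0 := by
        by_contra h1
        refine hr (- v 0 / v 1) ?_
        have : algebraMap K L (v 1) ≠ 0 := by simpa using h1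
        rw [map_div₀, map_neg, eq_div_iff this]
        linear_combination hv
      rw [h1] at hv
      ext i
      fin_cases i
      · simpa using hv
      · exact h1
    · intro x
      obtain ⟨p, q, rfl⟩ := h.span x
      exact ⟨![p, q], rfl⟩
  rw [← (LinearEquiv.ofBijective f hf).finrank_eq]
  simp

theorem IsQuadraticConj.isTotallyComplex {c : K} {σ : L ≃ₐ[K] L} {r : L}
    (_ : IsQuadraticConj c σ r) [IsTotallyComplex K] : IsTotallyComplex L :=
  isTotallyComplex_of_algebra K L

theorem IsTotallyComplex.finrank_eq_two_mul_card (K : Type*) [Field K] [NumberField K]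
    [IsTotallyComplex K] : finrank ℚ K = 2 * Fintype.card (InfinitePlace K) := by
  rw [IsTotallyComplex.finrank, InfinitePlace.card_eq_nrRealPlaces_add_nrComplexPlaces,
    IsTotallyComplex.nrRealPlaces_eq_zero, zero_add]

theorem IsQuadraticConj.card_infinitePlace {c : K} {σ : L ≃ₐ[K] L} {r : L}
    (h : IsQuadraticConj c σ r) [IsTotallyComplex K] :
    Fintype.card (InfinitePlace L) = 2 * Fintype.card (InfinitePlace K) := by
  have := h.isTotallyComplex
  have h1 := IsTotallyComplex.finrank_eq_two_mul_card K
  have h2 := IsTotallyComplex.finrank_eq_two_mul_card L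
  have h3 := Module.finrank_mul_finrank ℚ K L
  rw [h.finrank_eq] at h3
  omega

/-- The image of a prime under the inverse of an automorphism. -/
noncomputable def primeConj (σ : L ≃ₐ[K] L) (w : HeightOneSpectrum (𝓞 L)) :
    HeightOneSpectrum (𝓞 L) :=
  HeightOneSpectrum.comap (RingOfIntegers.mapRingEquiv (σ : L ≃+* L) : 𝓞 L →+* 𝓞 L)
    (RingOfIntegers.mapRingEquiv (σ : L ≃+* L)).surjective w

theorem WithZero.eq_of_forall_le_exp_neg {x y : ℤᵐ⁰} (hx : x ≤ 1) (hy : y ≤ 1)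
    (h : ∀ n : ℕ, x ≤ exp (-(n : ℤ)) ↔ y ≤ exp (-(n : ℤ))) : x = y := by
  have key : ∀ x y : ℤᵐ⁰, x ≤ 1 → (∀ n : ℕ, x ≤ exp (-(n : ℤ)) → y ≤ exp (-(n : ℤ))) → y ≤ x := by
    intro x y hx h
    by_cases h0 : x = 0
    · subst h0
      by_contra h1
      have hy0 : y ≠ 0 := fun h => h1 (by rw [h])
      have := h ((-log y).toNat + 1) zero_le
      rw [← log_le_iff_le_exp hy0] at this
      push_cast at this
      omega
    · rw [← exp_log h0, ← exp_zero, exp_le_exp] at hx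
      have := h (-log x).toNat (by rw [← exp_log h0, exp_le_exp]; simp [hx])
      rw [Int.toNat_of_nonneg (by omega), neg_neg, exp_log h0] at this
      exact this
  exact (key _ _ hy fun n => (h n).2).antisymm (key _ _ hx fun n => (h n).1)

theorem valuation_primeConj (σ : L ≃ₐ[K] L) (w : HeightOneSpectrum (𝓞 L)) (x : L) :
    (primeConj σ w).valuation L x = w.valuation L (σ x) := by
  obtain ⟨x, y, hy, rfl⟩ := IsFractionRing.div_surjective (A := 𝓞 L) x
  have key : ∀ x : 𝓞 L, (primeConj σ w).valuation L (algebraMap (𝓞 L) L x) =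
      w.valuation L (σ (algebraMap (𝓞 L) L x)) := fun x => by
    have h1 : σ (algebraMap (𝓞 L) L x) =
      algebraMap (𝓞 L) L (RingOfIntegers.mapRingEquiv (σ : L ≃+* L) x) := rfl
    rw [h1]
    refine WithZero.eq_of_forall_le_exp_neg (HeightOneSpectrum.valuation_le_one _ _)
      (HeightOneSpectrum.valuation_le_one _ _) fun n => ?_
    rw [valuation_le_exp_iff_mem, valuation_le_exp_iff_mem]
    have : (primeConj σ w).asIdeal ^ n =
        (w.asIdeal ^ n).comap (RingOfIntegers.mapRingEquiv (σ : L ≃+* L)) := by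
      change (w.asIdeal.comap (RingOfIntegers.mapRingEquiv (σ : L ≃+* L))) ^ n = _
      rw [← Ideal.map_symm, ← Ideal.map_symm, Ideal.map_pow]
    rw [this]
    rfl
  rw [map_div₀, map_div₀, map_div₀, key, key]

/-- The prime of `K` below a prime of `L`. -/
noncomputable def primeBelow (K : Type*) {L : Type*} [Field K] [Field L] [NumberField K]
    [NumberField L] [Algebra K L] (w : HeightOneSpectrum (𝓞 L)) : HeightOneSpectrum (𝓞 K) :=
  w.under (𝓞 K)

theorem exists_valuation_algebraMap (w : HeightOneSpectrum (𝓞 L)) :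
    ∃ e : ℕ, e ≠ 0 ∧ ∀ x : K, w.valuation L (algebraMap K L x) = (primeBelow K w).valuation K x ^ e := by
  have : w.asIdeal.LiesOver (primeBelow K w).asIdeal := ⟨rfl⟩
  refine ⟨(primeBelow K w).asIdeal.ramificationIdx' w.asIdeal,
    Ideal.IsDedekindDomain.ramificationIdx'_ne_zero_of_liesOver w.asIdeal (primeBelow K w).ne_bot,
    fun x => (HeightOneSpectrum.valuation_liesOver L (primeBelow K w) w x).symm⟩

theorem valuation_algebraMap_lt_one_iff (w : HeightOneSpectrum (𝓞 L)) (x : K) :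
    w.valuation L (algebraMap K L x) < 1 ↔ (primeBelow K w).valuation K x < 1 := by
  obtain ⟨e, he, h⟩ := exists_valuation_algebraMap (K := K) w
  rw [h, pow_lt_one_iff he]

theorem valuation_algebraMap_eq_one_iff (w : HeightOneSpectrum (𝓞 L)) (x : K) :
    w.valuation L (algebraMap K L x) = 1 ↔ (primeBelow K w).valuation K x = 1 := by
  obtain ⟨e, he, h⟩ := exists_valuation_algebraMap (K := K) w
  rw [h]; exact pow_eq_one_iff_left he

theorem primeBelow_eq_of_forall {w : HeightOneSpectrum (𝓞 L)} {v : HeightOneSpectrum (𝓞 K)}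
    (h : ∀ x : K, (primeBelow K w).valuation K x < 1 ↔ v.valuation K x < 1) : primeBelow K w = v :=
  HeightOneSpectrum.eq_of_valuation_isEquiv_valuation (K := K)
    (Valuation.isEquiv_iff_val_lt_one.2 fun {x} => h x)

theorem primeBelow_primeConj (σ : L ≃ₐ[K] L) (w : HeightOneSpectrum (𝓞 L)) :
    primeBelow K (primeConj σ w) = primeBelow K w :=
  primeBelow_eq_of_forall fun x => by
    rw [← valuation_algebraMap_lt_one_iff, ← valuation_algebraMap_lt_one_iff, valuation_primeConj,
      AlgEquiv.commutes]

theorem primeBelow_surjective : Function.Surjective (primeBelow K (L := L)) := fun v => by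
  have : Algebra.IsIntegral (𝓞 K) (𝓞 L) := inferInstance
  obtain ⟨P, hP, h⟩ := v.asIdeal.exists_ideal_over_prime_of_isIntegral_of_isDomain (S := 𝓞 L) (by simp)
  refine ⟨⟨P, hP, ?_⟩, HeightOneSpectrum.ext h⟩
  rintro rfl
  refine v.ne_bot ?_
  rw [← h, Ideal.comap_bot_of_injective]
  exact RingOfIntegers.algebraMap.injective K L

theorem finite_primeBelow_fiber (v : HeightOneSpectrum (𝓞 K)) :
    {w : HeightOneSpectrum (𝓞 L) | primeBelow K w = v}.Finite := by
  obtain ⟨x, hx⟩ := v.valuation_exists_uniformizer K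
  have hx0 : algebraMap K L x ≠ 0 := by
    intro h
    have : x = 0 := by simpa using h
    rw [this, map_zero] at hx
    exact exp_ne_zero hx.symm
  refine (finite_setOf_valuation_ne_one (Units.mk0 _ hx0)).subset fun w hw => ?_
  have hw : primeBelow K w = v := hw
  change w.valuation L (algebraMap K L x) ≠ 1
  rw [Ne, valuation_algebraMap_eq_one_iff, hw, hx, ← exp_zero, exp_inj]
  norm_num

/-- A place at which `c` is a square splits in `K(√c)`. -/
theorem exists_ne_primeBelow_eq {c : Kˣ} {σ : L ≃ₐ[K] L} {r : L} (h : IsQuadraticConj (c : K) σ r)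
    {v : HeightOneSpectrum (𝓞 K)} (hc : c ∈ localSquares (v.valuation K)) :
    ∃ w w' : HeightOneSpectrum (𝓞 L), w ≠ w' ∧ primeBelow K w = v ∧ primeBelow K w' = v := by
  obtain ⟨w, hw⟩ := primeBelow_surjective (K := K) (L := L) v
  refine ⟨w, primeConj σ w, fun he => ?_, hw, by rw [primeBelow_primeConj, hw]⟩
  obtain ⟨ε, y, hε, hy⟩ := hc
  have hε' : w.valuation L (algebraMap K L ε) < 1 := by
    rw [valuation_algebraMap_lt_one_iff, hw]; exact hε
  have h2 : (2 : L) ≠ 0 := two_ne_zero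
  have h4 := congrArg (algebraMap K L) hy
  simp only [map_mul, map_add, map_one, map_pow, map_ofNat, ← h.sq] at h4
  set t : L := (algebraMap K L y / r - 1) / 2 with ht
  have hr := h.ne_zero
  have e1 : t * (t + 1) = algebraMap K L ε := by
    have : algebraMap K L y = (2 * t + 1) * r := by rw [ht]; field_simp; ring
    rw [this] at h4
    have h5 : r ^ 2 * (4 * (t * (t + 1) - algebraMap K L ε)) = 0 := by linear_combination -h4
    have h6 : (4 : L) ≠ 0 := by norm_num
    have : t * (t + 1) - algebraMap K L ε = 0 := by simpa [hr, h6] using h5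
    linear_combination this
  have e2 : σ t = -(t + 1) := by
    rw [ht, map_div₀, map_sub, map_div₀, AlgEquiv.commutes, h.conj, map_one, map_ofNat]
    field_simp
    ring
  have e3 : w.valuation L (t + 1) = w.valuation L t := by
    conv_rhs => rw [he, valuation_primeConj, e2, Valuation.map_neg]
  rw [← e1, map_mul, e3, ← sq, pow_lt_one_iff two_ne_zero] at hε'
  have := (w.valuation L).map_add_eq_of_lt_right (x := t) (y := 1) (by simpa using hε')
  rw [e3, map_one] at this
  exact hε'.ne this

end

section

theorem index_range_sq_of_injective {F A : Type*} [Field F] [NeZero (2 : F)] [CommGroup A]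
    [Module.Finite ℤ (Additive A)] {f : A →* Fˣ} (hf : Function.Injective f) {a : A}
    (ha : f a = -1) :
    (powMonoidHom 2 : A →* A).range.index = 2 ^ (finrank ℤ (Additive A) + 1) := by
  rw [Subgroup.index_range_powMonoidHom A two_ne_zero, pow_succ]
  congr 1
  rw [Nat.card_eq_two_iff]
  refine ⟨⟨1, by simp⟩, ⟨a, ?_⟩, ?_, ?_⟩
  · rw [MonoidHom.mem_ker]; apply hf; ext; simp [ha]
  · intro h
    have := congrArg (fun x : (powMonoidHom 2 : A →* A).ker => (f (x : A) : F)) h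
    simp only [map_one, ha, Units.val_one, Units.val_neg] at this
    exact NeZero.ne (2 : F) (by linear_combination this)
  · refine Set.eq_univ_of_forall fun x => ?_
    have h1 := x.2
    rw [MonoidHom.mem_ker, powMonoidHom_apply] at h1
    have h2 : (f (x : A) : F) ^ 2 = 1 ^ 2 := by
      rw [← Units.val_pow_eq_pow_val, ← map_pow, h1]; simp
    rcases sq_eq_sq_iff_eq_or_eq_neg.1 h2 with h3 | h3
    · left; apply Subtype.ext; apply hf; ext; simpa using h3
    · right; apply Subtype.ext; apply hf; ext; simpa [ha] using h3

section Involution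
variable {M : Type*} [CommGroup M] (σ : M →* M)

/-- The norm map of an involution. -/
def involutionNorm (hσ : ∀ m, σ (σ m) = m) : M →* (MonoidHom.eqLocus σ (MonoidHom.id M)) :=
  (MonoidHom.id M * σ).codRestrict _ fun m => by
    change σ (m * σ m) = m * σ m
    rw [map_mul, hσ, mul_comm]

/-- The map `m ↦ m / σ m`. -/
def involutionDiv (hσ : ∀ m, σ (σ m) = m) : M →* (MonoidHom.id M * σ).ker :=
  (MonoidHom.id M / σ).codRestrict _ fun m => by
    change m / σ m * σ (m / σ m) = 1
    rw [map_div, hσ]; simp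

theorem index_range_involutionNorm (hσ : ∀ m, σ (σ m) = m)
    (h : ∀ x : M, x * σ x = 1 → ∃ y : M, y / σ y = x) :
    (powMonoidHom 2 : (MonoidHom.id M * σ).ker →* (MonoidHom.id M * σ).ker).range.index *
      (involutionNorm σ hσ).range.index =
    (powMonoidHom 2 : (MonoidHom.eqLocus σ (MonoidHom.id M)) →* _).range.index := by
  set N := involutionNorm σ hσ
  set θ := involutionDiv σ hσ
  have hθ : Function.Surjective θ := fun x => by
    obtain ⟨y, hy⟩ := h x x.2
    exact ⟨y, Subtype.ext hy⟩
  have h1 : (powMonoidHom 2 : (MonoidHom.eqLocus σ (MonoidHom.id M)) →* _).range ≤ N.range := by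
    rintro _ ⟨u, rfl⟩
    refine ⟨u, Subtype.ext ?_⟩
    change (u : M) * σ u = (u : M) ^ 2
    rw [show σ u = u from u.2, sq]
  rw [← Subgroup.relIndex_mul_index h1, ← Subgroup.index_comap]
  congr 1
  rw [← Subgroup.index_comap_of_surjective _ hθ]
  congr 1
  ext m
  constructor
  · rintro ⟨m1, hm1⟩
    have e1 : (m1 : M) ^ 2 = m / σ m := congrArg Subtype.val hm1
    have e2 : (m1 : M) * σ m1 = 1 := m1.2
    refine ⟨⟨m / m1, ?_⟩, Subtype.ext ?_⟩
    · change σ (m / m1) = m / m1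
      rw [map_div, eq_inv_of_mul_eq_one_right e2]
      rw [eq_div_iff_mul_eq', div_inv_eq_mul]
      rw [eq_div_iff_mul_eq'] at e1
      rw [sq] at e1
      rw [mul_assoc, mul_comm]; exact e1
    · change (m / m1 : M) ^ 2 = m * σ m
      rw [div_pow, e1, div_div_eq_mul_div, sq, mul_assoc, mul_div_assoc, mul_div_cancel_left]
  · rintro ⟨u, hu⟩
    have e1 : (u : M) ^ 2 = m * σ m := congrArg Subtype.val hu
    have e2 : σ u = u := u.2
    refine ⟨⟨m / u, ?_⟩, Subtype.ext ?_⟩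
    · change m / u * σ (m / u) = 1
      rw [map_div, e2, div_mul_div_comm, ← sq, e1, div_self']
    · change (m / u : M) ^ 2 = m / σ m
      rw [div_pow, e1, sq, mul_div_mul_left_eq_div]

theorem finrank_le_involution (hσ : ∀ m, σ (σ m) = m) [Module.Finite ℤ (Additive M)] :
    finrank ℤ (Additive M) ≤ finrank ℤ (Additive (MonoidHom.id M * σ).ker) +
      finrank ℤ (Additive (MonoidHom.eqLocus σ (MonoidHom.id M))) := by
  let f : Additive M →ₗ[ℤ] Additive (MonoidHom.eqLocus σ (MonoidHom.id M)) :=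
    AddMonoidHom.toIntLinearMap (MonoidHom.toAdditive (involutionNorm σ hσ))
  let g : Additive (MonoidHom.id M * σ).ker →ₗ[ℤ] Additive M :=
    AddMonoidHom.toIntLinearMap (MonoidHom.toAdditive (MonoidHom.id M * σ).ker.subtype)
  let i : Additive (MonoidHom.eqLocus σ (MonoidHom.id M)) →ₗ[ℤ] Additive M :=
    AddMonoidHom.toIntLinearMap (MonoidHom.toAdditive
      (MonoidHom.eqLocus σ (MonoidHom.id M)).subtype)
  have hi : Function.Injective i := fun x y h => Subtype.ext h
  have : Module.Finite ℤ (Additive (MonoidHom.eqLocus σ (MonoidHom.id M))) :=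
    Module.Finite.of_injective i hi
  have hg : Function.Injective g := fun x y h => Subtype.ext h
  have hfg : LinearMap.ker f = LinearMap.range g := by
    ext m
    constructor
    · intro h
      exact ⟨⟨m, congrArg Subtype.val h⟩, rfl⟩
    · rintro ⟨x, rfl⟩
      exact Subtype.ext x.2
  rw [← Submodule.finrank_quotient_add_finrank (LinearMap.ker f), f.quotKerEquivRange.finrank_eq,
    add_comm, hfg, LinearMap.finrank_range_of_inj hg]
  exact Nat.add_le_add_left (Submodule.finrank_le _) _

end Involution
end

section

/-- Nonzero elements of the form `y ^ 2 - c * z ^ 2`. -/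
def globalNorms {K : Type*} [Field K] (c : K) : Subgroup Kˣ where
  carrier := {x | ∃ y z : K, (x : K) = y ^ 2 - c * z ^ 2}
  one_mem' := ⟨1, 0, by simp⟩
  mul_mem' := by
    rintro x x' ⟨y, z, e⟩ ⟨y', z', e'⟩
    refine ⟨y * y' + c * z * z', y * z' + z * y', ?_⟩
    rw [Units.val_mul, e, e']; ring
  inv_mem' := by
    rintro x ⟨y, z, e⟩
    refine ⟨y / x, z / x, ?_⟩
    rw [Units.val_inv_eq_inv_val]
    have := x.ne_zero
    field_simp
    rw [e]

theorem globalNorms_le_localNorms {K : Type*} [Field K] (w : Valuation K ℤᵐ⁰) (c : K) :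
    globalNorms c ≤ localNorms w c := by
  rintro x ⟨y, z, e⟩
  exact mem_localNorms_of_eq e

variable {K L : Type*} [Field K] [Field L] [NumberField K] [NumberField L] [Algebra K L]

theorem IsGoodSet.exists_valuation_eq {S : Finset (HeightOneSpectrum (𝓞 K))} (hS : IsGoodSet S)
    {F : Finset (HeightOneSpectrum (𝓞 K))} (f : HeightOneSpectrum (𝓞 K) → ℤ)
    (hf : ∀ v ∉ F, f v = 0) :
    ∃ k : Kˣ, ∀ v ∉ S, v.valuation K (k : K) = exp (f v) := by
  classical
  choose! h2 π hπ hπ' using hS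
  refine ⟨∏ v ∈ F \ S, π v ^ (-f v), fun v hv => ?_⟩
  rw [Units.coe_prod, map_prod]
  have h1 : ∀ u ∈ F \ S, u ≠ v → v.valuation K ((π u ^ (-f u) : Kˣ) : K) = 1 := fun u hu huv => by
    rw [Units.val_zpow_eq_zpow_val, map_zpow₀, hπ' u (Finset.mem_sdiff.1 hu).2 v hv huv.symm,
      one_zpow]
  rw [Finset.prod_eq_single v h1]
  · rw [Units.val_zpow_eq_zpow_val, map_zpow₀, hπ v hv, ← exp_zsmul]
    simp
  · intro h
    have : v ∉ F := fun h' => h (Finset.mem_sdiff.2 ⟨h', hv⟩)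
    simp [hf v this]

theorem IsGoodSet.exists_valuation_eq_max {S : Finset (HeightOneSpectrum (𝓞 K))} (hS : IsGoodSet S)
    {p q : K} (h : p ≠ 0 ∨ q ≠ 0) :
    ∃ k : Kˣ, ∀ v ∉ S, v.valuation K (k : K) = max (v.valuation K p) (v.valuation K q) := by
  classical
  by_cases hp : p = 0
  · subst hp
    exact ⟨Units.mk0 q (by simpa using h), fun v _ => by simp⟩
  by_cases hq : q = 0
  · subst hq
    exact ⟨Units.mk0 p (by simpa using h), fun v _ => by simp⟩
  have hfin := (finite_setOf_valuation_ne_one (Units.mk0 p hp)).union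
    (finite_setOf_valuation_ne_one (Units.mk0 q hq))
  have hne : ∀ v : HeightOneSpectrum (𝓞 K), max (v.valuation K p) (v.valuation K q) ≠ 0 := fun v => by
    refine ne_of_gt (lt_max_of_lt_left ?_)
    rw [zero_lt_iff]; simpa using hp
  obtain ⟨k, hk⟩ := hS.exists_valuation_eq (F := hfin.toFinset)
    (fun v => log (max (v.valuation K p) (v.valuation K q))) fun v hv => by
      simp only [Set.Finite.mem_toFinset, Set.mem_union, Set.mem_ofPred_eq, not_or, not_not,
        Units.val_mk0] at hv
      simp [hv]
  exact ⟨k, fun v hv => by rw [hk v hv, exp_log (hne v)]⟩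

/-- The primes of `L` above those in `S`. -/
noncomputable def primesAbove (L : Type*) [Field L] [NumberField L] [Algebra K L]
    (S : Finset (HeightOneSpectrum (𝓞 K))) : Finset (HeightOneSpectrum (𝓞 L)) :=
  (S.finite_toSet.preimage' (f := primeBelow K (L := L)) fun v _ => finite_primeBelow_fiber v).toFinset

theorem mem_primesAbove {S : Finset (HeightOneSpectrum (𝓞 K))} {w : HeightOneSpectrum (𝓞 L)} :
    w ∈ primesAbove L S ↔ primeBelow K w ∈ S := by simp [primesAbove]

theorem card_add_card_le_card_primesAbove {c : Kˣ} {σ : L ≃ₐ[K] L} {r : L}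
    (h : IsQuadraticConj (c : K) σ r) (S : Finset (HeightOneSpectrum (𝓞 K)))
    [DecidablePred fun v : HeightOneSpectrum (𝓞 K) => c ∈ localSquares (v.valuation K)] :
    S.card + (S.filter fun v => c ∈ localSquares (v.valuation K)).card ≤ (primesAbove L S).card := by
  classical
  rw [Finset.card_eq_sum_card_fiberwise (f := primeBelow K) (s := primesAbove L S) (t := S)
    fun w hw => mem_primesAbove.1 hw, Finset.card_eq_sum_ones, Finset.card_filter,
    ← Finset.sum_add_distrib]
  refine Finset.sum_le_sum fun v hv => ?_
  split_ifs with hc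
  · obtain ⟨w, w', h1, h2, h3⟩ := exists_ne_primeBelow_eq h hc
    refine Finset.one_lt_card.2 ⟨w, ?_, w', ?_, h1⟩ <;> simp [mem_primesAbove, h2, h3, hv]
  · obtain ⟨w, hw⟩ := primeBelow_surjective (K := K) (L := L) v
    refine Finset.card_pos.2 ⟨w, ?_⟩
    simp [mem_primesAbove, hw, hv]

theorem algebraMap_mem_sUnits_iff {S : Finset (HeightOneSpectrum (𝓞 K))} {x : Kˣ} :
    Units.map (algebraMap K L : K →* L) x ∈ sUnits (primesAbove L S) ↔ x ∈ sUnits S := by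
  rw [mem_sUnits, mem_sUnits]
  constructor
  · intro h v hv
    obtain ⟨w, hw⟩ := primeBelow_surjective (K := K) (L := L) v
    have := h w (by rwa [mem_primesAbove, hw])
    rw [← hw, ← valuation_algebraMap_eq_one_iff (L := L)]
    exact this
  · intro h w hw
    rw [mem_primesAbove] at hw
    exact (valuation_algebraMap_eq_one_iff w (x : K)).2 (h _ hw)

/-- The automorphism of `S`-units induced by an automorphism of the field. -/
noncomputable def sUnitsConj (σ : L ≃ₐ[K] L) (S : Finset (HeightOneSpectrum (𝓞 K))) :
    sUnits (primesAbove L S) →* sUnits (primesAbove L S) :=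
  ((Units.map (σ : L →* L)).comp (Subgroup.subtype _)).codRestrict _ fun x => mem_sUnits.2
    fun w hw => by
      have := mem_sUnits.1 x.2 (primeConj σ w) (by
        rwa [mem_primesAbove, primeBelow_primeConj, ← mem_primesAbove])
      rw [valuation_primeConj] at this
      exact this

/-- Hilbert's theorem 90 for `S`-units. -/
theorem exists_div_conj_eq {c : Kˣ} {σ : L ≃ₐ[K] L} {r : L}
    (h : IsQuadraticConj (c : K) σ r) {S : Finset (HeightOneSpectrum (𝓞 K))} (hS : IsGoodSet S)
    (hc : c ∈ sUnits S) (x : sUnits (primesAbove L S)) (hx : x * sUnitsConj σ S x = 1) :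
    ∃ y : sUnits (primesAbove L S), y / sUnitsConj σ S y = x := by
  set X : L := ((x : Lˣ) : L) with hX
  have hX0 : X ≠ 0 := (x : Lˣ).ne_zero
  have hx' : X * σ X = 1 := congrArg (fun t : sUnits (primesAbove L S) => ((t : Lˣ) : L)) hx
  obtain ⟨y, hy0, hy⟩ : ∃ y : L, y ≠ 0 ∧ y = X * σ y := by
    by_cases h1 : 1 + X = 0
    · refine ⟨r, h.ne_zero, ?_⟩
      rw [h.conj]
      linear_combination r * h1
    · refine ⟨1 + X, h1, ?_⟩
      rw [map_add, map_one]
      linear_combination -hx'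
  obtain ⟨p, q, hpq⟩ := h.span y
  have hpq0 : p ≠ 0 ∨ q ≠ 0 := by
    by_contra! h0
    rw [h0.1, h0.2] at hpq
    simp at hpq
    exact hy0 hpq
  obtain ⟨k, hk⟩ := hS.exists_valuation_eq_max hpq0
  have hk0 : algebraMap K L k ≠ 0 := by simp
  have hmem : Units.mk0 (y / algebraMap K L k) (div_ne_zero hy0 hk0) ∈ sUnits (primesAbove L S) := by
    rw [mem_sUnits]
    intro w hw
    have hv : primeBelow K w ∉ S := by rwa [mem_primesAbove] at hw
    have h2 : w.valuation L (2 : L) = 1 := by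
      have := (valuation_algebraMap_eq_one_iff w (2 : K)).2 (hS _ hv).1
      rwa [map_ofNat] at this
    have hr : w.valuation L r = 1 := by
      have h3 := (valuation_algebraMap_eq_one_iff w (c : K)).2 (mem_sUnits.1 hc _ hv)
      rw [← h.sq, map_pow] at h3
      exact (pow_eq_one_iff_left two_ne_zero).1 h3
    have hX1 : w.valuation L X = 1 := mem_sUnits.1 x.2 w hw
    have hσy : w.valuation L (σ y) = w.valuation L y := by
      conv_rhs => rw [hy, map_mul, hX1, one_mul]
    have hσ : σ y = algebraMap K L p - algebraMap K L q * r := by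
      rw [hpq]; simp [h.conj, sub_eq_add_neg]
    have hp : w.valuation L (algebraMap K L p) ≤ w.valuation L y := by
      have : w.valuation L (2 * algebraMap K L p) ≤ w.valuation L y := by
        rw [show 2 * algebraMap K L p = y + σ y by rw [hσ, hpq]; ring]
        exact (Valuation.map_add _ _ _).trans (by rw [hσy, max_self])
      rwa [map_mul, h2, one_mul] at this
    have hq : w.valuation L (algebraMap K L q) ≤ w.valuation L y := by
      have : w.valuation L (2 * (algebraMap K L q * r)) ≤ w.valuation L y := by
        rw [show 2 * (algebraMap K L q * r) = y - σ y by rw [hσ, hpq]; ring]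
        exact (Valuation.map_sub _ _ _).trans (by rw [hσy, max_self])
      rwa [map_mul, map_mul, h2, one_mul, hr, mul_one] at this
    have hy1 : w.valuation L y = max (w.valuation L (algebraMap K L p)) (w.valuation L (algebraMap K L q)) := by
      refine le_antisymm ?_ (max_le hp hq)
      conv_lhs => rw [hpq]
      refine (Valuation.map_add _ _ _).trans ?_
      rw [map_mul, hr, mul_one]
    obtain ⟨e, he, hval⟩ := exists_valuation_algebraMap (K := K) w
    have hk1 : w.valuation L (algebraMap K L k) = w.valuation L y := by
      rw [hy1, hval, hval, hval, hk _ hv]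
      rcases le_total ((primeBelow K w).valuation K p) ((primeBelow K w).valuation K q) with h3 | h3
      · rw [max_eq_right h3, max_eq_right (pow_le_pow_left₀ zero_le h3 e)]
      · rw [max_eq_left h3, max_eq_left (pow_le_pow_left₀ zero_le h3 e)]
    rw [Units.val_mk0, map_div₀, hk1, div_self]
    simpa using hy0
  refine ⟨⟨_, hmem⟩, ?_⟩
  rw [div_eq_iff_eq_mul]
  apply Subtype.ext
  apply Units.ext
  change y / algebraMap K L k = X * σ (y / algebraMap K L k)
  rw [map_div₀, AlgEquiv.commutes, ← mul_div_assoc, ← hy]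

theorem finite_additive_subgroup {A : Type*} [CommGroup A] [Module.Finite ℤ (Additive A)]
    (H : Subgroup A) : Module.Finite ℤ (Additive H) := by
  let g : Additive H →ₗ[ℤ] Additive A :=
    AddMonoidHom.toIntLinearMap (MonoidHom.toAdditive H.subtype)
  exact Module.Finite.of_injective g fun x y h => Subtype.ext h

theorem index_range_sq_subgroup {F : Type*} [Field F] [NeZero (2 : F)] {U : Subgroup Fˣ}
    [Module.Finite ℤ (Additive U)] {H : Subgroup U} (h1 : (-1 : Fˣ) ∈ U)
    (h2 : (⟨-1, h1⟩ : U) ∈ H) :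
    (powMonoidHom 2 : H →* H).range.index = 2 ^ (finrank ℤ (Additive H) + 1) := by
  have := finite_additive_subgroup H
  let f : H →* Fˣ := U.subtype.comp H.subtype
  exact index_range_sq_of_injective (f := f) (fun x y h => Subtype.ext (Subtype.ext h))
    (a := ⟨⟨-1, h1⟩, h2⟩) rfl

/-- First inequality for the norm index of `S`-units in a quadratic extension. -/
theorem two_mul_relIndex_globalNorms_le [IsTotallyComplex K] {c : Kˣ} (hc : ¬ IsSquare (c : K))
    {S : Finset (HeightOneSpectrum (𝓞 K))} (hS : IsGoodSet S) (hcS : c ∈ sUnits S)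
    [DecidablePred fun v : HeightOneSpectrum (𝓞 K) => c ∉ localSquares (v.valuation K)] :
    (globalNorms (c : K)).relIndex (sUnits S) ≠ 0 ∧
    2 * (globalNorms (c : K)).relIndex (sUnits S) ≤
      2 ^ (S.filter fun v => c ∉ localSquares (v.valuation K)).card := by
  classical
  obtain ⟨L, _, _, _, σ, r, h⟩ := exists_isQuadraticConj hc
  set τ := sUnitsConj σ S
  have hτ : ∀ m, τ (τ m) = m := fun m => Subtype.ext (Units.ext (h.conj_conj _))
  let j : sUnits S →* MonoidHom.eqLocus τ (MonoidHom.id _) :=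
    (((Units.map (algebraMap K L : K →* L)).comp (Subgroup.subtype _)).codRestrict
      (sUnits (primesAbove L S)) fun x => algebraMap_mem_sUnits_iff.2 x.2).codRestrict _ fun x =>
        Subtype.ext (Units.ext (σ.commutes _))
  have hj : Function.Bijective j := by
    constructor
    · intro x y hxy
      have := congrArg (fun t : MonoidHom.eqLocus τ (MonoidHom.id _) =>
        (((t : sUnits (primesAbove L S)) : Lˣ) : L)) hxy
      exact Subtype.ext (Units.ext ((algebraMap K L).injective this))
    · rintro ⟨x, hx⟩
      have hx' : σ ((x : Lˣ) : L) = ((x : Lˣ) : L) :=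
        congrArg (fun t : sUnits (primesAbove L S) => ((t : Lˣ) : L)) hx
      obtain ⟨p, hp⟩ := h.exists_of_fixed hx'
      have hp0 : p ≠ 0 := by
        rintro rfl
        rw [map_zero] at hp
        exact (x : Lˣ).ne_zero hp
      have hxp : Units.map (algebraMap K L : K →* L) (Units.mk0 p hp0) = (x : Lˣ) :=
        Units.ext hp.symm
      exact ⟨⟨Units.mk0 p hp0, algebraMap_mem_sUnits_iff.1 (hxp ▸ x.2)⟩,
        Subtype.ext (Subtype.ext hxp)⟩
  have hrU : finrank ℤ (Additive (MonoidHom.eqLocus τ (MonoidHom.id _))) =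
      Units.rank K + S.card := by
    rw [← finrank_sUnits S]
    exact (LinearEquiv.ofBijective (AddMonoidHom.toIntLinearMap (MonoidHom.toAdditive j))
      hj).finrank_eq.symm
  have hrM := finrank_sUnits (primesAbove L S)
  have hle := finrank_le_involution τ hτ
  have hidx := index_range_involutionNorm τ hτ fun x hx => exists_div_conj_eq h hS hcS x hx
  rw [index_range_sq_subgroup (neg_one_mem_sUnits _) (Subtype.ext (Units.ext (by
        change (-1 : L) * σ (-1) = 1
        simp))),
    index_range_sq_subgroup (neg_one_mem_sUnits _) (Subtype.ext (Units.ext (by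
        change σ (-1) = (-1 : L)
        simp))), hrU] at hidx
  have hcard := card_add_card_le_card_primesAbove h S
  have hinf := h.card_infinitePlace
  have hfilter := Finset.card_filter_add_card_filter_not
    (s := S) (fun v => c ∈ localSquares (v.valuation K))
  have hposK : 0 < Fintype.card (InfinitePlace K) := Fintype.card_pos
  have hposL : 0 < Fintype.card (InfinitePlace L) := Fintype.card_pos
  rw [Units.rank] at hrM hidx hrU
  rw [hrM, hrU] at hle
  set k := (involutionNorm τ hτ).range.index with hk
  have hk0 : k ≠ 0 := fun h0 => by
    rw [h0, mul_zero] at hidx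
    exact (pow_ne_zero _ two_ne_zero) hidx.symm
  have hk2 : 2 * k ≤ 2 ^ (S.filter fun v => c ∉ localSquares (v.valuation K)).card := by
    set a := finrank ℤ (Additive (MonoidHom.id _ * τ).ker) with ha
    have h1 : 2 ^ a * (2 * k) = 2 ^ (Fintype.card (InfinitePlace K) - 1 + S.card + 1) := by
      rw [← hidx]; ring
    refine le_of_mul_le_mul_left ?_ (Nat.two_pow_pos a)
    rw [h1, ← pow_add]
    exact Nat.pow_le_pow_right (by norm_num) (by omega)
  have hle2 : ((involutionNorm τ hτ).range.comap j) ≤ (globalNorms (c : K)).subgroupOf (sUnits S) := by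
    rintro x ⟨m, hm⟩
    obtain ⟨p, q, hpq⟩ := h.span ((m : Lˣ) : L)
    refine ⟨p, q, (algebraMap K L).injective ?_⟩
    rw [← h.mul_conj, ← hpq]
    exact (congrArg (fun t : MonoidHom.eqLocus τ (MonoidHom.id _) =>
        (((t : sUnits (primesAbove L S)) : Lˣ) : L)) hm).symm
  have hdvd := Subgroup.index_dvd_of_le hle2
  rw [Subgroup.index_comap_of_surjective _ hj.2, ← hk] at hdvd
  change (globalNorms (c : K)).relIndex (sUnits S) ∣ k at hdvd
  exact ⟨fun h0 => hk0 (Nat.eq_zero_of_zero_dvd (h0 ▸ hdvd)),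
    (Nat.mul_le_mul_left 2 (Nat.le_of_dvd (Nat.pos_of_ne_zero hk0) hdvd)).trans hk2⟩

end

section

/-- If `x i ∈ U` lies outside `M i` and in all the other `M j`, then the subset products of the
`x i` are distinct modulo `N ≤ ⨅ i, M i`. -/
theorem Subgroup.two_pow_card_le_relIndex {G ι : Type*} [CommGroup G] {T : Finset ι}
    {N U : Subgroup G} {M : ι → Subgroup G} (hN : ∀ i ∈ T, N ≤ M i) (hU : N.relIndex U ≠ 0)
    (x : ι → G) (hx : ∀ i ∈ T, x i ∈ U) (h1 : ∀ i ∈ T, x i ∉ M i)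
    (h2 : ∀ i ∈ T, ∀ j ∈ T, j ≠ i → x i ∈ M j) : 2 ^ T.card ≤ N.relIndex U := by
  classical
  have hfin : (N.subgroupOf U).FiniteIndex := ⟨hU⟩
  let f : T.powerset → U ⧸ N.subgroupOf U := fun A => QuotientGroup.mk
    ⟨∏ i ∈ A.1, x i, U.prod_mem fun i hi => hx i (Finset.mem_powerset.1 A.2 hi)⟩
  have key : ∀ A B : T.powerset, f A = f B → A.1 ⊆ B.1 := by
    intro A B hAB i hi
    by_contra hiB
    have hiT := Finset.mem_powerset.1 A.2 hi
    rw [QuotientGroup.eq, Subgroup.mem_subgroupOf] at hAB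
    have h3 : (∏ j ∈ A.1, x j)⁻¹ * ∏ j ∈ B.1, x j ∈ M i := hN i hiT hAB
    have hB : ∏ j ∈ B.1, x j ∈ M i := (M i).prod_mem fun j hj =>
      h2 j (Finset.mem_powerset.1 B.2 hj) i hiT fun h => hiB (h ▸ hj)
    have hA : ∏ j ∈ A.1.erase i, x j ∈ M i := (M i).prod_mem fun j hj =>
      h2 j (Finset.mem_powerset.1 A.2 (Finset.mem_of_mem_erase hj)) i hiT
        (Finset.ne_of_mem_erase hj).symm
    rw [(M i).mul_mem_cancel_right hB, inv_mem_iff, ← Finset.mul_prod_erase _ _ hi,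
      (M i).mul_mem_cancel_right hA] at h3
    exact h1 i hiT h3
  have hf : Function.Injective f := fun A B h =>
    Subtype.ext ((key A B h).antisymm (key B A h.symm))
  have := Nat.card_le_card_of_injective f hf
  rwa [Nat.card_eq_fintype_card, Fintype.card_coe, Finset.card_powerset] at this

variable {K : Type*} [Field K] [NumberField K]

/-- Approximation by an integer at finitely many places. -/
theorem exists_integer_approx (T : Finset (HeightOneSpectrum (𝓞 K)))
    (z : HeightOneSpectrum (𝓞 K) → K) (hz : ∀ v ∈ T, v.valuation K (z v) ≤ 1)
    (γ : HeightOneSpectrum (𝓞 K) → ℤᵐ⁰) (hγ : ∀ v ∈ T, γ v ≠ 0) :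
    ∃ r : 𝓞 K, ∀ v ∈ T, v.valuation K (algebraMap (𝓞 K) K r - z v) < γ v := by
  have h1 : ∀ v : T, ∃ r : 𝓞 K, v.1.valuation K (algebraMap (𝓞 K) K r - z v) < γ v :=
    fun v => exists_integer_valuation_sub_lt v.1 (hz v v.2) (hγ v v.2)
  choose r hr using h1
  have h2 : ∀ v : HeightOneSpectrum (𝓞 K), ∃ n : ℕ, v ∈ T → exp (-(n : ℤ)) < γ v := by
    intro v
    refine ⟨(1 - log (γ v)).toNat, fun hv => ?_⟩
    rw [← exp_log (hγ v hv), exp_lt_exp, log_exp]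
    have := Int.self_le_toNat (1 - log (γ v))
    omega
  choose n hn using h2
  obtain ⟨y, hy⟩ := exists_forall_sub_mem_ideal (s := T)
    (fun v : HeightOneSpectrum (𝓞 K) => v.asIdeal) n (fun v _ => v.prime)
    (fun v _ v' _ h h' => h (HeightOneSpectrum.ext h')) r
  refine ⟨y, fun v hv => ?_⟩
  have h3 := ((valuation_le_exp_iff_mem (K := K) v _ _).2 (hy v hv)).trans_lt (hn v hv)
  rw [map_sub] at h3
  rw [← sub_add_sub_cancel _ (algebraMap (𝓞 K) K (r ⟨v, hv⟩))]
  exact Valuation.map_add_lt _ h3 (hr ⟨v, hv⟩)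

/-- Simultaneous approximation of local square classes. -/
theorem exists_mul_inv_mem_localSquares (T : Finset (HeightOneSpectrum (𝓞 K)))
    (z : HeightOneSpectrum (𝓞 K) → Kˣ) :
    ∃ x : Kˣ, ∀ v ∈ T, x * (z v)⁻¹ ∈ localSquares (v.valuation K) := by
  rcases T.eq_empty_or_nonempty with rfl | ⟨v₀, hv₀⟩
  · exact ⟨1, by simp⟩
  have h1 : ∀ v : HeightOneSpectrum (𝓞 K), ∃ m : Kˣ, v.valuation K (z v * m * m : K) ≤ 1 := by
    intro v
    obtain ⟨a, b, hb, hab⟩ := IsFractionRing.div_surjective (A := 𝓞 K) (z v : K)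
    have hb0 : algebraMap (𝓞 K) K b ≠ 0 := by
      simpa using nonZeroDivisors.ne_zero hb
    refine ⟨Units.mk0 _ hb0, ?_⟩
    rw [Units.val_mk0, ← hab, div_mul_cancel₀ _ hb0, ← map_mul]
    exact v.valuation_le_one _
  choose m hm using h1
  obtain ⟨r, hr⟩ := exists_integer_approx T (fun v => (z v * m v * m v : Kˣ))
    (fun v _ => by simpa using hm v)
    (fun v => v.valuation K 4 * v.valuation K ((z v * m v * m v : Kˣ) : K)) (fun v _ => by simp)
  have hr0 : algebraMap (𝓞 K) K r ≠ 0 := by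
    intro h0
    have := hr v₀ hv₀
    rw [h0, zero_sub, Valuation.map_neg] at this
    refine this.not_ge (mul_le_of_le_one_left' ?_)
    exact Valuation.map_four_le_one _
  refine ⟨Units.mk0 _ hr0, fun v hv => ?_⟩
  have := mul_inv_mem_localSquares (x := Units.mk0 _ hr0) (y := z v * m v * m v)
    (v.valuation K) (hr v hv)
  have h2 := mul_mem this (mul_self_mem_localSquares (w := v.valuation K) (m v))
  have h3 : Units.mk0 _ hr0 * (z v * m v * m v)⁻¹ * (m v * m v) = Units.mk0 _ hr0 * (z v)⁻¹ := by
    rw [mul_assoc (z v), mul_inv, mul_assoc, mul_assoc, inv_mul_cancel, mul_one]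
  rwa [h3] at h2

variable [IsTotallyComplex K]

theorem false_of_dual_localNorms {c : Kˣ} (hc : ¬ IsSquare (c : K))
    {S : Finset (HeightOneSpectrum (𝓞 K))} (hS : IsGoodSet S) (hcS : c ∈ sUnits S)
    (x : HeightOneSpectrum (𝓞 K) → Kˣ)
    (hx : ∀ v ∈ S, c ∉ localSquares (v.valuation K) → x v ∈ sUnits S)
    (h1 : ∀ v ∈ S, c ∉ localSquares (v.valuation K) → x v ∉ localNorms (v.valuation K) (c : K))
    (h2 : ∀ v ∈ S, c ∉ localSquares (v.valuation K) → ∀ v' ∈ S,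
      c ∉ localSquares (v'.valuation K) → v' ≠ v → x v ∈ localNorms (v'.valuation K) (c : K)) :
    False := by
  classical
  obtain ⟨h3, h4⟩ := two_mul_relIndex_globalNorms_le hc hS hcS
  have h5 := Subgroup.two_pow_card_le_relIndex
    (T := S.filter fun v => c ∉ localSquares (v.valuation K))
    (M := fun v => localNorms (v.valuation K) (c : K))
    (fun v _ => globalNorms_le_localNorms _ _) h3 x
    (fun v hv => hx v (Finset.mem_filter.1 hv).1 (Finset.mem_filter.1 hv).2)
    (fun v hv => h1 v (Finset.mem_filter.1 hv).1 (Finset.mem_filter.1 hv).2)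
    (fun v hv v' hv' => h2 v (Finset.mem_filter.1 hv).1 (Finset.mem_filter.1 hv).2 v'
      (Finset.mem_filter.1 hv').1 (Finset.mem_filter.1 hv').2)
  omega

theorem infinite_not_mem_localSquares {c : Kˣ} (hc : ¬ IsSquare (c : K)) :
    {v : HeightOneSpectrum (𝓞 K) | c ∉ localSquares (v.valuation K)}.Infinite := by
  classical
  intro hfin
  have h1 : ∀ v : HeightOneSpectrum (𝓞 K), ∃ y : Kˣ, c ∉ localSquares (v.valuation K) →
      y ∉ localNorms (v.valuation K) (c : K) := by
    intro v
    by_cases hv : c ∈ localSquares (v.valuation K)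
    · exact ⟨1, fun h => absurd hv h⟩
    · obtain ⟨y, hy⟩ := exists_not_mem_localNorms (v.valuation_surjective K) hv
      exact ⟨y, fun _ => hy⟩
  choose y hy using h1
  have h2 := fun v : HeightOneSpectrum (𝓞 K) =>
    exists_mul_inv_mem_localSquares hfin.toFinset (Function.update 1 v (y v))
  choose x hx using h2
  choose A hA using exists_mem_sUnits (K := K)
  obtain ⟨S, hS, hT⟩ := exists_isGoodSet_superset
    (hfin.toFinset ∪ A c ∪ hfin.toFinset.biUnion fun v => A (x v))
  refine false_of_dual_localNorms hc hS (sUnits_mono (fun v hv => hT (by simp [hv])) (hA c)) x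
    (fun v _ hcv => sUnits_mono (fun v' hv' => hT ?_) (hA (x v))) (fun v _ hcv hm => ?_)
    (fun v _ hcv v' _ hcv' hne => ?_)
  · refine Finset.mem_union_right _ (Finset.mem_biUnion.2 ⟨v, by simpa using hcv, hv'⟩)
  · have h3 := hx v v (by simpa using hcv)
    rw [Function.update_self] at h3
    refine hy v hcv ?_
    have h4 := localSquares_le_localNorms (c : K) h3
    rwa [(localNorms _ _).mul_mem_cancel_left hm, inv_mem_iff] at h4
  · have h3 := hx v v' (by simpa using hcv')
    rw [Function.update_of_ne hne, Pi.one_apply, inv_one, mul_one] at h3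
    exact localSquares_le_localNorms (c : K) h3

end

theorem Subgroup.index_le_two_of_mul_mem {G : Type*} [CommGroup G] (H : Subgroup G)
    (h : ∀ x y, x ∉ H → y ∉ H → x * y ∈ H) : H.index ≠ 0 ∧ H.index ≤ 2 := by
  by_cases hT : ∃ a, a ∉ H
  · obtain ⟨a, ha⟩ := hT
    have : H.index = 2 := Subgroup.index_eq_two_iff.2 ⟨a, fun b => by
      by_cases hb : b ∈ H
      · exact Or.inr ⟨hb, fun h' => ha ((H.mul_mem_cancel_left hb).1 h')⟩
      · exact Or.inl ⟨h b a hb ha, hb⟩⟩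
    omega
  · push Not at hT
    rw [(Subgroup.eq_top_iff' H).2 hT, Subgroup.index_top]
    simp

section

variable {K : Type u} [Field K] [NumberField K]

theorem mem_localSquares_algebraMap {L : Type*} [Field L] [NumberField L] [Algebra K L]
    (w : HeightOneSpectrum (𝓞 L)) {x : Kˣ} (hx : x ∈ localSquares ((primeBelow K w).valuation K))
    {y : Lˣ} (hy : (y : L) = algebraMap K L x) : y ∈ localSquares (w.valuation L) := by
  obtain ⟨ε, z, h1, h2⟩ := hx
  refine ⟨algebraMap K L ε, algebraMap K L z, (valuation_algebraMap_lt_one_iff w ε).2 h1, ?_⟩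
  rw [hy, ← map_pow, ← h2, map_mul, map_add, map_mul, map_one, map_ofNat]

theorem mem_range_sq_of_eq {S : Finset (HeightOneSpectrum (𝓞 K))} {x : sUnits S} {k : K}
    (h : ((x : Kˣ) : K) = k * k) : x ∈ (powMonoidHom 2 : sUnits S →* sUnits S).range := by
  have hk : k ≠ 0 := by
    rintro rfl
    rw [zero_mul] at h
    exact (x : Kˣ).ne_zero h
  refine ⟨⟨Units.mk0 k hk, mem_sUnits.2 fun v hv => ?_⟩, Subtype.ext (Units.ext ?_)⟩
  · have := mem_sUnits.1 x.2 v hv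
    rw [h, ← pow_two, map_pow] at this
    exact (pow_eq_one_iff_left two_ne_zero).1 this
  · change k ^ 2 = _
    rw [h, pow_two]

/-- An `S`-unit which is a local square at all places of a small set, independent of `b`. -/
theorem exists_sUnit_of_card_lt {S W : Finset (HeightOneSpectrum (𝓞 K))} (hS : IsGoodSet S)
    (hW : Disjoint W S) {b : Kˣ}
    (hcard : W.card + 1 < Fintype.card (InfinitePlace K) + S.card) :
    ∃ c ∈ sUnits S, (∀ w ∈ W, c ∈ localSquares (w.valuation K)) ∧ ¬ IsSquare (c : K) ∧
      ¬ IsSquare (c * b : K) := by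
  classical
  let f : W → Subgroup (sUnits S) := fun w => (localSquares (w.1.valuation K)).subgroupOf (sUnits S)
  have hf : ∀ w, (f w).index ≠ 0 ∧ (f w).index ≤ 2 := fun w =>
    Subgroup.index_le_two_of_mul_mem _ fun x y hx hy => by
      have hw := Finset.disjoint_left.1 hW w.2
      exact mul_mem_localSquares_of_odd (hS _ hw).1 (mem_sUnits.1 x.2 _ hw) (mem_sUnits.1 y.2 _ hw)
        hx hy
  have h1 : (⨅ w, f w).index ≤ 2 ^ W.card := by
    refine (Subgroup.index_iInf_le f).trans ?_
    refine (Finset.prod_le_prod' fun w _ => (hf w).2).trans ?_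
    simp
  set Q := (powMonoidHom 2 : sUnits S →* sUnits S).range with hQ
  have hQf : Q ≤ ⨅ w, f w := by
    refine le_iInf fun w => ?_
    rintro _ ⟨y, rfl⟩
    exact sq_mem_localSquares (w := w.1.valuation K) (y : Kˣ)
  have h2 := Subgroup.relIndex_mul_index hQf
  rw [hQ, index_sUnits_sq, ← hQ] at h2
  by_contra! hcon
  have h3 := Subgroup.index_le_two_of_mul_mem (Q.subgroupOf (⨅ w, f w)) (by
    rintro ⟨x, hx⟩ ⟨y, hy⟩ hxQ hyQ
    rw [Subgroup.mem_subgroupOf] at hxQ hyQ ⊢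
    have key : ∀ z : sUnits S, z ∈ ⨅ w, f w → z ∉ Q → IsSquare (((z : Kˣ) : K) * b) := by
      intro z hz hzQ
      refine hcon z z.2 (fun w hw => ?_) ?_
      · exact (Subgroup.mem_iInf.1 hz) ⟨w, hw⟩
      · rintro ⟨k, hk⟩
        exact hzQ (mem_range_sq_of_eq hk)
    obtain ⟨k, hk⟩ := key x hx hxQ
    obtain ⟨l, hl⟩ := key y hy hyQ
    refine mem_range_sq_of_eq (k := k * l / b) ?_
    have hb := b.ne_zero
    change ((x : Kˣ) : K) * ((y : Kˣ) : K) = _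
    field_simp
    linear_combination ((y : Kˣ) : K) * b * hk + k * k * hl)
  change Q.relIndex _ ≠ 0 ∧ Q.relIndex _ ≤ 2 at h3
  have h4 : 2 ^ (Fintype.card (InfinitePlace K) + S.card) ≤ 2 ^ (W.card + 1) := by
    rw [← h2, pow_succ, mul_comm]
    exact Nat.mul_le_mul h1 h3.2
  have := (Nat.pow_le_pow_iff_right one_lt_two).1 h4
  omega

variable [IsTotallyComplex K]

/-- If `c` and `c * b` are nonsquares, `b` splits at infinitely many places where `c` does not. -/
theorem exists_mem_not_mem_localSquares {b c : Kˣ} (hb : ¬ IsSquare (b : K))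
    (hc : ¬ IsSquare (c : K)) (hcb : ¬ IsSquare (c * b : K))
    {S : Finset (HeightOneSpectrum (𝓞 K))} (hS : IsGoodSet S) (hbS : b ∈ sUnits S)
    (hcS : c ∈ sUnits S) (W : Finset (HeightOneSpectrum (𝓞 K))) :
    ∃ w ∉ W, w ∉ S ∧ b ∈ localSquares (w.valuation K) ∧ c ∉ localSquares (w.valuation K) := by
  classical
  obtain ⟨L, _, _, _, σ, r, h⟩ := exists_isQuadraticConj hb
  have := h.isTotallyComplex
  have hc0 : algebraMap K L c ≠ 0 := by simp
  have hcL : ¬ IsSquare (((Units.mk0 _ hc0 : Lˣ)) : L) := by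
    rintro ⟨x, hx⟩
    obtain ⟨p, q, rfl⟩ := h.span x
    have hx' := congrArg σ hx
    simp only [Units.val_mk0, map_mul, map_add, AlgEquiv.commutes, h.conj] at hx hx'
    have h1 : algebraMap K L (p * q) = 0 := by
      have : (4 * r) * algebraMap K L (p * q) = 0 := by
        rw [map_mul]; linear_combination hx' - hx
      refine (mul_eq_zero.1 this).resolve_left (mul_ne_zero (by norm_num) h.ne_zero)
    have h2 : algebraMap K L c = algebraMap K L (p * p + b * (q * q)) := by
      rw [map_add, map_mul, map_mul, map_mul, ← h.sq]
      rw [map_mul] at h1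
      linear_combination hx + 2 * r * h1
    have h3 := (algebraMap K L).injective h2
    rcases mul_eq_zero.1 ((map_eq_zero _).1 h1) with rfl | rfl
    · exact hcb ⟨b * q, by rw [h3]; ring⟩
    · exact hc ⟨p, by rw [h3]; ring⟩
  have hfin : (⋃ v ∈ W ∪ S, {w : HeightOneSpectrum (𝓞 L) | primeBelow K w = v}).Finite :=
    Set.Finite.biUnion (Finset.finite_toSet _) fun v _ => finite_primeBelow_fiber v
  obtain ⟨w, hw, hw'⟩ := ((infinite_not_mem_localSquares hcL).sdiff hfin).nonempty
  have hwS : primeBelow K w ∉ W ∪ S := fun h' => hw' (by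
    simp only [Set.mem_iUnion]
    exact ⟨_, h', rfl⟩)
  rw [Finset.notMem_union] at hwS
  have hcw : c ∉ localSquares ((primeBelow K w).valuation K) := fun h' =>
    hw (mem_localSquares_algebraMap w h' rfl)
  refine ⟨primeBelow K w, hwS.1, hwS.2, ?_, hcw⟩
  by_contra hbw
  have hcbw := mul_mem_localSquares_of_odd (hS _ hwS.2).1 (mem_sUnits.1 hcS _ hwS.2)
    (mem_sUnits.1 hbS _ hwS.2) hcw hbw
  have h1 := mem_localSquares_algebraMap w (y := Units.mk0 _ hc0 * (Units.mk0 r h.ne_zero) ^ 2)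
    hcbw (by simp [h.sq])
  rw [(localSquares _).mul_mem_cancel_right (sq_mem_localSquares _)] at h1
  exact hw h1

/-- The auxiliary set of places in the norm index computation. -/
theorem exists_split_places {b : Kˣ} (hb : ¬ IsSquare (b : K))
    {S : Finset (HeightOneSpectrum (𝓞 K))} (hS : IsGoodSet S) (hbS : b ∈ sUnits S) (n : ℕ)
    (hn : n + 1 ≤ Fintype.card (InfinitePlace K) + S.card) :
    ∃ (W : Finset (HeightOneSpectrum (𝓞 K))) (u : HeightOneSpectrum (𝓞 K) → Kˣ),
      Disjoint W S ∧ W.card = n ∧ (∀ w ∈ W, b ∈ localSquares (w.valuation K)) ∧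
      ∀ w ∈ W, u w ∈ sUnits S ∧ u w ∉ localSquares (w.valuation K) ∧
        ∀ w' ∈ W, w' ≠ w → u w ∈ localSquares (w'.valuation K) := by
  classical
  induction n with
  | zero => exact ⟨∅, 1, by simp⟩
  | succ n ih =>
    obtain ⟨W, u, h1, h2, h3, h4⟩ := ih (by omega)
    obtain ⟨c, hcS, hcW, hc, hcb⟩ := exists_sUnit_of_card_lt (b := b) hS h1 (by omega)
    obtain ⟨w, hwW, hwS, hbw, hcw⟩ := exists_mem_not_mem_localSquares hb hc hcb hS hbS hcS W
    have key : ∀ w' ∈ W, ∃ x ∈ sUnits S, x ∉ localSquares (w'.valuation K) ∧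
        x ∈ localSquares (w.valuation K) ∧
        ∀ w'' ∈ W, w'' ≠ w' → x ∈ localSquares (w''.valuation K) := by
      intro w' hw'
      obtain ⟨h5, h6, h7⟩ := h4 w' hw'
      by_cases hu : u w' ∈ localSquares (w.valuation K)
      · exact ⟨u w', h5, h6, hu, h7⟩
      · refine ⟨u w' * c, mul_mem h5 hcS, ?_, ?_, fun w'' hw'' hne =>
          mul_mem (h7 w'' hw'' hne) (hcW w'' hw'')⟩
        · rwa [(localSquares _).mul_mem_cancel_right (hcW w' hw')]
        · exact mul_mem_localSquares_of_odd (hS _ hwS).1 (mem_sUnits.1 h5 _ hwS)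
            (mem_sUnits.1 hcS _ hwS) hu hcw
    choose! x hx1 hx2 hx3 hx4 using key
    refine ⟨insert w W, Function.update x w c, ?_, ?_, ?_, ?_⟩
    · rw [Finset.disjoint_insert_left]; exact ⟨hwS, h1⟩
    · rw [Finset.card_insert_of_notMem hwW, h2]
    · rw [Finset.forall_mem_insert]; exact ⟨hbw, h3⟩
    · rw [Finset.forall_mem_insert]
      refine ⟨?_, fun w' hw' => ?_⟩
      · rw [Function.update_self, Finset.forall_mem_insert]
        exact ⟨hcS, hcw, fun h => absurd rfl h, fun w' hw' _ => hcW w' hw'⟩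
      · have hne : w' ≠ w := fun h => hwW (h ▸ hw')
        rw [Function.update_of_ne hne, Finset.forall_mem_insert]
        exact ⟨hx1 w' hw', hx2 w' hw', fun _ => hx3 w' hw', hx4 w' hw'⟩

end

section

variable {K : Type u} [Field K] [NumberField K] [IsTotallyComplex K]

/-- An `S ∪ W`-unit that is a local square at `S` is a square. -/
theorem isSquare_of_forall_mem_localSquares {S W : Finset (HeightOneSpectrum (𝓞 K))}
    [DecidableEq (HeightOneSpectrum (𝓞 K))]
    (hS : IsGoodSet S) (hW : Disjoint W S) {u : HeightOneSpectrum (𝓞 K) → Kˣ}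
    (hu : ∀ w ∈ W, u w ∈ sUnits S ∧ u w ∉ localSquares (w.valuation K) ∧
        ∀ w' ∈ W, w' ≠ w → u w ∈ localSquares (w'.valuation K)) {x : Kˣ}
    (hx : x ∈ sUnits (S ∪ W)) (hxS : ∀ v ∈ S, x ∈ localSquares (v.valuation K)) :
    IsSquare (x : K) := by
  classical
  by_contra hsq
  have hle : sUnits (K := K) S ≤ sUnits (S ∪ W) := sUnits_mono Finset.subset_union_left
  have key : ∀ w ∈ W, ∃ z ∈ sUnits (S ∪ W), (x ∉ localSquares (w.valuation K) →
      z ∉ localNorms (w.valuation K) (x : K)) ∧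
        ∀ w' ∈ W, w' ≠ w → z ∈ localSquares (w'.valuation K) := by
    intro w hw
    have hwS := Finset.disjoint_left.1 hW hw
    obtain ⟨h1, h2, h3⟩ := hu w hw
    by_cases hsw : IsSquare (w.valuation K (x : K))
    · obtain ⟨hw2, π, hπ, hπ'⟩ := hS w hwS
      have hmem : ∀ w' ∈ W, u w' ∈ sUnits S := fun w' hw' => (hu w' hw').1
      set A := (W.erase w).filter fun w' => π ∉ localSquares (w'.valuation K) with hA
      have hAW : ∀ w' ∈ A, w' ∈ W := fun w' h =>
        Finset.mem_of_mem_erase (Finset.mem_filter.1 h).1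
      have hprod : ∏ w' ∈ A, u w' ∈ sUnits S := (sUnits S).prod_mem fun w' h =>
        hmem w' (hAW w' h)
      refine ⟨π * ∏ w' ∈ A, u w', mul_mem ?_ (hle hprod), fun hxw hz => ?_, fun w' hw' hne => ?_⟩
      · rw [mem_sUnits]
        intro v hv
        rw [Finset.notMem_union] at hv
        exact hπ' v hv.1 fun h => hv.2 (h ▸ hw)
      · have h5 := isSquare_map_of_mem_localNorms hw2 hsw hxw hz
        rw [Units.val_mul, map_mul, mem_sUnits.1 hprod w hwS, hπ, mul_one] at h5
        exact not_isSquare_exp_neg_one h5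
      · have hw'S := Finset.disjoint_left.1 hW hw'
        by_cases hπw : π ∈ localSquares (w'.valuation K)
        · refine mul_mem hπw (Subgroup.prod_mem _ fun w'' hw'' => ?_)
          refine (hu w'' (hAW w'' hw'')).2.2 w' hw' ?_
          rintro rfl
          exact (Finset.mem_filter.1 hw'').2 hπw
        · have hA' : w' ∈ A := Finset.mem_filter.2 ⟨Finset.mem_erase.2 ⟨hne, hw'⟩, hπw⟩
          rw [← Finset.mul_prod_erase _ _ hA', ← mul_assoc]
          refine mul_mem (mul_mem_localSquares_of_odd (hS _ hw'S).1 (hπ' _ hw'S hne)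
            (mem_sUnits.1 (hmem w' hw') _ hw'S) hπw (hu w' hw').2.1)
            (Subgroup.prod_mem _ fun w'' hw'' => ?_)
          rw [Finset.mem_erase] at hw''
          exact (hu w'' (hAW w'' hw''.2)).2.2 w' hw' hw''.1.symm
    · exact ⟨u w, hle h1, fun _ => not_mem_localNorms_of_not_isSquare (hS w hwS).1
        (mem_sUnits.1 h1 w hwS) h2 hsw, h3⟩
  choose! z hz1 hz2 hz3 using key
  have hmemW : ∀ v ∈ S ∪ W, x ∉ localSquares (v.valuation K) → v ∈ W := fun v hv hxv =>
    (Finset.mem_union.1 hv).resolve_left fun h => hxv (hxS v h)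
  exact false_of_dual_localNorms hsq (hS.mono Finset.subset_union_left) hx z
    (fun v hv hxv => hz1 v (hmemW v hv hxv)) (fun v hv hxv => hz2 v (hmemW v hv hxv) hxv)
    fun v hv hxv v' hv' hxv' hne => localSquares_le_localNorms _
      (hz3 v (hmemW v hv hxv) v' (hmemW v' hv' hxv') hne)

/-- Index comparison along a diagonal. -/
theorem Subgroup.index_le_mul_relIndex_of_le {G : Type*} [CommGroup G] {Q N Δ : Subgroup G}
    (h : Q ≤ N) {m : ℕ} (hQ : Q.index ≤ m * Q.relIndex Δ) (h0 : Q.index ≠ 0) :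
    N.index ≤ m * N.relIndex Δ := by
  have h1 : Q.relIndex Δ * (Δ ⊔ Q).index = Q.index := by
    rw [← Subgroup.relIndex_sup_right, Subgroup.relIndex_mul_index le_sup_right]
  have h2 : N.relIndex Δ * (Δ ⊔ N).index = N.index := by
    rw [← Subgroup.relIndex_sup_right, Subgroup.relIndex_mul_index le_sup_right]
  have h3 : (Δ ⊔ Q).index ≠ 0 := fun h => h0 (by rw [← h1, h, mul_zero])
  have h4 : Q.relIndex Δ ≠ 0 := fun h => h0 (by rw [← h1, h, zero_mul])
  rw [← h1, mul_comm] at hQ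
  have h5 := Nat.le_of_mul_le_mul_right hQ (Nat.pos_of_ne_zero h4)
  have h6 : (Δ ⊔ N).index ≤ (Δ ⊔ Q).index :=
    Nat.le_of_dvd (Nat.pos_of_ne_zero h3) (Subgroup.index_dvd_of_le (sup_le_sup_left h Δ))
  rw [← h2, mul_comm]
  exact Nat.mul_le_mul_right _ (h6.trans h5)

/-- The Hasse norm theorem for quadratic extensions of totally complex fields. -/
theorem mem_globalNorms_of_forall_mem_localNorms {a b : Kˣ}
    (h : ∀ v : HeightOneSpectrum (𝓞 K), a ∈ localNorms (v.valuation K) (b : K)) :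
    a ∈ globalNorms (b : K) := by
  classical
  by_cases hb : IsSquare (b : K)
  · obtain ⟨k, hk⟩ := hb
    have hk0 : k ≠ 0 := by
      rintro rfl
      rw [zero_mul] at hk
      exact b.ne_zero hk
    refine ⟨(a + 1) / 2, (a - 1) / (2 * k), ?_⟩
    rw [hk]
    field_simp
    ring
  obtain ⟨Sa, hSa⟩ := exists_mem_sUnits a
  obtain ⟨Sb, hSb⟩ := exists_mem_sUnits b
  obtain ⟨S, hS, hsub⟩ := exists_isGoodSet_superset (Sa ∪ Sb)
  have haS := sUnits_mono (Finset.subset_union_left.trans hsub) hSa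
  have hbS := sUnits_mono (Finset.subset_union_right.trans hsub) hSb
  have hr : 0 < Fintype.card (InfinitePlace K) := Fintype.card_pos
  obtain ⟨W, u, hWS, hWcard, hbW, hu⟩ := exists_split_places hb hS hbS
    (Fintype.card (InfinitePlace K) + S.card - 1) (by omega)
  have hle : sUnits (K := K) S ≤ sUnits (S ∪ W) := sUnits_mono Finset.subset_union_left
  let δ : sUnits (K := K) (S ∪ W) →* (S → Kˣ) := MonoidHom.pi fun _ => Subgroup.subtype _
  let Q : Subgroup (S → Kˣ) := Subgroup.pi Set.univ fun v => localSquares (v.1.valuation K)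
  let N : Subgroup (S → Kˣ) := Subgroup.pi Set.univ fun v => localNorms (v.1.valuation K) (b : K)
  have hQN : Q ≤ N := fun x hx v hv => localSquares_le_localNorms _ (hx v hv)
  have hQidx : Q.index = ∏ v ∈ S, (localSquares (v.valuation K)).index := by
    rw [← Finset.prod_coe_sort]
    exact Subgroup.index_pi _
  have hQ0 : Q.index ≠ 0 := by
    rw [hQidx]
    exact Finset.prod_ne_zero_iff.2 fun v _ => (index_localSquares_le v).1
  have hQrel : Q.relIndex δ.range = 2 ^ (Fintype.card (InfinitePlace K) + (S ∪ W).card) := by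
    rw [← Subgroup.index_comap, ← index_sUnits_sq]
    congr 1
    refine le_antisymm (fun x hx => ?_) ?_
    · obtain ⟨k, hk⟩ := isSquare_of_forall_mem_localSquares hS hWS hu x.2
        fun v hv => hx ⟨v, hv⟩ trivial
      exact mem_range_sq_of_eq hk
    · rintro _ ⟨y, rfl⟩
      exact fun v _ => sq_mem_localSquares (w := v.1.valuation K) (y : Kˣ)
  have hNidx : 2 ^ (S.filter fun v => b ∉ localSquares (v.valuation K)).card ≤ N.index := by
    have h1 : N.index = ∏ v ∈ S, (localNorms (v.valuation K) (b : K)).index := by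
      rw [← Finset.prod_coe_sort]
      exact Subgroup.index_pi _
    rw [h1, ← Finset.prod_const, Finset.prod_filter]
    refine Finset.prod_le_prod' fun v _ => ?_
    have h2 : (localNorms (v.valuation K) (b : K)).index ≠ 0 := fun h0 =>
      (index_localSquares_le v).1 (Nat.eq_zero_of_zero_dvd
        (h0 ▸ Subgroup.index_dvd_of_le (localSquares_le_localNorms (b : K))))
    split_ifs with hv
    · exact Nat.pos_of_ne_zero h2
    · have h3 : (localNorms (v.valuation K) (b : K)).index ≠ 1 := fun h3 => by
        obtain ⟨y, hy⟩ := exists_not_mem_localNorms (v.valuation_surjective K) hv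
        rw [Subgroup.index_eq_one] at h3
        exact hy (h3 ▸ Subgroup.mem_top y)
      omega
  have hcomp := Subgroup.index_le_mul_relIndex_of_le (Δ := δ.range) (m := 2) hQN (by
    rw [hQrel, hQidx]
    refine (prod_index_localSquares_le S).trans ?_
    rw [IsTotallyComplex.finrank_eq_two_mul_card, Finset.card_union_of_disjoint hWS.symm, hWcard,
      show (4 : ℕ) = 2 ^ 2 from rfl, ← pow_mul, ← pow_add, ← pow_succ']
    exact Nat.pow_le_pow_right two_pos (by omega)) hQ0
  rw [← Subgroup.index_comap] at hcomp
  obtain ⟨h1, h2⟩ := two_mul_relIndex_globalNorms_le hb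
    (hS.mono (Finset.subset_union_left (s₂ := W))) (hle hbS)
  have hfilter : ((S ∪ W).filter fun v => b ∉ localSquares (v.valuation K)) =
      S.filter fun v => b ∉ localSquares (v.valuation K) := by
    rw [Finset.filter_union, Finset.filter_eq_empty_iff (s := W) |>.2 fun w hw h => h (hbW w hw),
      Finset.union_empty]
  rw [hfilter] at h2
  have hCB : (globalNorms (b : K)).subgroupOf (sUnits (S ∪ W)) ≤ N.comap δ := fun x hx v _ =>
    globalNorms_le_localNorms _ _ hx
  have h3 := Subgroup.relIndex_mul_index hCB
  change _ = (globalNorms (b : K)).relIndex (sUnits (S ∪ W)) at h3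
  have h4 : ((globalNorms (b : K)).subgroupOf (sUnits (S ∪ W))).relIndex (N.comap δ) ≤ 1 := by
    by_contra! h5
    have h6 : (N.comap δ).index ≠ 0 := fun h0 => h1 (by rw [← h3, h0, mul_zero])
    have h7 := Nat.mul_le_mul_right (N.comap δ).index (Nat.succ_le_of_lt h5)
    rw [h3] at h7
    omega
  have h5 : ((globalNorms (b : K)).subgroupOf (sUnits (S ∪ W))).relIndex (N.comap δ) = 1 := by
    refine le_antisymm h4 (Nat.pos_of_ne_zero fun h0 => h1 ?_)
    rw [← h3, h0, zero_mul]
  rw [Subgroup.relIndex_eq_one] at h5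
  exact h5 (x := ⟨a, hle haS⟩) fun v _ => h v

end

section

variable {K : Type*} [Field K] {w : Valuation K ℤᵐ⁰}

theorem exists_one_add_four_mul_eq_of_pow {ε : K} (hε : w ε < 1) (n : ℕ) :
    ∃ ε' k : K, w ε' ≤ w ε ^ (n + 1) ∧ 1 + 4 * ε = k ^ 2 * (1 + 4 * ε') := by
  induction n with
  | zero => exact ⟨ε, 1, by simp, by simp⟩
  | succ n ih =>
    obtain ⟨ε', k, h1, h2⟩ := ih
    have h3 : w ε' < 1 := h1.trans_lt (pow_lt_one₀ zero_le hε (Nat.succ_ne_zero n))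
    have h4 : w (1 + 2 * ε') = 1 := by
      have : w (2 * ε') < 1 := by
        rw [map_mul]
        exact (mul_le_of_le_one_left' w.map_two_le_one).trans_lt h3
      rw [w.map_add_eq_of_lt_left (by simpa using this), map_one]
    have h5 : 1 + 2 * ε' ≠ 0 := fun h => by rw [h, map_zero] at h4; exact zero_ne_one h4
    refine ⟨-(ε' ^ 2 / (1 + 2 * ε') ^ 2), k * (1 + 2 * ε'), ?_, ?_⟩
    · rw [Valuation.map_neg, map_div₀, map_pow, map_pow, h4, one_pow, div_one]
      refine (pow_le_pow_left₀ zero_le h1 2).trans ?_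
      rw [← pow_mul]
      exact pow_le_pow_right_of_le_one' hε.le (by omega)
    · have h6 : ε' ^ 2 / (1 + 2 * ε') ^ 2 * (1 + 2 * ε') ^ 2 = ε' ^ 2 :=
        div_mul_cancel₀ _ (pow_ne_zero 2 h5)
      linear_combination h2 + 4 * k ^ 2 * h6

/-- Square roots of `1 + 4 * ε` can be computed to arbitrary precision. -/
theorem exists_one_add_four_mul_eq {ε : K} (hε : w ε < 1) {γ : ℤᵐ⁰} (hγ : γ ≠ 0) :
    ∃ ε' k : K, w ε' < γ ∧ w ε' < 1 ∧ 1 + 4 * ε = k ^ 2 * (1 + 4 * ε') := by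
  obtain ⟨n, hn⟩ := exists_pow_lt₀ hε (Units.mk0 γ hγ)
  obtain ⟨ε', k, h1, h2⟩ := exists_one_add_four_mul_eq_of_pow hε n
  refine ⟨ε', k, h1.trans_lt (lt_of_le_of_lt (pow_le_pow_right_of_le_one' hε.le (by omega)) hn),
    h1.trans_lt (pow_lt_one₀ zero_le hε (Nat.succ_ne_zero n)), h2⟩

variable [CharZero K]

theorem mem_localNorms_of_mem_localSquares {b : Kˣ} (hb : b ∈ localSquares w) (x : Kˣ) :
    x ∈ localNorms w (b : K) := by
  by_cases hx : (x : K) = 1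
  · rw [show x = 1 from Units.ext hx]
    exact one_mem _
  obtain ⟨ε, k, hε, h1⟩ := hb
  have hx1 : w ((x : K) - 1) ≠ 0 := (Valuation.ne_zero_iff _).2 (sub_ne_zero.2 hx)
  obtain ⟨ε', l, h2, h3, h4⟩ := exists_one_add_four_mul_eq hε
    (γ := w 4 * w (x : K) * (w ((x : K) - 1) ^ 2)⁻¹)
    (mul_ne_zero (mul_ne_zero (by simp) (by simp)) (inv_ne_zero (pow_ne_zero _ hx1)))
  have h5 := map_one_add_four_mul (w := w) hε
  have h6 := map_one_add_four_mul (w := w) h3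
  have h5' : 1 + 4 * ε ≠ 0 := fun h => by rw [h, map_zero] at h5; exact zero_ne_one h5
  have h6' : 1 + 4 * ε' ≠ 0 := fun h => by rw [h, map_zero] at h6; exact zero_ne_one h6
  have hl : l ≠ 0 := by
    rintro rfl
    rw [h4] at h5'
    simp at h5'
  have hk : k ≠ 0 := by
    rintro rfl
    rw [zero_pow two_ne_zero] at h1
    exact mul_ne_zero b.ne_zero h5' h1
  have hb : (b : K) = k ^ 2 / (l ^ 2 * (1 + 4 * ε')) := by
    rw [eq_div_iff (mul_ne_zero (pow_ne_zero _ hl) h6'), ← h4, h1]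
  refine mem_localNorms_of_lt (y := (x + 1) / 2) (z := (x - 1) / (2 * (k / l))) ?_
  have h7 : (((x : K) + 1) / 2) ^ 2 - b * ((x - 1) / (2 * (k / l))) ^ 2 - x =
      (x - 1) ^ 2 * ε' / (1 + 4 * ε') := by
    rw [hb]
    field_simp
    ring
  rw [h7, map_div₀, h6, div_one, map_mul, map_pow, mul_comm]
  exact (lt_mul_inv_iff₀ (zero_lt_iff.2 (pow_ne_zero _ hx1))).1 h2

/-- If a ternary form `⟨a, b, -ab⟩` represents a local square then `a` is a local norm. -/
theorem mem_localNorms_of_ternary {a b : Kˣ} {x₁ x₂ x₃ r : K} (hr : r ≠ 0)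
    (h : w (a * x₁ ^ 2 + b * x₂ ^ 2 - a * b * x₃ ^ 2 - r ^ 2) < w 4 * w (r ^ 2)) :
    a ∈ localNorms w (b : K) := by
  by_cases hb : b ∈ localSquares w
  · exact mem_localNorms_of_mem_localSquares hb a
  have h4 : (4 : K) ≠ 0 := by norm_num
  have hw4 : w (4 : K) ≠ 0 := by simp
  set q := a * x₁ ^ 2 + b * x₂ ^ 2 - a * b * x₃ ^ 2 with hq
  obtain ⟨ε, k, h1, h2, h3⟩ := exists_one_add_four_mul_eq (w := w) (ε := (q - r ^ 2) / (4 * r ^ 2))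
    (γ := w 4) (by
      rw [map_div₀, map_mul]
      exact (div_lt_one₀ (zero_le.trans_lt h)).2 h) hw4
  have hε := map_one_add_four_mul (w := w) h2
  have hqt : q = (r * k) ^ 2 * (1 + 4 * ε) := by
    rw [mul_pow, mul_assoc, ← h3]
    field_simp
    ring
  have hq0 : q ≠ 0 := by
    intro h0
    rw [h0, zero_sub, Valuation.map_neg] at h
    exact h.not_ge (mul_le_of_le_one_left' w.map_four_le_one)
  set t := r * k with ht
  have ht0 : t ≠ 0 := by
    intro h0
    rw [hqt, h0] at hq0
    simp at hq0
  have hM : w 4 * w (t ^ 2) ≤ w (t ^ 2 - b * x₂ ^ 2) := by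
    by_contra! hlt
    have hlt' : w (t ^ 2 - b * x₂ ^ 2) < w (t ^ 2) :=
      hlt.trans_le (mul_le_of_le_one_left' w.map_four_le_one)
    have heq : w (b * x₂ ^ 2) = w (t ^ 2) := by
      rw [← w.map_sub_eq_of_lt_left hlt']
      congr 1; ring
    have hx₂ : x₂ ≠ 0 := by
      rintro rfl
      rw [zero_pow two_ne_zero, mul_zero, map_zero] at heq
      exact (Valuation.ne_zero_iff _).2 (pow_ne_zero 2 ht0) heq.symm
    have h5 := mem_localSquares_of_lt (w := w) (x := b * (Units.mk0 x₂ hx₂) ^ 2) (y := t) (by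
      rw [Units.val_mul, Units.val_pow_eq_pow_val, Units.val_mk0, heq]
      exact hlt)
    rw [(localSquares w).mul_mem_cancel_right (sq_mem_localSquares _)] at h5
    exact hb h5
  have hN : q - b * x₂ ^ 2 = (t ^ 2 - b * x₂ ^ 2) + 4 * ε * t ^ 2 := by rw [hqt]; ring
  have hlt : w (4 * ε * t ^ 2) < w 4 * w (t ^ 2 - b * x₂ ^ 2) := by
    rw [mul_assoc, map_mul]
    refine lt_of_lt_of_le ?_ (mul_le_mul_right hM _)
    rw [map_mul]
    have h5 : 0 < w (t ^ 2) := zero_lt_iff.2 ((Valuation.ne_zero_iff _).2 (pow_ne_zero 2 ht0))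
    exact (mul_lt_mul_iff_right₀ (zero_lt_iff.2 hw4)).2 ((mul_lt_mul_iff_left₀ h5).2 h1)
  have hNval : w (q - b * x₂ ^ 2) = w (t ^ 2 - b * x₂ ^ 2) := by
    rw [hN]
    exact w.map_add_eq_of_lt_left (hlt.trans_le (mul_le_of_le_one_left' w.map_four_le_one))
  have hN0 : q - b * x₂ ^ 2 ≠ 0 := by
    intro h0
    rw [h0, map_zero] at hNval
    rw [← hNval, mul_zero] at hlt
    exact not_lt_zero hlt
  have hfac : q - b * x₂ ^ 2 = a * (x₁ ^ 2 - b * x₃ ^ 2) := by rw [hq]; ring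
  have hU0 : x₁ ^ 2 - b * x₃ ^ 2 ≠ 0 := by
    intro h0
    rw [hfac, h0, mul_zero] at hN0
    exact hN0 rfl
  have h5 : Units.mk0 _ hN0 ∈ localNorms w (b : K) := by
    refine mem_localNorms_of_lt (y := t) (z := x₂) ?_
    rw [Units.val_mk0, hNval, hN, sub_add_cancel_left, Valuation.map_neg]
    exact hlt
  have h6 : Units.mk0 _ hU0 ∈ localNorms w (b : K) := mem_localNorms_of_eq rfl
  have h7 : Units.mk0 _ hN0 = a * Units.mk0 _ hU0 := Units.ext hfac
  rwa [h7, (localNorms w _).mul_mem_cancel_right h6] at h5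

end

section

open Filter Topology

theorem tendsto_mul_one_sub_div_pow {s : ℝ} {N : ℕ} (hN : |s| < N) :
    (0 < s → Tendsto (fun k : ℕ => s * ((1 - s / N) ^ k) ^ 2) atTop (𝓝 0)) ∧
    (s < 0 → Tendsto (fun k : ℕ => s * ((1 - s / N) ^ k) ^ 2) atTop atBot) := by
  have hN0 : (0 : ℝ) < N := (abs_nonneg s).trans_lt hN
  have h1 : ∀ k : ℕ, ((1 - s / N) ^ k) ^ 2 = ((1 - s / N) ^ 2) ^ k := fun k => by
    rw [← pow_mul, ← pow_mul, mul_comm]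
  simp only [h1]
  have h2 := abs_lt.1 hN
  constructor
  · intro h
    have h3 : s / N < 1 := (div_lt_one hN0).2 h2.2
    have h4 : 0 < s / N := div_pos h hN0
    have := (tendsto_pow_atTop_nhds_zero_of_lt_one (r := (1 - s / N) ^ 2) (by positivity)
      (by nlinarith)).const_mul s
    simpa using this
  · intro h
    have h4 : s / N < 0 := div_neg_of_neg_of_pos h hN0
    exact (tendsto_pow_atTop_atTop_of_one_lt (r := (1 - s / N) ^ 2)
      (by nlinarith)).const_mul_atTop_of_neg h

theorem eventually_ternary_neg {s t : ℝ} {N : ℕ} (hs : s ≠ 0) (ht : t ≠ 0) (hsN : |s| < N)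
    (htN : |t| < N) :
    ∀ᶠ k : ℕ in atTop, s * ((1 - s / N) ^ k) ^ 2 + t * ((1 - t / N) ^ k) ^ 2 - s * t < 0 := by
  obtain ⟨h1, h2⟩ := tendsto_mul_one_sub_div_pow hsN
  obtain ⟨h3, h4⟩ := tendsto_mul_one_sub_div_pow htN
  rcases lt_or_gt_of_ne hs with hs' | hs' <;> rcases lt_or_gt_of_ne ht with ht' | ht'
  · have := ((h2 hs').eventually (eventually_lt_atBot 0)).and
      ((h4 ht').eventually (eventually_lt_atBot 0))
    filter_upwards [this] with k hk
    nlinarith [mul_pos_of_neg_of_neg hs' ht']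
  · have := ((h2 hs').eventually (eventually_lt_atBot (s * t - 1))).and
      ((h3 ht').eventually (eventually_lt_nhds one_pos))
    filter_upwards [this] with k hk
    linarith [hk.1, hk.2]
  · have := ((h4 ht').eventually (eventually_lt_atBot (s * t - 1))).and
      ((h1 hs').eventually (eventually_lt_nhds one_pos))
    filter_upwards [this] with k hk
    linarith [hk.1, hk.2]
  · have hst : 0 < s * t / 2 := by positivity
    have := ((h1 hs').eventually (eventually_lt_nhds hst)).and
      ((h3 ht').eventually (eventually_lt_nhds hst))
    filter_upwards [this] with k hk
    linarith [hk.1, hk.2]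

theorem eventually_quadratic_neg (A B : ℝ) {C : ℝ} (hC : C < 0) :
    ∀ᶠ m : ℕ in atTop, A + B * m + C * m ^ 2 < 0 := by
  have h := tendsto_natCast_atTop_atTop (R := ℝ)
  filter_upwards [h.eventually_ge_atTop ((|A| + |B| + 1) / (-C)), h.eventually_ge_atTop 1]
    with m h1 h2
  rw [div_le_iff₀ (by linarith)] at h1
  nlinarith [le_abs_self A, le_abs_self B, abs_nonneg A, abs_nonneg B]

end

section

variable {K : Type u} [Field K]

theorem Valuation.exists_forall_sub_lt {w : Valuation K ℤᵐ⁰} {β y₀ : Fin 3 → K}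
    (hβ : ∀ i, β i ≠ 0) (hy : ∀ i, w (y₀ i) ≤ 1) {δ : ℤᵐ⁰} (hδ : δ ≠ 0) :
    ∃ γ : ℤᵐ⁰, γ ≠ 0 ∧ ∀ y : Fin 3 → K, (∀ i, w (y i - y₀ i) < γ) →
      w (∑ i, β i * y i ^ 2 - ∑ i, β i * y₀ i ^ 2) < δ := by
  set B := w (β 0) ⊔ w (β 1) ⊔ w (β 2) with hB
  have hβB : ∀ i, w (β i) ≤ B := by
    intro i; fin_cases i <;> simp [hB]
  have hB0 : 0 < B := (zero_lt_iff.2 ((Valuation.ne_zero_iff _).2 (hβ 0))).trans_le (hβB 0)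
  refine ⟨min 1 (δ * B⁻¹), ?_, fun y hyy => ?_⟩
  · rcases min_choice 1 (δ * B⁻¹) with h | h <;> rw [h]
    · exact one_ne_zero
    · exact mul_ne_zero hδ (inv_ne_zero hB0.ne')
  · rw [← Finset.sum_sub_distrib]
    refine Valuation.map_sum_lt _ hδ fun i _ => ?_
    obtain ⟨h1, h2⟩ := lt_min_iff.1 (hyy i)
    rw [show β i * y i ^ 2 - β i * y₀ i ^ 2 = (y i - y₀ i) * β i * (y i - y₀ i + 2 * y₀ i) by ring,
      map_mul, map_mul]
    have h3 : w (y i - y₀ i + 2 * y₀ i) ≤ 1 := by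
      refine w.map_add_le h1.le ?_
      rw [map_mul]
      exact mul_le_one' w.map_two_le_one (hy i)
    refine (mul_le_of_le_one_right' h3).trans_lt ?_
    refine (mul_le_mul_right (hβB i) _).trans_lt ?_
    rwa [lt_mul_inv_iff₀ hB0] at h2

variable [NumberField K]

open Filter in
theorem exists_ternary_neg {c d : K} (hc : c ≠ 0) (hd : d ≠ 0) :
    ∃ z : Fin 3 → K, ∀ φ : K →+* ℝ, φ (∑ i, ![c, d, -(c * d)] i * z i ^ 2) < 0 := by
  obtain ⟨N, hN⟩ : ∃ N : ℕ, ∀ φ : K →+* ℝ, |φ c| < N ∧ |φ d| < N := by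
    have h : ∀ φ : K →+* ℝ, ∀ᶠ N : ℕ in atTop, |φ c| < N ∧ |φ d| < N := fun φ =>
      ((tendsto_natCast_atTop_atTop (R := ℝ)).eventually_gt_atTop _).and
        ((tendsto_natCast_atTop_atTop (R := ℝ)).eventually_gt_atTop _)
    exact (eventually_all.2 h).exists
  obtain ⟨k, hk⟩ := (eventually_all.2 fun φ : K →+* ℝ => eventually_ternary_neg
    ((map_ne_zero φ).2 hc) ((map_ne_zero φ).2 hd) (hN φ).1 (hN φ).2).exists
  refine ⟨![(1 - c / N) ^ k, (1 - d / N) ^ k, 1], fun φ => ?_⟩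
  have := hk φ
  simp [Fin.sum_univ_three]
  linarith

theorem exists_natCast_valuation_lt (v : HeightOneSpectrum (𝓞 K)) {γ : ℤᵐ⁰} (hγ : γ ≠ 0) :
    ∃ M : ℕ, M ≠ 0 ∧ v.valuation K (M : K) < γ := by
  have h0 : Ideal.absNorm v.asIdeal ≠ 0 := by
    rw [Ne, Ideal.absNorm_eq_zero_iff]
    exact v.ne_bot
  have h1 : v.valuation K ((Ideal.absNorm v.asIdeal : ℕ) : K) < 1 := by
    have := (v.valuation_lt_one_iff_mem (K := K) ((Ideal.absNorm v.asIdeal : ℕ) : 𝓞 K)).2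
      (Ideal.absNorm_mem v.asIdeal)
    rw [← map_natCast (algebraMap (𝓞 K) K)]
    exact this
  obtain ⟨n, hn⟩ := exists_pow_lt₀ h1 (Units.mk0 γ hγ)
  exact ⟨Ideal.absNorm v.asIdeal ^ n, pow_ne_zero _ h0, by rwa [Nat.cast_pow, map_pow]⟩

open Filter in
/-- A value of the form `⟨c, d, -cd⟩`, negative at all real places and close to values of another
ternary form at finitely many finite places. -/
theorem exists_common_value_approx (T : Finset (HeightOneSpectrum (𝓞 K))) {α : Fin 3 → K}
    (hα : ∀ i, α i ≠ 0) {c d : K} (hc : c ≠ 0) (hd : d ≠ 0) :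
    ∃ y : Fin 3 → K, (∀ φ : K →+* ℝ, φ (∑ i, ![c, d, -(c * d)] i * y i ^ 2) < 0) ∧
      ∀ v ∈ T, ∃ x : Fin 3 → K,
        v.valuation K (∑ i, α i * x i ^ 2 - ∑ i, ![c, d, -(c * d)] i * y i ^ 2) <
          v.valuation K 4 * v.valuation K (∑ i, ![c, d, -(c * d)] i * y i ^ 2) := by
  classical
  set β := ![c, d, -(c * d)] with hβdef
  have hβ : ∀ i, β i ≠ 0 := by
    intro i; fin_cases i <;> simp [hβdef, hc, hd]
  have hloc : ∀ v : HeightOneSpectrum (𝓞 K), ∃ (x y₀ : Fin 3 → K) (γ : ℤᵐ⁰), γ ≠ 0 ∧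
      (∀ i, v.valuation K (y₀ i) ≤ 1) ∧ ∀ y : Fin 3 → K,
      (∀ i, v.valuation K (y i - y₀ i) < γ) →
        v.valuation K (∑ i, α i * x i ^ 2 - ∑ i, β i * y i ^ 2) <
          v.valuation K 4 * v.valuation K (∑ i, β i * y i ^ 2) := by
    intro v
    obtain ⟨x, y, hxy⟩ := exists_local_common_value (v.valuation_surjective K) hα hβ
    obtain ⟨δ, hδ, hδy⟩ := Valuation.exists_ne_zero_forall_mul_le_one (v.valuation K) y
    obtain ⟨m, rfl⟩ := v.valuation_surjective K δ
    have hm : m ≠ 0 := fun h => hδ (by rw [h, map_zero])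
    have hmy : ∀ i, v.valuation K (m * y i) ≤ 1 := fun i => by rw [map_mul]; exact hδy i
    have hm0 : v.valuation K (m ^ 2) ≠ 0 := by simpa using hm
    have hsc : ∀ (a z : Fin 3 → K), ∑ i, a i * (m * z i) ^ 2 = m ^ 2 * ∑ i, a i * z i ^ 2 := by
      intro a z
      rw [Finset.mul_sum]
      exact Finset.sum_congr rfl fun i _ => by ring
    have hP0 : v.valuation K (∑ i, β i * (m * y i) ^ 2) ≠ 0 := by
      rw [hsc, map_mul]
      refine mul_ne_zero hm0 fun h0 => ?_
      rw [h0, mul_zero] at hxy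
      exact not_lt_zero hxy
    have h40 : v.valuation K (4 : K) ≠ 0 := by simp
    obtain ⟨γ, hγ, hγ'⟩ := Valuation.exists_forall_sub_lt (w := v.valuation K) hβ hmy
      (mul_ne_zero h40 hP0)
    refine ⟨fun i => m * x i, fun i => m * y i, γ, hγ, hmy, fun z hz => ?_⟩
    have h1 := hγ' z hz
    have h2 : v.valuation K (∑ i, β i * z i ^ 2) = v.valuation K (∑ i, β i * (m * y i) ^ 2) := by
      have h3 := h1.trans_le (mul_le_of_le_one_left' (v.valuation K).map_four_le_one)
      have h4 := Valuation.map_add_eq_of_lt_right _ h3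
      rwa [sub_add_cancel] at h4
    rw [h2]
    have h5 : ∑ i, α i * (m * x i) ^ 2 - ∑ i, β i * z i ^ 2 =
        m ^ 2 * (∑ i, α i * x i ^ 2 - ∑ i, β i * y i ^ 2) -
          (∑ i, β i * z i ^ 2 - ∑ i, β i * (m * y i) ^ 2) := by
      rw [hsc, hsc]; ring
    rw [h5]
    refine (Valuation.map_sub _ _ _).trans_lt (max_lt ?_ h1)
    rw [map_mul, hsc, map_mul, mul_left_comm]
    exact (mul_lt_mul_iff_right₀ (zero_lt_iff.2 hm0)).2 hxy
  choose x y₀ γ hγ hy₀ hxy using hloc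
  obtain ⟨z, hz⟩ := exists_ternary_neg (K := K) hc hd
  have hM : ∀ v : HeightOneSpectrum (𝓞 K), ∃ M : ℕ, M ≠ 0 ∧
      ∀ i, v.valuation K ((M : K) * z i) < γ v := by
    intro v
    set B := 1 ⊔ (v.valuation K (z 0) ⊔ v.valuation K (z 1) ⊔ v.valuation K (z 2)) with hB
    have hzB : ∀ i, v.valuation K (z i) ≤ B := by
      intro i; fin_cases i <;> simp [hB]
    have hB0 : 0 < B := zero_lt_one.trans_le le_sup_left
    obtain ⟨M, hM, hM'⟩ := exists_natCast_valuation_lt v (mul_ne_zero (hγ v) (inv_ne_zero hB0.ne'))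
    refine ⟨M, hM, fun i => ?_⟩
    rw [map_mul]
    refine (mul_le_mul_right (hzB i) _).trans_lt ?_
    rwa [lt_mul_inv_iff₀ hB0] at hM'
  choose M hM0 hM using hM
  have hr : ∀ i : Fin 3, ∃ r : 𝓞 K, ∀ v ∈ T, v.valuation K (algebraMap (𝓞 K) K r - y₀ v i) < γ v :=
    fun i => exists_integer_approx T (fun v => y₀ v i) (fun v _ => hy₀ v i) γ fun v _ => hγ v
  choose r hr using hr
  set A : ℕ := ∏ v ∈ T, M v with hA
  have hA0 : (A : ℝ) ≠ 0 := by exact_mod_cast Finset.prod_ne_zero_iff.2 fun v _ => hM0 v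
  have hreal : ∀ φ : K →+* ℝ, ∀ᶠ m : ℕ in atTop,
      φ (∑ i, β i * (algebraMap (𝓞 K) K (r i) + (m * A : K) * z i) ^ 2) < 0 := by
    intro φ
    have h1 := eventually_quadratic_neg (φ (∑ i, β i * algebraMap (𝓞 K) K (r i) ^ 2))
      (φ (∑ i, β i * (2 * A * z i * algebraMap (𝓞 K) K (r i))))
      (C := (A : ℝ) ^ 2 * φ (∑ i, β i * z i ^ 2)) (mul_neg_of_pos_of_neg (by positivity) (hz φ))
    filter_upwards [h1] with m hm
    refine lt_of_eq_of_lt ?_ hm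
    simp only [map_mul, map_pow, map_add, map_natCast, map_ofNat, Fin.sum_univ_three]
    ring
  obtain ⟨m, hm⟩ := (eventually_all.2 hreal).exists
  refine ⟨fun i => algebraMap (𝓞 K) K (r i) + (m * A : K) * z i, hm, fun v hv => ⟨x v, hxy v _ ?_⟩⟩
  intro i
  rw [add_sub_right_comm]
  refine Valuation.map_add_lt _ (hr i v hv) ?_
  rw [hA, ← Finset.mul_prod_erase _ _ hv, Nat.cast_mul,
    show ((m : K) * (M v * (∏ v ∈ T.erase v, M v : ℕ))) * z i =
      ((m * (∏ v ∈ T.erase v, M v : ℕ) : ℕ) : K) * (M v * z i) by push_cast; ring, map_mul]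
  refine (mul_le_of_le_one_left' ?_).trans_lt (hM v i)
  have := v.valuation_le_one (K := K) ((m * (∏ v ∈ T.erase v, M v : ℕ) : ℕ) : 𝓞 K)
  rw [← map_natCast (algebraMap (𝓞 K) K)]
  exact this

end

section

variable {K : Type u} [Field K] [NumberField K]

theorem mem_globalNorms_algebraMap {L : Type u} [Field L] [NumberField L] [Algebra K L]
    {a b : Kˣ} {e : K} {r : L} (he : e ≠ 0) (hr : r ^ 2 = algebraMap K L e)
    (hneg : ∀ φ : K →+* ℝ, φ e < 0) (T : Set (HeightOneSpectrum (𝓞 K)))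
    (hT : ∀ v ∉ T, v.valuation K 2 = 1 ∧ v.valuation K (a : K) = 1 ∧ v.valuation K (b : K) = 1)
    (h : ∀ v ∈ T, ∃ x : Fin 3 → K, v.valuation K
      (∑ i, ![(a : K), b, -(a * b)] i * x i ^ 2 - e) < v.valuation K 4 * v.valuation K e) :
    ∃ y z : L, algebraMap K L a = y ^ 2 - algebraMap K L b * z ^ 2 := by
  have hr0 : r ≠ 0 := by
    rintro rfl
    refine he ((algebraMap K L).injective ?_)
    rw [← hr, map_zero, zero_pow two_ne_zero]
  have hL : IsTotallyComplex L := by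
    refine (isTotallyComplex_iff L).2 fun w => InfinitePlace.not_isReal_iff_isComplex.1 fun hw => ?_
    have h1 := hneg ((InfinitePlace.isReal_iff.1 hw).embedding.comp (algebraMap K L))
    rw [RingHom.comp_apply, ← hr, map_pow] at h1
    exact absurd h1 (not_lt.2 (sq_nonneg _))
  have key : Units.map (algebraMap K L).toMonoidHom a ∈
      globalNorms ((Units.map (algebraMap K L).toMonoidHom b : Lˣ) : L) := by
    refine mem_globalNorms_of_forall_mem_localNorms fun w => ?_
    by_cases hw : primeBelow K w ∈ T
    · obtain ⟨x, hx⟩ := h _ hw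
      obtain ⟨n, hn, hval⟩ := exists_valuation_algebraMap (K := K) w
      refine mem_localNorms_of_ternary (x₁ := algebraMap K L (x 0)) (x₂ := algebraMap K L (x 1))
        (x₃ := algebraMap K L (x 2)) hr0 ?_
      have h4 : (4 : L) = algebraMap K L 4 := (map_ofNat _ _).symm
      rw [hr, h4, hval, hval, ← mul_pow]
      convert pow_lt_pow_left₀ hx zero_le hn using 1
      rw [← hval]
      congr 1
      simp [Fin.sum_univ_three]
      ring
    · obtain ⟨h2, ha, hb⟩ := hT _ hw
      refine mem_localNorms_of_units ?_ ?_ ?_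
      · have := (valuation_algebraMap_eq_one_iff w (2 : K)).2 h2
        rwa [map_ofNat] at this
      · exact (valuation_algebraMap_eq_one_iff w (a : K)).2 ha
      · exact (valuation_algebraMap_eq_one_iff w (b : K)).2 hb
  exact key

end

section

variable {K : Type*} [Field K] [CharZero K]

theorem exists_ternary_eq_of_isotropic {a b e : K} (ha : a ≠ 0) (hb : b ≠ 0)
    {z : Fin 3 → K} (hz : z ≠ 0) (h : a * z 0 ^ 2 + b * z 1 ^ 2 - a * b * z 2 ^ 2 = 0) :
    ∃ x₁ x₂ x₃ : K, a * x₁ ^ 2 + b * x₂ ^ 2 - a * b * x₃ ^ 2 = e := by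
  -- find a vector not orthogonal to `z`
  obtain ⟨p, hp⟩ : ∃ p : Fin 3 → K, a * z 0 * p 0 + b * z 1 * p 1 - a * b * z 2 * p 2 ≠ 0 := by
    by_contra hcon
    push Not at hcon
    refine hz (funext fun i => ?_)
    have h0 := hcon ![1, 0, 0]
    have h1 := hcon ![0, 1, 0]
    have h2 := hcon ![0, 0, 1]
    simp [ha, hb] at h0 h1 h2
    fin_cases i <;> simp [h0, h1, h2]
  set B := a * z 0 * p 0 + b * z 1 * p 1 - a * b * z 2 * p 2 with hB
  set q := a * p 0 ^ 2 + b * p 1 ^ 2 - a * b * p 2 ^ 2 with hq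
  have hB2 : 2 * B ≠ 0 := mul_ne_zero two_ne_zero hp
  refine ⟨p 0 + (e - q) / (2 * B) * z 0, p 1 + (e - q) / (2 * B) * z 1,
    p 2 + (e - q) / (2 * B) * z 2, ?_⟩
  have hk : (e - q) / (2 * B) * (2 * B) = e - q := div_mul_cancel₀ _ hB2
  set k := (e - q) / (2 * B)
  rw [hB] at hk
  linear_combination hk + k ^ 2 * h + hq

/-- If a ternary form `⟨a, b, -ab⟩` is isotropic over `K(√e)` then it represents `e`. -/
theorem exists_ternary_eq_of_quadratic {a b e : K} (ha : a ≠ 0) (hb : b ≠ 0)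
    {p q : Fin 3 → K} (hpq : p ≠ 0 ∨ q ≠ 0)
    (h1 : a * p 0 ^ 2 + b * p 1 ^ 2 - a * b * p 2 ^ 2 +
      e * (a * q 0 ^ 2 + b * q 1 ^ 2 - a * b * q 2 ^ 2) = 0)
    (h2 : a * p 0 * q 0 + b * p 1 * q 1 - a * b * p 2 * q 2 = 0) :
    ∃ x₁ x₂ x₃ : K, a * x₁ ^ 2 + b * x₂ ^ 2 - a * b * x₃ ^ 2 = e := by
  by_cases hQ : a * q 0 ^ 2 + b * q 1 ^ 2 - a * b * q 2 ^ 2 = 0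
  · by_cases hq : q = 0
    · refine exists_ternary_eq_of_isotropic ha hb (hpq.resolve_right (not_not.2 hq)) ?_
      rw [hQ] at h1
      linear_combination h1
    · exact exists_ternary_eq_of_isotropic ha hb hq hQ
  · set Q := a * q 0 ^ 2 + b * q 1 ^ 2 - a * b * q 2 ^ 2 with hQd
    refine ⟨b * (p 1 * q 2 - p 2 * q 1) / Q, a * (p 2 * q 0 - p 0 * q 2) / Q,
      (p 0 * q 1 - p 1 * q 0) / Q, ?_⟩
    rw [div_pow, div_pow, div_pow, mul_div_assoc', mul_div_assoc', mul_div_assoc', ← add_div,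
      ← sub_div, div_eq_iff (pow_ne_zero 2 hQ)]
    linear_combination (a * p 0 * q 0 + b * p 1 * q 1 - a * b * p 2 * q 2) * h2 - Q * h1 +
      (a * p 0 ^ 2 + b * p 1 ^ 2 - a * b * p 2 ^ 2) * hQd

end

section

variable {K : Type u} [Field K] [NumberField K]

/-- Over a number field, the six-dimensional form `⟨a, b, -ab, -c, -d, cd⟩` is isotropic. -/
theorem exists_ternary_eq_ternary {a b c d : K} (ha : a ≠ 0) (hb : b ≠ 0) (hc : c ≠ 0)
    (hd : d ≠ 0) :
    ∃ x₁ x₂ x₃ y₁ y₂ y₃ : K, (y₁ ≠ 0 ∨ y₂ ≠ 0 ∨ y₃ ≠ 0) ∧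
      a * x₁ ^ 2 + b * x₂ ^ 2 - a * b * x₃ ^ 2 = c * y₁ ^ 2 + d * y₂ ^ 2 - c * d * y₃ ^ 2 := by
  obtain ⟨v₀⟩ : Nonempty (HeightOneSpectrum (𝓞 K)) := by
    obtain ⟨M, hM⟩ := Ideal.exists_maximal (𝓞 K)
    exact ⟨⟨M, hM.isPrime, Ring.ne_bot_of_isMaximal_of_not_isField hM
      (RingOfIntegers.not_isField K)⟩⟩
  have hfin := (((finite_setOf_valuation_ne_one (Units.mk0 (2 : K) two_ne_zero)).union
    (finite_setOf_valuation_ne_one (Units.mk0 a ha))).union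
    (finite_setOf_valuation_ne_one (Units.mk0 b hb))).union (Set.finite_singleton v₀)
  have hα : ∀ i, ![a, b, -(a * b)] i ≠ 0 := by
    intro i; fin_cases i <;> simp [ha, hb]
  obtain ⟨y, hneg, hy⟩ := exists_common_value_approx hfin.toFinset hα hc hd
  set e := ∑ i, ![c, d, -(c * d)] i * y i ^ 2 with he
  have he0 : e ≠ 0 := by
    obtain ⟨x, hx⟩ := hy v₀ (by simp)
    intro h
    rw [h, map_zero, mul_zero] at hx
    exact not_lt_zero hx
  have he' : e = c * y 0 ^ 2 + d * y 1 ^ 2 - c * d * y 2 ^ 2 := by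
    rw [he]; simp [Fin.sum_univ_three]; ring
  have hynz : y 0 ≠ 0 ∨ y 1 ≠ 0 ∨ y 2 ≠ 0 := by
    by_contra! h
    exact he0 (by rw [he', h.1, h.2.1, h.2.2]; ring)
  suffices ∃ x₁ x₂ x₃ : K, a * x₁ ^ 2 + b * x₂ ^ 2 - a * b * x₃ ^ 2 = e by
    obtain ⟨x₁, x₂, x₃, hx⟩ := this
    exact ⟨x₁, x₂, x₃, y 0, y 1, y 2, hynz, hx.trans he'⟩
  have hT : ∀ v ∉ (hfin.toFinset : Set (HeightOneSpectrum (𝓞 K))), v.valuation K 2 = 1 ∧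
      v.valuation K ((Units.mk0 a ha : Kˣ) : K) = 1 ∧
      v.valuation K ((Units.mk0 b hb : Kˣ) : K) = 1 := by
    intro v hv
    simp at hv
    tauto
  by_cases hsq : IsSquare e
  · obtain ⟨r, hr⟩ := hsq
    obtain ⟨p, q, hpq⟩ := mem_globalNorms_algebraMap (L := K) (r := r) he0
      (by rw [hr]; simp [sq]) hneg _ hT hy
    simp only [Algebra.algebraMap_self, RingHom.id_apply, Units.val_mk0] at hpq
    refine exists_ternary_eq_of_isotropic ha hb (z := ![b * q, a, p]) ?_ ?_
    · intro h
      exact ha (by simpa using congrFun h 1)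
    · simp
      linear_combination a * b * hpq
  · obtain ⟨L, _, _, _, σ, r, h⟩ := exists_isQuadraticConj hsq
    obtain ⟨p, q, hpq⟩ := mem_globalNorms_algebraMap (L := L) (r := r) he0 h.sq hneg _ hT hy
    obtain ⟨p₁, p₂, rfl⟩ := h.span p
    obtain ⟨q₁, q₂, rfl⟩ := h.span q
    have hc1 := congrArg σ hpq
    simp only [map_sub, map_mul, map_pow, map_add, AlgEquiv.commutes, h.conj, Units.val_mk0] at hpq hc1
    have hinj := (algebraMap K L).injective
    have e1 : a = p₁ ^ 2 + e * p₂ ^ 2 - b * (q₁ ^ 2 + e * q₂ ^ 2) := by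
      refine hinj ?_
      simp only [map_sub, map_mul, map_pow, map_add]
      have h2 : (2 : L) ≠ 0 := two_ne_zero
      refine mul_left_cancel₀ h2 ?_
      linear_combination hpq + hc1 + 2 * ((algebraMap K L p₂) ^ 2 -
        algebraMap K L b * (algebraMap K L q₂) ^ 2) * h.sq
    have e2 : p₁ * p₂ - b * (q₁ * q₂) = 0 := by
      refine hinj ?_
      simp only [map_sub, map_mul, map_zero]
      have h2 : 4 * r ≠ 0 := mul_ne_zero (OfNat.ofNat_ne_zero 4) h.ne_zero
      refine mul_left_cancel₀ h2 ?_
      linear_combination hc1 - hpq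
    refine exists_ternary_eq_of_quadratic (p := ![b * q₁, a, p₁]) (q := ![b * q₂, 0, p₂]) ha hb
      (Or.inl fun h => ha (by simpa using congrFun h 1)) ?_ ?_
    · simp
      linear_combination a * b * e1
    · simp
      linear_combination - a * b * e2

end

section

variable {K F D : Type*} [Field K] [Field F] [Algebra K F] [DivisionRing D] [Algebra K D]

theorem equivFinsuppOfBasisLeft_mul_right {ι : Type*} [DecidableEq ι] (b : Basis ι K F) (x : F ⊗[K] D) (d : D)
    (i : ι) : TensorProduct.equivFinsuppOfBasisLeft b (x * 1 ⊗ₜ d) i =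
      TensorProduct.equivFinsuppOfBasisLeft b x i * d := by
  induction x with
  | zero => simp
  | tmul f e => simp [TensorProduct.equivFinsuppOfBasisLeft_apply_tmul]
  | add x y hx hy => simp [add_mul, hx, hy]

theorem equivFinsuppOfBasisLeft_mul_left {ι : Type*} [DecidableEq ι] (b : Basis ι K F) (x : F ⊗[K] D) (d : D)
    (i : ι) : TensorProduct.equivFinsuppOfBasisLeft b ((1 ⊗ₜ d) * x) i =
      d * TensorProduct.equivFinsuppOfBasisLeft b x i := by
  induction x with
  | zero => simp
  | tmul f e => simp [TensorProduct.equivFinsuppOfBasisLeft_apply_tmul]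
  | add x y hx hy => simp [mul_add, hx, hy]

/-- An element of `F ⊗ D` commuting with `D` lies in `F`. -/
theorem exists_eq_algebraMap_of_commute [Algebra.IsCentral K D] {x : F ⊗[K] D}
    (hx : ∀ d : D, (1 ⊗ₜ d) * x = x * 1 ⊗ₜ d) : ∃ f : F, x = algebraMap F (F ⊗[K] D) f := by
  classical
  let b := Basis.ofVectorSpace K F
  have h : ∀ i, ∃ k : K, TensorProduct.equivFinsuppOfBasisLeft b x i = algebraMap K D k := by
    intro i
    refine (Algebra.IsCentral.mem_center_iff K).1 ?_
    rw [Subalgebra.mem_center_iff]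
    intro d
    rw [← equivFinsuppOfBasisLeft_mul_left, ← equivFinsuppOfBasisLeft_mul_right, hx]
  choose k hk using h
  refine ⟨∑ i ∈ (TensorProduct.equivFinsuppOfBasisLeft b x).support, k i • b i, ?_⟩
  apply (TensorProduct.equivFinsuppOfBasisLeft b (N := D)).injective
  ext i
  rw [Algebra.TensorProduct.algebraMap_apply, TensorProduct.equivFinsuppOfBasisLeft_apply_tmul]
  have h1 : b.repr (∑ j ∈ (TensorProduct.equivFinsuppOfBasisLeft b x).support, k j • b j) i =
      if i ∈ (TensorProduct.equivFinsuppOfBasisLeft b x).support then k i else 0 := by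
    simp only [map_sum, map_smul, Finsupp.finsetSum_apply, Finsupp.smul_apply, Basis.repr_self,
      Finsupp.single_apply, smul_eq_mul, mul_ite, mul_one, mul_zero, Finset.sum_ite_eq']
  rw [Finsupp.mapRange_apply, Algebra.algebraMap_self, RingHom.id_apply, h1]
  split_ifs with h2
  · simp [hk, Algebra.smul_def]
  · simpa using h2

instance isCentral_tensorProduct [Algebra.IsCentral K D] : Algebra.IsCentral F (F ⊗[K] D) where
  out := fun x hx => by
    rw [Subalgebra.mem_center_iff] at hx
    obtain ⟨f, rfl⟩ := exists_eq_algebraMap_of_commute (x := x) fun d => hx _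
    exact ⟨f, rfl⟩

theorem isSimpleRing_tensorProduct [Algebra.IsCentral K D] : IsSimpleRing (F ⊗[K] D) := by
  classical
  let b := Basis.ofVectorSpace K F
  let c := TensorProduct.equivFinsuppOfBasisLeft b (N := D)
  refine IsSimpleRing.of_eq_bot_or_eq_top fun I => or_iff_not_imp_left.2 fun hI => ?_
  obtain ⟨x₀, hx₀I, hx₀⟩ : ∃ x ∈ I, x ≠ 0 := by
    by_contra! h
    exact hI (eq_bot_iff.2 fun x hx => by simpa using h x hx)
  have hP : ∃ n, ∃ x ∈ I, x ≠ 0 ∧ (c x).support.card = n := ⟨_, x₀, hx₀I, hx₀, rfl⟩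
  obtain ⟨x, hxI, hx0, hxn⟩ := Nat.find_spec hP
  have hmin : ∀ y ∈ I, (c y).support.card < (c x).support.card → y = 0 := by
    intro y hy hlt
    by_contra hy0
    rw [hxn] at hlt
    exact Nat.find_min hP hlt ⟨y, hy, hy0, rfl⟩
  obtain ⟨i, hi⟩ : ∃ i, c x i ≠ 0 := by
    by_contra! h
    exact hx0 (c.injective (by rw [map_zero]; ext i; simpa using h i))
  set z := x * 1 ⊗ₜ (c x i)⁻¹ with hz
  have hzI : z ∈ I := I.mul_mem_right _ _ hxI
  have hcz : ∀ j, c z j = c x j * (c x i)⁻¹ := fun j => equivFinsuppOfBasisLeft_mul_right b _ _ _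
  have hzi : c z i = 1 := by rw [hcz, mul_inv_cancel₀ hi]
  have hcomm : ∀ d : D, (1 ⊗ₜ d) * z = z * 1 ⊗ₜ d := by
    intro d
    rw [← sub_eq_zero]
    refine hmin _ (I.sub_mem (I.mul_mem_left _ _ hzI) (I.mul_mem_right _ _ hzI)) ?_
    have hj : ∀ j, c ((1 ⊗ₜ d) * z - z * 1 ⊗ₜ d) j = d * c z j - c z j * d := by
      intro j
      rw [map_sub, Finsupp.sub_apply]
      exact congrArg₂ _ (equivFinsuppOfBasisLeft_mul_left b _ _ _)
        (equivFinsuppOfBasisLeft_mul_right b _ _ _)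
    refine Finset.card_lt_card ((Finset.ssubset_iff_of_subset fun j => ?_).2 ⟨i, ?_, ?_⟩)
    · rw [Finsupp.mem_support_iff, Finsupp.mem_support_iff, hj, hcz]
      contrapose!
      intro h
      simp [h]
    · simpa using hi
    · rw [Finsupp.notMem_support_iff, hj, hzi]
      simp
  obtain ⟨f, hf⟩ := exists_eq_algebraMap_of_commute (K := K) (x := z) hcomm
  have hf0 : f ≠ 0 := by
    rintro rfl
    rw [map_zero] at hf
    rw [hf, map_zero] at hzi
    simp at hzi
  have h1 : (1 : F ⊗[K] D) ∈ I := by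
    have := I.mul_mem_left (algebraMap F _ f⁻¹) _ hzI
    rwa [hf, ← map_mul, inv_mul_cancel₀ hf0, map_one] at this
  exact (TwoSidedIdeal.one_mem_iff _).1 h1

end

section

variable {A V W : Type*} [Ring A] [IsSimpleRing A] [IsArtinianRing A] [AddCommGroup V]
  [AddCommGroup W] [Module A V] [Module A W]

theorem nonempty_linearEquiv_of_isSimpleModule [IsSimpleModule A V] [IsSimpleModule A W] :
    Nonempty (V ≃ₗ[A] W) := by
  have e1 := LinearEquiv.ofInjective (LinearMap.inl A V W) LinearMap.inl_injective
  have e2 := LinearEquiv.ofInjective (LinearMap.inr A V W) LinearMap.inr_injective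
  have := IsSimpleModule.congr e1.symm
  have := IsSimpleModule.congr e2.symm
  obtain ⟨e⟩ := IsSimpleRing.isIsotypic A (V × W) (LinearMap.range (LinearMap.inr A V W))
    (LinearMap.range (LinearMap.inl A V W))
  exact ⟨e1.trans (e.trans e2.symm)⟩

theorem exists_linearEquiv_fin [IsSimpleModule A V] [Module.Finite A W] :
    ∃ k : ℕ, Nonempty (W ≃ₗ[A] Fin k → V) := by
  refine IsIsotypicOfType.linearEquiv_fun fun m _ => nonempty_linearEquiv_of_isSimpleModule

end

section

variable {F A V W : Type*} [Field F] [Ring A] [Algebra F A] [IsSimpleRing A] [FiniteDimensional F A]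
  [AddCommGroup V] [Module F V] [Module A V] [IsScalarTower F A V]
  [AddCommGroup W] [Module F W] [Module A W] [IsScalarTower F A W]

theorem exists_finrank_eq_mul [IsSimpleModule A V] [FiniteDimensional F W] :
    ∃ k : ℕ, finrank F W = k * finrank F V ∧ Nonempty (W ≃ₗ[A] Fin k → V) := by
  have := IsArtinianRing.of_finite F A
  have : Module.Finite A W := Module.Finite.of_restrictScalars_finite F A W
  obtain ⟨k, ⟨e⟩⟩ := exists_linearEquiv_fin (A := A) (V := V) (W := W)
  refine ⟨k, ?_, ⟨e⟩⟩
  by_cases hV : FiniteDimensional F V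
  · rw [(e.restrictScalars F).finrank_eq, Module.finrank_pi_fintype]
    simp
  · have hk : ¬ FiniteDimensional F V := hV
    exfalso
    have : Module.Finite A V := inferInstance
    exact hV (Module.Finite.trans A V)

theorem nonempty_linearEquiv_of_finrank_eq [IsSimpleModule A V] [FiniteDimensional F W]
    [FiniteDimensional F V] (h : finrank F W = finrank F V) : Nonempty (W ≃ₗ[A] V) := by
  obtain ⟨k, hk, ⟨e⟩⟩ := exists_finrank_eq_mul (F := F) (A := A) (V := V) (W := W)
  have : Nontrivial V := IsSimpleModule.nontrivial A V
  have hV : finrank F V ≠ 0 := (finrank_pos).ne'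
  obtain rfl : k = 1 := by
    rw [h] at hk
    exact (Nat.eq_of_mul_eq_mul_right (Nat.pos_of_ne_zero hV) (by rw [one_mul]; exact hk)).symm
  exact ⟨e.trans (LinearEquiv.funUnique (Fin 1) A V)⟩

end

section

variable {F A V : Type*} [Field F] [Ring A] [Algebra F A] [IsSimpleRing A] [FiniteDimensional F A]
  [AddCommGroup V] [Module F V] [Module A V] [IsScalarTower F A V] [IsSimpleModule A V]

theorem finiteDimensional_of_isSimpleModule (F A V : Type*) [Field F] [Ring A] [Algebra F A]
    [FiniteDimensional F A] [AddCommGroup V] [Module F V] [Module A V] [IsScalarTower F A V]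
    [IsSimpleModule A V] : FiniteDimensional F V :=
  have : Module.Finite A V := inferInstance
  Module.Finite.trans A V

theorem bijective_toModuleEnd (F A V : Type*) [Field F] [Ring A] [Algebra F A] [IsSimpleRing A]
    [FiniteDimensional F A] [AddCommGroup V] [Module F V] [Module A V] [IsScalarTower F A V]
    [IsSimpleModule A V] : Function.Bijective
    (Module.toModuleEnd (Module.End A V) (S := A) V) := by
  classical
  have := finiteDimensional_of_isSimpleModule F A V
  have : Nontrivial V := IsSimpleModule.nontrivial A V
  have : IsScalarTower F (Module.End A V) V := ⟨fun c e v => rfl⟩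
  have : Module.Finite (Module.End A V) V :=
    Module.Finite.of_restrictScalars_finite F (Module.End A V) V
  exact ⟨RingHom.injective _, Module.Finite.toModuleEnd_moduleEnd_surjective⟩

theorem finrank_end_mul_finrank :
    finrank F (Module.End A V) * finrank F A = finrank F V ^ 2 := by
  classical
  have := finiteDimensional_of_isSimpleModule F A V
  have : IsScalarTower F (Module.End A V) V := ⟨fun c e v => rfl⟩
  have : Module.Finite (Module.End A V) V :=
    Module.Finite.of_restrictScalars_finite F (Module.End A V) V
  have h1 : finrank F A = finrank (Module.End A V) V * finrank F V := by
    let b := Module.finBasis (Module.End A V) V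
    let e1 : A ≃ₗ[F] (V →ₗ[Module.End A V] V) :=
      LinearEquiv.ofBijective
        { toFun := Module.toModuleEnd (Module.End A V) (S := A) V
          map_add' := map_add _
          map_smul' := fun c a => by ext v; simp }
        (bijective_toModuleEnd F A V)
    rw [(e1.trans (b.constr F (M' := V)).symm).finrank_eq, Module.finrank_pi_fintype]
    simp
  have h2 : finrank F (Module.End A V) * finrank (Module.End A V) V = finrank F V :=
    Module.finrank_mul_finrank _ _ _
  rw [h1, ← mul_assoc, h2, sq]

theorem exists_eq_smul_of_commute_end [Algebra.IsCentral F A] {z : Module.End A V}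
    (hz : ∀ e : Module.End A V, e * z = z * e) : ∃ c : F, z = c • (1 : Module.End A V) := by
  let z' : Module.End (Module.End A V) V :=
    { toFun := z
      map_add' := map_add z
      map_smul' := fun e v => (LinearMap.congr_fun (hz e) v).symm }
  obtain ⟨a, ha⟩ := (bijective_toModuleEnd F A V).2 z'
  have hav : ∀ v, a • v = z v := fun v => LinearMap.congr_fun ha v
  have hac : a ∈ Subalgebra.center F A := by
    rw [Subalgebra.mem_center_iff]
    intro b
    apply (bijective_toModuleEnd F A V).1
    ext v
    change (b * a) • v = (a * b) • v
    rw [mul_smul, mul_smul, hav, hav, map_smul]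
  obtain ⟨c, rfl⟩ := (Algebra.IsCentral.mem_center_iff F).1 hac
  refine ⟨c, ?_⟩
  ext v
  rw [← hav]
  simp

end

section

variable {A V : Type*} [Ring A] [AddCommGroup V] [Module A V]

/-- The twist of a module by an automorphism of the ring. -/
def TwistedModule (_ : A ≃+* A) (V : Type*) : Type _ := V

instance (σ : A ≃+* A) : AddCommGroup (TwistedModule σ V) := inferInstanceAs (AddCommGroup V)

instance (σ : A ≃+* A) : Module A (TwistedModule σ V) where
  smul a := fun (v : V) => (σ a • v : V)
  one_smul := fun (v : V) => (congrArg (· • v) (map_one σ)).trans (one_smul A v)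
  mul_smul a b := fun (v : V) => (congrArg (· • v) (map_mul σ a b)).trans (mul_smul (σ a) (σ b) v)
  smul_zero a := smul_zero (A := V) (σ a)
  smul_add a := fun (v w : V) => smul_add (σ a) v w
  add_smul a b := fun (v : V) => (congrArg (· • v) (map_add σ a b)).trans (add_smul (σ a) (σ b) v)
  zero_smul := fun (v : V) => (congrArg (· • v) (map_zero σ)).trans (zero_smul A v)

/-- The identity as an additive map to the twist. -/
def TwistedModule.of (σ : A ≃+* A) (V : Type*) [AddCommGroup V] : V ≃+ TwistedModule σ V :=
  AddEquiv.refl V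

theorem TwistedModule.smul_of (σ : A ≃+* A) (a : A) (v : V) :
    a • of σ V v = of σ V (σ a • v) := rfl

instance (σ : A ≃+* A) [hV : IsSimpleModule A V] : IsSimpleModule A (TwistedModule σ V) := by
  have h := isSimpleModule_iff_toSpanSingleton_surjective.1 hV
  refine isSimpleModule_iff_toSpanSingleton_surjective.2
    ⟨(TwistedModule.of σ V).toEquiv.nontrivial_congr.1 h.1, fun m hm v => ?_⟩
  obtain ⟨m, rfl⟩ := (TwistedModule.of σ V).surjective m
  obtain ⟨v, rfl⟩ := (TwistedModule.of σ V).surjective v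
  obtain ⟨a, ha⟩ := h.2 m (fun h => hm (by rw [h, map_zero])) v
  refine ⟨σ.symm a, ?_⟩
  rw [LinearMap.toSpanSingleton_apply, TwistedModule.smul_of, σ.apply_symm_apply]
  exact congrArg _ ha

/-- Simple modules are isomorphic to their twists by automorphisms. -/
theorem exists_semilinear_end [IsSimpleRing A] [IsArtinianRing A] [IsSimpleModule A V]
    (σ : A ≃+* A) : ∃ u : V ≃+ V, ∀ (a : A) v, u (a • v) = σ a • u v := by
  obtain ⟨u⟩ := nonempty_linearEquiv_of_isSimpleModule (A := A) (V := V) (W := TwistedModule σ V)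
  refine ⟨u.toAddEquiv.trans (TwistedModule.of σ V).symm, fun a v => ?_⟩
  apply (TwistedModule.of σ V).injective
  rw [← TwistedModule.smul_of]
  simp

end

section

variable (F A : Type*) [Field F] [Ring A] [Algebra F A]

/-- The dimension of a minimal left ideal. -/
noncomputable def simpleDim : ℕ :=
  sInf {m | ∃ I : Submodule A A, IsSimpleModule A I ∧ finrank F I = m}

variable [IsSimpleRing A] [FiniteDimensional F A]

theorem exists_isSimpleModule_finrank_eq :
    ∃ I : Submodule A A, IsSimpleModule A I ∧ finrank F I = simpleDim F A := by
  have := IsArtinianRing.of_finite F A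
  have h : {m | ∃ I : Submodule A A, IsSimpleModule A I ∧ finrank F I = m}.Nonempty := by
    obtain ⟨I, hI⟩ := IsSemisimpleModule.exists_simple_submodule A A
    exact ⟨_, I, hI, rfl⟩
  exact Nat.sInf_mem h

variable (V : Type*) [AddCommGroup V] [Module F V] [Module A V] [IsScalarTower F A V]

theorem simpleDim_dvd_finrank [FiniteDimensional F V] : simpleDim F A ∣ finrank F V := by
  obtain ⟨I, hI, h⟩ := exists_isSimpleModule_finrank_eq F A
  obtain ⟨k, hk, -⟩ := exists_finrank_eq_mul (F := F) (A := A) (V := I) (W := V)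
  rw [hk, h]
  exact Dvd.intro_left k rfl

theorem isSimpleModule_of_finrank_eq [FiniteDimensional F V] (h : finrank F V = simpleDim F A) :
    IsSimpleModule A V := by
  obtain ⟨I, hI, h'⟩ := exists_isSimpleModule_finrank_eq F A
  have := finiteDimensional_of_isSimpleModule F A I
  obtain ⟨e⟩ := nonempty_linearEquiv_of_finrank_eq (F := F) (A := A) (V := I) (W := V) (h.trans h'.symm)
  exact IsSimpleModule.congr e

end

theorem simpleDim_dvd_finrank_mul {F F' A A' : Type*} [Field F] [Field F'] [Algebra F F'] [Ring A]
    [Algebra F A] [Ring A'] [Algebra F' A'] [Algebra F A'] [IsScalarTower F F' A']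
    [FiniteDimensional F F'] [FiniteDimensional F A] [FiniteDimensional F' A']
    [IsSimpleRing A] [IsSimpleRing A'] (f : A →ₐ[F] A') :
    simpleDim F A ∣ finrank F F' * simpleDim F' A' := by
  obtain ⟨I, hI, h⟩ := exists_isSimpleModule_finrank_eq F' A'
  have := finiteDimensional_of_isSimpleModule F' A' I
  let M : Module A I := Module.compHom I f.toRingHom
  have hs : ∀ (a : A) (v : I), a • v = f a • v := fun _ _ => rfl
  have : IsScalarTower F A I := ⟨fun c a v => by
    rw [hs, hs, map_smul, smul_assoc]⟩
  have : FiniteDimensional F I := Module.Finite.trans F' I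
  rw [← h, Module.finrank_mul_finrank]
  exact simpleDim_dvd_finrank F A I

section

variable (K F D : Type*) [Field K] [Field F] [Algebra K F] [DivisionRing D] [Algebra K D]
  [FiniteDimensional K D] [Algebra.IsCentral K D]

theorem finrank_dvd_mul_simpleDim [FiniteDimensional K F] :
    finrank K D ∣ finrank K F * simpleDim F (F ⊗[K] D) := by
  have := isSimpleRing_tensorProduct (K := K) (F := F) (D := D)
  obtain ⟨I, hI, h⟩ := exists_isSimpleModule_finrank_eq F (F ⊗[K] D)
  let f : D →ₐ[K] F ⊗[K] D := Algebra.TensorProduct.includeRight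
  let M : Module D I := Module.compHom I f.toRingHom
  have hs : ∀ (a : D) (v : I), a • v = f a • v := fun _ _ => rfl
  have : IsScalarTower K D I := ⟨fun c a v => by
    rw [hs, hs, map_smul, smul_assoc]⟩
  rw [← h, Module.finrank_mul_finrank, ← Module.finrank_mul_finrank K D I]
  exact Dvd.intro _ rfl

variable {K D}

theorem dvd_simpleDim {n : ℕ} (hn : finrank K D = n ^ 2) : n ∣ simpleDim F (F ⊗[K] D) := by
  have := isSimpleRing_tensorProduct (K := K) (F := F) (D := D)
  obtain ⟨I, hI, h⟩ := exists_isSimpleModule_finrank_eq F (F ⊗[K] D)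
  have h1 := finrank_end_mul_finrank (F := F) (A := F ⊗[K] D) (V := I)
  rw [Module.finrank_baseChange, hn, h] at h1
  exact (Nat.pow_dvd_pow_iff two_ne_zero).1 ⟨_, (h1.symm.trans (mul_comm _ _))⟩

theorem simpleDim_tensorProduct_dvd (F' : Type*) [Field F'] [Algebra K F'] [Algebra F F']
    [IsScalarTower K F F'] [FiniteDimensional F F'] :
    simpleDim F (F ⊗[K] D) ∣ finrank F F' * simpleDim F' (F' ⊗[K] D) := by
  have := isSimpleRing_tensorProduct (K := K) (F := F) (D := D)
  have := isSimpleRing_tensorProduct (K := K) (F := F') (D := D)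
  exact simpleDim_dvd_finrank_mul
    (Algebra.TensorProduct.map (Algebra.ofId F F') (AlgHom.id K D) : F ⊗[K] D →ₐ[F] F' ⊗[K] D)

end

theorem exists_algHom_matrix_algebraicClosure {K : Type u} [Field K] {D : Type u} [DivisionRing D]
    [Algebra K D] [FiniteDimensional K D] [Algebra.IsCentral K D] {n : ℕ}
    (hn : finrank K D = n ^ 2) :
    Nonempty (D →ₐ[K] Matrix (Fin n) (Fin n) (AlgebraicClosure K)) := by
  have := isSimpleRing_tensorProduct (K := K) (F := AlgebraicClosure K) (D := D)
  obtain ⟨k, hk, ⟨e⟩⟩ := IsSimpleRing.exists_algEquiv_matrix_of_isAlgClosed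
    (AlgebraicClosure K) (AlgebraicClosure K ⊗[K] D)
  have h := e.toLinearEquiv.finrank_eq
  rw [Module.finrank_baseChange, hn, Module.finrank_matrix] at h
  obtain rfl : n = k := by
    simp only [Fintype.card_fin, finrank_self, mul_one, ← sq] at h
    exact Nat.pow_left_injective two_ne_zero h
  exact ⟨(e.toAlgHom.restrictScalars K).comp Algebra.TensorProduct.includeRight⟩

/-- A central division algebra is split by a finite Galois extension. -/
theorem exists_isGalois_algHom_matrix {K : Type u} [Field K] [CharZero K] {D : Type u}
    [DivisionRing D] [Algebra K D] [FiniteDimensional K D] [Algebra.IsCentral K D] {n : ℕ}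
    (hn : finrank K D = n ^ 2) :
    ∃ N : IntermediateField K (AlgebraicClosure K), FiniteDimensional K N ∧ IsGalois K N ∧
      Nonempty (D →ₐ[K] Matrix (Fin n) (Fin n) N) := by
  obtain ⟨g⟩ := exists_algHom_matrix_algebraicClosure hn
  let b := Module.finBasis K D
  let S : Set (AlgebraicClosure K) :=
    Set.range fun t : Fin (finrank K D) × Fin n × Fin n => g (b t.1) t.2.1 t.2.2
  have hS : S.Finite := Set.finite_range _
  let L := IntermediateField.adjoin K S
  have : FiniteDimensional K L := by
    have : Finite S := hS
    exact IntermediateField.finiteDimensional_adjoin fun x _ => Algebra.IsIntegral.isIntegral x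
  let N := IntermediateField.normalClosure K L (AlgebraicClosure K)
  have hLN : L ≤ N := IntermediateField.le_normalClosure L
  let φ : Matrix (Fin n) (Fin n) N →ₐ[K] Matrix (Fin n) (Fin n) (AlgebraicClosure K) :=
    N.val.mapMatrix
  have hφ : Function.Injective φ := Matrix.map_injective N.val.injective
  have hr : ∀ x, g x ∈ φ.range := by
    intro x
    have hb : ∀ i, g (b i) ∈ φ.range := by
      intro i
      refine ⟨Matrix.of fun r s => ⟨g (b i) r s, hLN (IntermediateField.subset_adjoin K S
        ⟨(i, r, s), rfl⟩)⟩, ?_⟩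
      ext r s
      rfl
    rw [← b.sum_repr x, map_sum]
    refine Subalgebra.sum_mem _ fun i _ => ?_
    rw [map_smul]
    exact Subalgebra.smul_mem _ (hb i) _
  refine ⟨N, inferInstance, ?_, ⟨(AlgEquiv.ofInjective φ hφ).symm.toAlgHom.comp
    (g.codRestrict φ.range hr)⟩⟩
  have : Normal K N := inferInstance
  exact ⟨⟩

theorem simpleDim_dvd_of_algHom_matrix {K N D : Type*} [Field K] [Field N] [Algebra K N]
    [DivisionRing D] [Algebra K D] [FiniteDimensional K D] [Algebra.IsCentral K D] {n : ℕ}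
    (g : D →ₐ[K] Matrix (Fin n) (Fin n) N) : simpleDim N (N ⊗[K] D) ∣ n := by
  have := isSimpleRing_tensorProduct (K := K) (F := N) (D := D)
  let f : N ⊗[K] D →ₐ[N] Module.End N (Fin n → N) :=
    Matrix.toLinAlgEquiv'.toAlgHom.comp
      (Algebra.TensorProduct.lift (Algebra.ofId N _) g fun x y => Algebra.commutes _ _)
  let M : Module (N ⊗[K] D) (Fin n → N) := Module.compHom _ f.toRingHom
  have hs : ∀ (a : N ⊗[K] D) (v : Fin n → N), a • v = f a v := fun _ _ => rfl
  have : IsScalarTower N (N ⊗[K] D) (Fin n → N) := ⟨fun c a v => by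
    rw [hs, hs, map_smul, LinearMap.smul_apply]⟩
  have h := simpleDim_dvd_finrank N (N ⊗[K] D) (Fin n → N)
  rwa [Module.finrank_pi, Fintype.card_fin] at h

section

variable {K N : Type u} [Field K] [Field N] [Algebra K N] [FiniteDimensional K N] [IsGalois K N]

theorem finrank_fixedField_eq_index (H : Subgroup Gal(N/K)) :
    finrank K (IntermediateField.fixedField H) = H.index := by
  rw [IntermediateField.finrank_eq_fixingSubgroup_index,
    IntermediateField.fixingSubgroup_fixedField]

/-- If `H` is normalised by `g` and does not contain `g`, then `g` induces a nontrivial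
automorphism of the fixed field of `H`. -/
theorem exists_algEquiv_fixedField {H : Subgroup Gal(N/K)} {g : Gal(N/K)} (hg : g ∉ H)
    (hn : ∀ h, h ∈ H → g⁻¹ * h * g ∈ H) :
    ∃ χ : IntermediateField.fixedField H ≃ₐ[K] IntermediateField.fixedField H,
      (∀ x, (χ x : N) = g x) ∧ ∃ x, χ x ≠ x := by
  let F := IntermediateField.fixedField H
  have h1 : ∀ x : F, g x ∈ F := by
    intro x
    rw [IntermediateField.mem_fixedField_iff]
    intro h hh
    have h2 := (IntermediateField.mem_fixedField_iff H _).1 x.2 _ (hn h hh)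
    calc h (g x) = g ((g⁻¹ * h * g) x) := by
          rw [← AlgEquiv.mul_apply, ← AlgEquiv.mul_apply]
          congr 1
          group
      _ = g x := by rw [h2]
  let χ : F →ₐ[K] F := (g.toAlgHom.comp F.val).codRestrict F.toSubalgebra h1
  have hχ : ∀ x, (χ x : N) = g x := fun x => rfl
  refine ⟨AlgEquiv.ofBijective χ (Algebra.IsAlgebraic.algHom_bijective χ), hχ, ?_⟩
  by_contra! hc
  apply hg
  rw [← IntermediateField.fixingSubgroup_fixedField H, IntermediateField.mem_fixingSubgroup_iff]
  intro x hx
  exact (hχ ⟨x, hx⟩).symm.trans (congrArg Subtype.val (hc ⟨x, hx⟩))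

variable {D : Type u} [DivisionRing D] [Algebra K D]
  [FiniteDimensional K D] [Algebra.IsCentral K D]

theorem simpleDim_fixedField_dvd {H H' : Subgroup Gal(N/K)} {m : ℕ} (h : H ≤ H')
    (hc : Nat.card H' = Nat.card H * m) :
    simpleDim (IntermediateField.fixedField H') (IntermediateField.fixedField H' ⊗[K] D) ∣
      m * simpleDim (IntermediateField.fixedField H) (IntermediateField.fixedField H ⊗[K] D) := by
  let _ : Algebra (IntermediateField.fixedField H') (IntermediateField.fixedField H) :=
    (IntermediateField.inclusion (IntermediateField.fixedField_le h)).toRingHom.toAlgebra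
  have : IsScalarTower K (IntermediateField.fixedField H') (IntermediateField.fixedField H) :=
    .of_algebraMap_eq fun _ => rfl
  have : IsScalarTower (IntermediateField.fixedField H') (IntermediateField.fixedField H) N :=
    .of_algebraMap_eq fun _ => rfl
  have : FiniteDimensional (IntermediateField.fixedField H') (IntermediateField.fixedField H) :=
    Module.Finite.of_restrictScalars_finite K _ _
  have h1 := simpleDim_tensorProduct_dvd (D := D) (K := K) (IntermediateField.fixedField H')
    (IntermediateField.fixedField H)
  have h2 := Module.finrank_mul_finrank (IntermediateField.fixedField H')
    (IntermediateField.fixedField H) N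
  rw [IntermediateField.finrank_fixedField_eq_card, IntermediateField.finrank_fixedField_eq_card,
    hc, mul_comm] at h2
  rwa [Nat.eq_of_mul_eq_mul_left Nat.card_pos h2] at h1

theorem simpleDim_fixedField_dvd_card_mul {n : ℕ} (H : Subgroup Gal(N/K))
    (g : D →ₐ[K] Matrix (Fin n) (Fin n) N) :
    simpleDim (IntermediateField.fixedField H) (IntermediateField.fixedField H ⊗[K] D) ∣
      Nat.card H * n := by
  refine (simpleDim_tensorProduct_dvd (D := D) (K := K) (IntermediateField.fixedField H) N).trans ?_
  rw [IntermediateField.finrank_fixedField_eq_card]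
  exact mul_dvd_mul_left _ (simpleDim_dvd_of_algHom_matrix g)

/-- Going down a chain of `p`-subgroups, the index drops below `p ^ c` in a single step. -/
theorem exists_subgroup_simpleDim {n p c : ℕ} [Fact p.Prime] (hn : finrank K D = n ^ 2)
    (hn0 : n ≠ 0) (hp : p ^ c ∣ n) (hc : c ≠ 0) (g : D →ₐ[K] Matrix (Fin n) (Fin n) N) :
    ∃ (i : ℕ) (H H' : Subgroup Gal(N/K)), H ≤ H' ∧ Nat.card H = p ^ i ∧
      Nat.card H' = p ^ (i + 1) ∧
      simpleDim (IntermediateField.fixedField H') (IntermediateField.fixedField H' ⊗[K] D) =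
        n * p ^ c ∧
      simpleDim (IntermediateField.fixedField H) (IntermediateField.fixedField H ⊗[K] D) =
        n * p ^ (c - 1) := by
  have hpp : p.Prime := Fact.out
  have key : ∃ (i : ℕ) (H H' : Subgroup Gal(N/K)), H ≤ H' ∧ Nat.card H = p ^ i ∧
      Nat.card H' = p ^ (i + 1) ∧
      n * p ^ c ∣ simpleDim (IntermediateField.fixedField H')
        (IntermediateField.fixedField H' ⊗[K] D) ∧
      ¬ n * p ^ c ∣ simpleDim (IntermediateField.fixedField H)
        (IntermediateField.fixedField H ⊗[K] D) := by
    by_contra! hcon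
    have hall : ∀ i, i ≤ (Nat.card Gal(N/K)).factorization p → ∃ H : Subgroup Gal(N/K),
        Nat.card H = p ^ i ∧ ¬ n * p ^ c ∣ simpleDim (IntermediateField.fixedField H)
        (IntermediateField.fixedField H ⊗[K] D) := by
      intro i
      induction i with
      | zero =>
        intro _
        refine ⟨⊥, by simp, fun h => ?_⟩
        have h1 := h.trans (simpleDim_fixedField_dvd_card_mul ⊥ g)
        rw [Subgroup.card_bot, one_mul] at h1
        have h2 := Nat.le_of_dvd (Nat.pos_of_ne_zero hn0) h1
        have h3 : 1 < p ^ c := Nat.one_lt_pow hc hpp.one_lt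
        nlinarith [Nat.pos_of_ne_zero hn0]
      | succ i ih =>
        intro hi
        obtain ⟨H, hH, hH'⟩ := ih (by omega)
        obtain ⟨H', h1, h2⟩ := Sylow.exists_subgroup_card_pow_succ
          ((Nat.Prime.pow_dvd_iff_le_factorization hpp Nat.card_pos.ne').2 hi) hH
        refine ⟨H', h1, fun h => hH' ?_⟩
        exact hcon i H H' h2 hH h1 h
    obtain ⟨H, hH, hH'⟩ := hall _ le_rfl
    apply hH'
    obtain ⟨t, ht⟩ := dvd_simpleDim (IntermediateField.fixedField H) hn
    have h1 := finrank_dvd_mul_simpleDim K (IntermediateField.fixedField H) D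
    rw [hn, finrank_fixedField_eq_index, ht, sq, mul_left_comm] at h1
    have h2 := (Nat.dvd_of_mul_dvd_mul_left (Nat.pos_of_ne_zero hn0) h1)
    have h3 : (p ^ c).Coprime H.index := by
      refine Nat.Coprime.pow_left _ ((Nat.Prime.coprime_iff_not_dvd hpp).2 fun h => ?_)
      apply Nat.pow_succ_factorization_not_dvd (n := Nat.card Gal(N/K)) Nat.card_pos.ne' hpp
      rw [pow_succ, ← hH, ← H.card_mul_index]
      exact mul_dvd_mul_left _ h
    rw [ht]
    exact mul_dvd_mul_left _ (h3.dvd_of_dvd_mul_left (hp.trans h2))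
  obtain ⟨i, H, H', hle, hi, hi', hd, hd'⟩ := key
  refine ⟨i, H, H', hle, hi, hi', ?_⟩
  obtain ⟨s, hs⟩ := dvd_simpleDim (IntermediateField.fixedField H) hn
  obtain ⟨s', hs'⟩ := dvd_simpleDim (IntermediateField.fixedField H') hn
  have h1 := simpleDim_fixedField_dvd_card_mul H g
  have h2 := simpleDim_fixedField_dvd_card_mul H' g
  have h3 := simpleDim_fixedField_dvd (D := D) (m := p) hle (by rw [hi, hi', pow_succ])
  have hn1 := Nat.pos_of_ne_zero hn0
  rw [hs, hi, mul_comm _ n] at h1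
  rw [hs', hi', mul_comm _ n] at h2
  rw [hs, hs', mul_left_comm] at h3
  rw [hs'] at hd
  rw [hs] at hd'
  obtain ⟨a, ha, rfl⟩ := (Nat.dvd_prime_pow hpp).1 (Nat.dvd_of_mul_dvd_mul_left hn1 h1)
  obtain ⟨b, hb, rfl⟩ := (Nat.dvd_prime_pow hpp).1 (Nat.dvd_of_mul_dvd_mul_left hn1 h2)
  have h4 := Nat.dvd_of_mul_dvd_mul_left hn1 h3
  have h5 := Nat.dvd_of_mul_dvd_mul_left hn1 hd
  rw [← pow_succ', Nat.pow_dvd_pow_iff_le_right hpp.one_lt] at h4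
  rw [Nat.pow_dvd_pow_iff_le_right hpp.one_lt] at h5
  have h6 : a < c := by
    by_contra h
    exact hd' (mul_dvd_mul_left _ (pow_dvd_pow p (by omega)))
  obtain rfl : b = c := by omega
  obtain rfl : a = b - 1 := by omega
  exact ⟨hs', hs⟩

theorem exists_cyclic_simpleDim_of_algHom_matrix {n p c : ℕ} [Fact p.Prime]
    (hn : finrank K D = n ^ 2) (hn0 : n ≠ 0) (hp : p ^ c ∣ n) (hc : c ≠ 0)
    (g : D →ₐ[K] Matrix (Fin n) (Fin n) N) :
    ∃ (F F' : Type u) (_ : Field F) (_ : Field F') (_ : Algebra K F) (_ : Algebra K F')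
      (_ : Algebra F F') (_ : IsScalarTower K F F') (_ : FiniteDimensional K F)
      (_ : FiniteDimensional F F'), finrank F F' = p ∧ (∃ χ : F' ≃ₐ[F] F', χ ≠ 1) ∧
      simpleDim F (F ⊗[K] D) = n * p ^ c ∧ simpleDim F' (F' ⊗[K] D) = n * p ^ (c - 1) := by
  have hpp : p.Prime := Fact.out
  obtain ⟨i, H, H', hle, hi, hi', h1, h2⟩ := exists_subgroup_simpleDim hn hn0 hp hc g
  have hidx : (H.subgroupOf H').index = p := by
    have h := Subgroup.relIndex_mul_relIndex (⊥ : Subgroup Gal(N/K)) H H' bot_le hle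
    rw [Subgroup.relIndex_bot_left, Subgroup.relIndex_bot_left, hi, hi', pow_succ] at h
    exact Nat.eq_of_mul_eq_mul_left (pow_pos hpp.pos i) h
  have hnorm : (H.subgroupOf H').Normal := by
    apply Subgroup.normal_of_index_eq_minFac_card
    rw [hidx, hi', Nat.Prime.pow_minFac hpp (by omega)]
  obtain ⟨g, hg, hgH⟩ : ∃ g ∈ H', g ∉ H := by
    by_contra! h
    have := Subgroup.card_le_of_le (H := H') (K := H) h
    rw [hi, hi', pow_succ] at this
    nlinarith [hpp.one_lt, pow_pos hpp.pos i]
  obtain ⟨χ, hχ, x, hx⟩ := exists_algEquiv_fixedField hgH (fun h hh => by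
    have := hnorm.conj_mem ⟨h, hle hh⟩ hh ⟨g⁻¹, H'.inv_mem hg⟩
    simpa [Subgroup.mem_subgroupOf] using this)
  let _ : Algebra (IntermediateField.fixedField H') (IntermediateField.fixedField H) :=
    (IntermediateField.inclusion (IntermediateField.fixedField_le hle)).toRingHom.toAlgebra
  have : IsScalarTower K (IntermediateField.fixedField H') (IntermediateField.fixedField H) :=
    .of_algebraMap_eq fun _ => rfl
  have : IsScalarTower (IntermediateField.fixedField H') (IntermediateField.fixedField H) N :=
    .of_algebraMap_eq fun _ => rfl
  have : FiniteDimensional (IntermediateField.fixedField H') (IntermediateField.fixedField H) :=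
    Module.Finite.of_restrictScalars_finite K _ _
  refine ⟨IntermediateField.fixedField H', IntermediateField.fixedField H, inferInstance,
    inferInstance, inferInstance, inferInstance, inferInstance, inferInstance, inferInstance,
    inferInstance, ?_, ⟨AlgEquiv.ofRingEquiv (f := χ.toRingEquiv) fun y => ?_, fun h => hx ?_⟩,
    h1, h2⟩
  · have h2 := Module.finrank_mul_finrank (IntermediateField.fixedField H')
      (IntermediateField.fixedField H) N
    rw [IntermediateField.finrank_fixedField_eq_card, IntermediateField.finrank_fixedField_eq_card,
      hi, hi', pow_succ, mul_comm] at h2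
    exact Nat.eq_of_mul_eq_mul_left (pow_pos hpp.pos i) h2
  · apply Subtype.ext
    exact (hχ _).trans ((IntermediateField.mem_fixedField_iff H' _).1 y.2 g hg)
  · exact DFunLike.congr_fun h x

end

/-- A central division algebra of degree divisible by `p ^ c` becomes of index `p ^ c` and
`p ^ (c - 1)` over the two layers of a cyclic extension of degree `p`. -/
theorem exists_cyclic_simpleDim {K : Type u} [Field K] [CharZero K] {D : Type u}
    [DivisionRing D] [Algebra K D] [FiniteDimensional K D] [Algebra.IsCentral K D] {n p c : ℕ}
    [Fact p.Prime] (hn : finrank K D = n ^ 2) (hn0 : n ≠ 0) (hp : p ^ c ∣ n) (hc : c ≠ 0) :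
    ∃ (F F' : Type u) (_ : Field F) (_ : Field F') (_ : Algebra K F) (_ : Algebra K F')
      (_ : Algebra F F') (_ : IsScalarTower K F F') (_ : FiniteDimensional K F)
      (_ : FiniteDimensional F F'), finrank F F' = p ∧ (∃ χ : F' ≃ₐ[F] F', χ ≠ 1) ∧
      simpleDim F (F ⊗[K] D) = n * p ^ c ∧ simpleDim F' (F' ⊗[K] D) = n * p ^ (c - 1) := by
  obtain ⟨N, hN, hG, ⟨g⟩⟩ := exists_isGalois_algHom_matrix hn
  exact exists_cyclic_simpleDim_of_algHom_matrix (N := N) hn hn0 hp hc g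

section

variable {K F F' D V : Type*} [Field K] [Field F] [Field F'] [Algebra K F] [Algebra K F']
  [Algebra F F'] [DivisionRing D] [Algebra K D]
  [AddCommGroup V] [Module F V] [Module F' V] [IsScalarTower F F' V]
  [Module (F ⊗[K] D) V] [IsScalarTower F (F ⊗[K] D) V]
  [Module (F' ⊗[K] D) V] [IsScalarTower F' (F' ⊗[K] D) V]

theorem tmul_smul_eq {L : Type*} [Field L] [Algebra K L] [Module L V] [Module (L ⊗[K] D) V]
    [IsScalarTower L (L ⊗[K] D) V] (x : L) (d : D) (v : V) :
    (x ⊗ₜ[K] d) • v = x • (1 ⊗ₜ[K] d : L ⊗[K] D) • v := by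
  rw [← smul_assoc, TensorProduct.smul_tmul', smul_eq_mul, mul_one]

theorem smul_one_tmul_smul {L : Type*} [Field L] [Algebra K L] [Module L V] [Module (L ⊗[K] D) V]
    [IsScalarTower L (L ⊗[K] D) V] (x : L) (d : D) (v : V) :
    x • (1 ⊗ₜ[K] d : L ⊗[K] D) • v = (1 ⊗ₜ[K] d : L ⊗[K] D) • x • v := by
  have h : x • v = (x ⊗ₜ[K] (1 : D)) • v := by
    rw [tmul_smul_eq, ← Algebra.TensorProduct.one_def, one_smul]
  rw [← tmul_smul_eq, h, ← mul_smul]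
  simp

/-- Build an endomorphism over `F ⊗ D` from an additive map compatible with `F` and `D`. -/
def endOfSMul {L : Type*} [Field L] [Algebra K L] [Module L V] [Module (L ⊗[K] D) V]
    [IsScalarTower L (L ⊗[K] D) V] (e : V →+ V) (h1 : ∀ (x : L) v, e (x • v) = x • e v)
    (h2 : ∀ (d : D) v, e ((1 ⊗ₜ[K] d : L ⊗[K] D) • v) = (1 ⊗ₜ[K] d : L ⊗[K] D) • e v) :
    Module.End (L ⊗[K] D) V where
  toFun := e
  map_add' := map_add e
  map_smul' a v := by
    induction a with
    | zero => simp
    | tmul x d => simp [tmul_smul_eq x d, h1, h2]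
    | add x y hx hy =>
      rw [add_smul, map_add, hx, hy, RingHom.id_apply, RingHom.id_apply, RingHom.id_apply, add_smul]

@[simp]
theorem endOfSMul_apply {L : Type*} [Field L] [Algebra K L] [Module L V] [Module (L ⊗[K] D) V]
    [IsScalarTower L (L ⊗[K] D) V] (e : V →+ V) (h1 : ∀ (x : L) v, e (x • v) = x • e v)
    (h2 : ∀ (d : D) v, e ((1 ⊗ₜ[K] d : L ⊗[K] D) • v) = (1 ⊗ₜ[K] d : L ⊗[K] D) • e v) (v : V) :
    endOfSMul e h1 h2 v = e v := rfl

/-- Scalars of the larger field as endomorphisms over `F ⊗ D`. -/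
def scalarEnd (hV : ∀ (d : D) (v : V), (1 ⊗ₜ[K] d : F ⊗[K] D) • v = (1 ⊗ₜ[K] d : F' ⊗[K] D) • v) :
    F' →ₐ[F] Module.End (F ⊗[K] D) V where
  toFun x := endOfSMul (DistribSMul.toAddMonoidHom V x) (fun y v => smul_comm x y v)
    (fun d v => by
      change x • _ = _ • x • v
      rw [hV, hV, smul_one_tmul_smul])
  map_one' := LinearMap.ext fun v => one_smul F' v
  map_mul' x y := LinearMap.ext fun v => mul_smul x y v
  map_zero' := LinearMap.ext fun v => zero_smul F' v
  map_add' x y := LinearMap.ext fun v => add_smul x y v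
  commutes' x := LinearMap.ext fun v => algebraMap_smul F' x v

@[simp]
theorem scalarEnd_apply
    (hV : ∀ (d : D) (v : V), (1 ⊗ₜ[K] d : F ⊗[K] D) • v = (1 ⊗ₜ[K] d : F' ⊗[K] D) • v) (x : F')
    (v : V) : scalarEnd hV x v = x • v := rfl

/-- Endomorphisms over `F' ⊗ D` as endomorphisms over `F ⊗ D`. -/
def restrictEnd
    (hV : ∀ (d : D) (v : V), (1 ⊗ₜ[K] d : F ⊗[K] D) • v = (1 ⊗ₜ[K] d : F' ⊗[K] D) • v) :
    Module.End (F' ⊗[K] D) V →+* Module.End (F ⊗[K] D) V where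
  toFun e := endOfSMul e.toAddMonoidHom
    (fun y v => by
      change e _ = y • e v
      rw [← algebraMap_smul F' y v, ← algebraMap_smul F' y (e v)]
      exact (e.restrictScalars F').map_smul _ v)
    (fun d v => by
      change e _ = _ • e v
      rw [hV, hV, map_smul])
  map_one' := rfl
  map_mul' x y := rfl
  map_zero' := rfl
  map_add' x y := rfl

@[simp]
theorem restrictEnd_apply
    (hV : ∀ (d : D) (v : V), (1 ⊗ₜ[K] d : F ⊗[K] D) • v = (1 ⊗ₜ[K] d : F' ⊗[K] D) • v)
    (e : Module.End (F' ⊗[K] D) V) (v : V) : restrictEnd hV e v = e v := rfl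

theorem exists_eq_restrictEnd
    (hV : ∀ (d : D) (v : V), (1 ⊗ₜ[K] d : F ⊗[K] D) • v = (1 ⊗ₜ[K] d : F' ⊗[K] D) • v)
    (e : Module.End (F ⊗[K] D) V) (he : ∀ x : F', e * scalarEnd hV x = scalarEnd hV x * e) :
    ∃ c, restrictEnd hV c = e := by
  refine ⟨endOfSMul e.toAddMonoidHom (fun x v => LinearMap.congr_fun (he x) v) (fun d v => ?_), ?_⟩
  · change e _ = _ • e v
    rw [← hV, ← hV, map_smul]
  · ext v
    rfl

theorem exists_semilinear_scalarEnd [IsScalarTower K F F'] [FiniteDimensional K D] [Algebra.IsCentral K D]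
    [IsSimpleModule (F' ⊗[K] D) V]
    (hV : ∀ (d : D) (v : V), (1 ⊗ₜ[K] d : F ⊗[K] D) • v = (1 ⊗ₜ[K] d : F' ⊗[K] D) • v)
    (χ : F' ≃ₐ[F] F') : ∃ u : Module.End (F ⊗[K] D) V, u ≠ 0 ∧
      ∀ x, u * scalarEnd hV x = scalarEnd hV (χ x) * u := by
  have := isSimpleRing_tensorProduct (K := K) (F := F') (D := D)
  have := IsArtinianRing.of_finite F' (F' ⊗[K] D)
  let σ : F' ⊗[K] D ≃ₐ[K] F' ⊗[K] D :=
    Algebra.TensorProduct.congr (χ.restrictScalars K) AlgEquiv.refl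
  have hσ : ∀ x d, σ (x ⊗ₜ d) = χ x ⊗ₜ d := fun x d => by simp [σ]
  obtain ⟨u, hu⟩ := exists_semilinear_end (A := F' ⊗[K] D) (V := V) σ.toRingEquiv
  have h1 : ∀ (x : F') v, u (x • v) = χ x • u v := by
    intro x v
    have h : ∀ (x : F') (v : V), x • v = (x ⊗ₜ[K] (1 : D)) • v := by
      intro x v
      rw [tmul_smul_eq, ← Algebra.TensorProduct.one_def, one_smul]
    rw [h, hu, h]
    exact congrArg (· • u v) (hσ x 1)
  have h2 : ∀ (d : D) (v : V), u ((1 ⊗ₜ[K] d : F' ⊗[K] D) • v) =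
      (1 ⊗ₜ[K] d : F' ⊗[K] D) • u v := by
    intro d v
    rw [hu]
    exact congrArg (· • u v) ((hσ 1 d).trans (by rw [map_one]))
  refine ⟨endOfSMul u.toAddMonoidHom (fun x v => ?_) (fun d v => ?_), fun h0 => ?_, fun x => ?_⟩
  · change u _ = x • u v
    rw [← algebraMap_smul F' x v, h1, AlgEquiv.commutes, algebraMap_smul]
  · change u _ = _ • u v
    rw [hV, hV, h2]
  · have : Nontrivial V := IsSimpleModule.nontrivial (F' ⊗[K] D) V
    obtain ⟨v, hv⟩ := exists_ne (0 : V)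
    have h : u v = 0 := LinearMap.congr_fun h0 v
    exact hv (by simpa using h)
  · ext v
    exact h1 x v

end

section

/-- The base change of an anti-automorphism. -/
theorem exists_antiautomorphism_tensorProduct (K F' : Type*) {D : Type*} [Field K] [Field F']
    [Algebra K F'] [DivisionRing D] [Algebra K D] (f : D →ₐ[K] Dᵐᵒᵖ) :
    ∃ θ : F' ⊗[K] D →ₐ[F'] (F' ⊗[K] D)ᵐᵒᵖ, ∀ d : D,
      θ (1 ⊗ₜ d) = MulOpposite.op (1 ⊗ₜ (f d).unop) := by
  let g : D →ₐ[K] (F' ⊗[K] D)ᵐᵒᵖ :=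
    (AlgHom.op (Algebra.TensorProduct.includeRight : D →ₐ[K] F' ⊗[K] D)).comp f
  have hc : ∀ x y, Commute (Algebra.ofId F' (F' ⊗[K] D)ᵐᵒᵖ x) (g y) :=
    fun x y => Algebra.commutes _ _
  refine ⟨Algebra.TensorProduct.lift (Algebra.ofId F' _) g hc, fun d => ?_⟩
  refine (Algebra.TensorProduct.lift_tmul (Algebra.ofId F' _) g hc 1 d).trans ?_
  rw [map_one, one_mul]
  rfl

variable {K F F' D V : Type*} [Field K] [Field F] [Field F'] [Algebra K F] [Algebra K F']
  [Algebra F F'] [IsScalarTower K F F'] [DivisionRing D] [Algebra K D]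
  [AddCommGroup V] [Module F V] [Module F' V] [IsScalarTower F F' V]
  [Module (F' ⊗[K] D) V] [IsScalarTower F' (F' ⊗[K] D) V]

theorem exists_adjoint_form [FiniteDimensional K D] [Algebra.IsCentral K D]
    [FiniteDimensional F F'] [IsSimpleModule (F' ⊗[K] D) V] (f : D →ₐ[K] Dᵐᵒᵖ) :
    ∃ h : V ≃+ Module.Dual F V, (∀ (x : F') v w, h (x • v) w = h v (x • w)) ∧
      ∀ (d : D) v w, h ((1 ⊗ₜ[K] d : F' ⊗[K] D) • v) w =
        h v ((1 ⊗ₜ[K] (f d).unop : F' ⊗[K] D) • w) := by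
  have := isSimpleRing_tensorProduct (K := K) (F := F') (D := D)
  have hfd := finiteDimensional_of_isSimpleModule F' (F' ⊗[K] D) V
  have : FiniteDimensional F V := Module.Finite.trans F' V
  obtain ⟨θ, hθ⟩ := exists_antiautomorphism_tensorProduct K F' f
  have : IsScalarTower F (F' ⊗[K] D) V := ⟨fun c a v => by
    rw [← algebraMap_smul F' c a, smul_assoc, algebraMap_smul]⟩
  have : FiniteDimensional F (F' ⊗[K] D) := Module.Finite.trans F' _
  let ρ : F' ⊗[K] D →+* Module.End F (Module.Dual F V) :=
    { toFun a := (Algebra.lsmul F F V (θ a).unop).dualMap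
      map_one' := by ext; simp
      map_mul' x y := by ext; simp
      map_zero' := by ext; simp
      map_add' x y := by ext; simp }
  let _ : Module (F' ⊗[K] D) (Module.Dual F V) := Module.compHom _ ρ
  have hs : ∀ (a : F' ⊗[K] D) (φ : Module.Dual F V) w, (a • φ) w = φ ((θ a).unop • w) :=
    fun a φ w => rfl
  have : IsScalarTower F (F' ⊗[K] D) (Module.Dual F V) := ⟨fun c a φ => by
    ext w
    rw [hs, LinearMap.smul_apply, hs, ← algebraMap_smul F' c a, map_smul θ, MulOpposite.unop_smul,
      smul_assoc, algebraMap_smul, map_smul]⟩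
  obtain ⟨h⟩ := nonempty_linearEquiv_of_finrank_eq (F := F) (A := F' ⊗[K] D) (V := V)
    (W := Module.Dual F V) (Subspace.dual_finrank_eq)
  refine ⟨h.symm.toAddEquiv, fun x v w => ?_, fun d v w => ?_⟩
  · change h.symm (x • v) w = h.symm v (x • w)
    rw [← algebraMap_smul (F' ⊗[K] D) x v, map_smul, hs, AlgHom.commutes,
      MulOpposite.algebraMap_apply, MulOpposite.unop_op, algebraMap_smul]
  · change h.symm _ w = h.symm v _
    rw [map_smul, hs, hθ, MulOpposite.unop_op]

variable [Module (F ⊗[K] D) V] [IsScalarTower F (F ⊗[K] D) V]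

/-- The adjoint anti-endomorphism. -/
theorem exists_antiendomorphism_end [FiniteDimensional K D] [Algebra.IsCentral K D]
    [FiniteDimensional F F'] [IsSimpleModule (F' ⊗[K] D) V]
    (hV : ∀ (d : D) (v : V), (1 ⊗ₜ[K] d : F ⊗[K] D) • v = (1 ⊗ₜ[K] d : F' ⊗[K] D) • v)
    (f : D →ₐ[K] Dᵐᵒᵖ) :
    ∃ τ : Module.End (F ⊗[K] D) V →+* (Module.End (F ⊗[K] D) V)ᵐᵒᵖ,
      ∀ x, τ (scalarEnd hV x) = MulOpposite.op (scalarEnd hV x) := by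
  obtain ⟨h, h1, h2⟩ := exists_adjoint_form (F := F) (F' := F') (V := V) f
  have hF : ∀ (e : Module.End (F ⊗[K] D) V) (x : F) v, e (x • v) = x • e v := fun e x v =>
    (e.restrictScalars F).map_smul x v
  have h3 : ∀ (x : F) v, h (x • v) = x • h v := by
    intro x v
    ext w
    rw [← algebraMap_smul F' x v, h1, LinearMap.smul_apply, algebraMap_smul, map_smul]
  let tr (e : Module.End (F ⊗[K] D) V) : Module.Dual F V →ₗ[F] Module.Dual F V :=
    (e.restrictScalars F).dualMap
  have htr : ∀ e φ w, tr e φ w = φ (e w) := fun e φ w => rfl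
  let t (e : Module.End (F ⊗[K] D) V) : Module.End (F ⊗[K] D) V :=
    endOfSMul (h.symm.toAddMonoidHom.comp ((tr e).toAddMonoidHom.comp h.toAddMonoidHom))
      (fun x v => by
        apply h.injective
        change h (h.symm (tr e (h (x • v)))) = h (x • h.symm (tr e (h v)))
        rw [h.apply_symm_apply, h3, h3, h.apply_symm_apply, map_smul])
      (fun d v => by
        apply h.injective
        change h (h.symm (tr e (h (_ • v)))) = h (_ • h.symm (tr e (h v)))
        ext w
        have he : e ((1 ⊗ₜ[K] (f d).unop : F' ⊗[K] D) • w) =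
            (1 ⊗ₜ[K] (f d).unop : F' ⊗[K] D) • e w := by rw [← hV, ← hV, map_smul]
        rw [h.apply_symm_apply, htr, hV, hV, h2, h2, h.apply_symm_apply, htr, he])
  have ht : ∀ e v w, h (t e v) w = h v (e w) := by
    intro e v w
    change h (h.symm (tr e (h v))) w = _
    rw [h.apply_symm_apply, htr]
  have hext : ∀ e e' : Module.End (F ⊗[K] D) V, (∀ v w, h (e v) w = h (e' v) w) → e = e' := by
    intro e e' hh
    ext v
    exact h.injective (LinearMap.ext (hh v))
  refine ⟨⟨⟨⟨fun e => MulOpposite.op (t e), ?_⟩, ?_⟩, ?_, ?_⟩, fun x => ?_⟩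
  · refine congrArg MulOpposite.op (hext _ _ fun v w => ?_)
    rw [ht]
    rfl
  · intro x y
    rw [← MulOpposite.op_mul]
    refine congrArg MulOpposite.op (hext _ _ fun v w => ?_)
    rw [ht, Module.End.mul_apply, Module.End.mul_apply, ht, ht]
  · refine congrArg MulOpposite.op (hext _ _ fun v w => ?_)
    rw [ht]
    simp
  · intro x y
    rw [← MulOpposite.op_add]
    refine congrArg MulOpposite.op (hext _ _ fun v w => ?_)
    rw [ht, LinearMap.add_apply, map_add, LinearMap.add_apply, map_add, LinearMap.add_apply, ht, ht]
  · refine congrArg MulOpposite.op (hext _ _ fun v w => ?_)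
    rw [ht, scalarEnd_apply, scalarEnd_apply, h1]

end

/-- The division algebra `E` of `D` over `F`, containing a cyclic extension `F'` of `F` with
centraliser `C`, an element `u` inducing an automorphism of `F'`, and an anti-endomorphism
fixing `F'`. -/
theorem exists_divisionRing_of_simpleDim {K F F' D : Type u} [Field K] [Field F] [Field F']
    [Algebra K F] [Algebra K F'] [Algebra F F'] [IsScalarTower K F F'] [DivisionRing D]
    [Algebra K D] [FiniteDimensional K D] [Algebra.IsCentral K D] [FiniteDimensional F F']
    {n p r : ℕ} (hn : finrank K D = n ^ 2) (hn0 : n ≠ 0) (hp : finrank F F' = p)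
    (h1 : simpleDim F (F ⊗[K] D) = n * (p * r)) (h2 : simpleDim F' (F' ⊗[K] D) = n * r)
    (χ : F' ≃ₐ[F] F') (f : D →ₐ[K] Dᵐᵒᵖ) :
    ∃ (E C : Type u) (_ : DivisionRing E) (_ : DivisionRing C) (_ : Algebra F E)
      (_ : Algebra F' C) (j : F' →ₐ[F] E) (k : C →+* E) (u : E) (τ : E →+* Eᵐᵒᵖ),
      u ≠ 0 ∧ (∀ x, u * j x = j (χ x) * u) ∧ (∀ x, k (algebraMap F' C x) = j x) ∧
      (∀ e, (∀ x, e * j x = j x * e) → ∃ c, k c = e) ∧ finrank F' C = r ^ 2 ∧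
      (∀ z : C, (∀ c, c * z = z * c) → ∃ x, z = algebraMap F' C x) ∧
      ∀ x, τ (j x) = MulOpposite.op (j x) := by
  classical
  have := isSimpleRing_tensorProduct (K := K) (F := F) (D := D)
  have := isSimpleRing_tensorProduct (K := K) (F := F') (D := D)
  obtain ⟨V, hV', hdim⟩ := exists_isSimpleModule_finrank_eq F' (F' ⊗[K] D)
  have hfd := finiteDimensional_of_isSimpleModule F' (F' ⊗[K] D) V
  have : FiniteDimensional F V := Module.Finite.trans F' V
  let ι : F ⊗[K] D →ₐ[F] F' ⊗[K] D :=
    Algebra.TensorProduct.map (Algebra.ofId F F') (AlgHom.id K D)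
  let _ : Module (F ⊗[K] D) V := Module.compHom V ι.toRingHom
  have hs : ∀ (a : F ⊗[K] D) (v : V), a • v = ι a • v := fun _ _ => rfl
  have : IsScalarTower F (F ⊗[K] D) V := ⟨fun c a v => by rw [hs, hs, map_smul, smul_assoc]⟩
  have hV : ∀ (d : D) (v : V), (1 ⊗ₜ[K] d : F ⊗[K] D) • v = (1 ⊗ₜ[K] d : F' ⊗[K] D) • v := by
    intro d v
    rw [hs]
    congr 1
    exact (Algebra.TensorProduct.map_tmul _ _ _ _).trans (by simp)
  have hsimple : IsSimpleModule (F ⊗[K] D) V := by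
    apply isSimpleModule_of_finrank_eq F
    rw [← Module.finrank_mul_finrank F F' V, hdim, h1, h2, hp, mul_left_comm]
  obtain ⟨u, hu0, hu⟩ := exists_semilinear_scalarEnd hV χ
  obtain ⟨τ, hτ⟩ := exists_antiendomorphism_end hV f
  refine ⟨Module.End (F ⊗[K] D) V, Module.End (F' ⊗[K] D) V, Module.End.instDivisionRing,
    Module.End.instDivisionRing, inferInstance, inferInstance, scalarEnd hV, restrictEnd hV, u, τ,
    hu0, hu, fun x => rfl, fun e he => exists_eq_restrictEnd hV e he, ?_, fun z hz => ?_, hτ⟩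
  · have h := finrank_end_mul_finrank (F := F') (A := F' ⊗[K] D) (V := V)
    rw [Module.finrank_baseChange, hn, hdim, h2, mul_pow, mul_comm] at h
    exact Nat.eq_of_mul_eq_mul_left (pow_pos (Nat.pos_of_ne_zero hn0) 2) h
  · obtain ⟨x, rfl⟩ := exists_eq_smul_of_commute_end (F := F') hz
    exact ⟨x, (Algebra.algebraMap_eq_smul_one x).symm⟩

section

variable {E L : Type*} [DivisionRing E] [Field L] {j : L →+* E} {χ : L →+* L} {u : E}

theorem pow_mul_eq_iterate_mul_pow (hu : ∀ x, u * j x = j (χ x) * u) (m : ℕ) (x : L) :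
    u ^ m * j x = j (χ^[m] x) * u ^ m := by
  induction m with
  | zero => simp
  | succ m ih => rw [pow_succ', mul_assoc, ih, ← mul_assoc, hu, mul_assoc, Function.iterate_succ_apply']

theorem mul_pow_eq_prod_mul_pow (hu : ∀ x, u * j x = j (χ x) * u) (z : L) (m : ℕ) :
    (j z * u) ^ m = j (∏ i ∈ Finset.range m, χ^[i] z) * u ^ m := by
  induction m with
  | zero => simp
  | succ m ih =>
    rw [pow_succ, ih, mul_assoc, ← mul_assoc (u ^ m), pow_mul_eq_iterate_mul_pow hu,
      Finset.prod_range_succ, map_mul, pow_succ]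
    simp only [mul_assoc]

theorem pow_mul_pow_eq_prod {v : E} {y : L} (hu : ∀ x, u * j x = j (χ x) * u)
    (hv : u * v = j y) (m : ℕ) :
    u ^ m * v ^ m = j (∏ i ∈ Finset.range m, χ^[i] y) := by
  induction m with
  | zero => simp
  | succ m ih =>
    rw [pow_succ u, pow_succ' v, mul_assoc, ← mul_assoc u v, hv, ← mul_assoc,
      pow_mul_eq_iterate_mul_pow hu, mul_assoc, ih, Finset.prod_range_succ, map_mul, ← map_mul,
      ← map_mul, mul_comm]

theorem pow_ne_one_of_semilinear {p : ℕ} (hp : p.Prime) {x₀ : L} (hx : χ x₀ ≠ x₀)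
    (hχ : ∀ x, χ^[p] x = x) (hu : ∀ x, u * j x = j (χ x) * u) : u ^ p ≠ 1 := by
  intro h
  have hu1 : u - 1 ≠ 0 := by
    intro h0
    rw [sub_eq_zero] at h0
    have := hu x₀
    rw [h0, one_mul, mul_one] at this
    exact hx (j.injective this).symm
  have hsum : ∑ i ∈ Finset.range p, u ^ i = 0 := by
    have := mul_geom_sum u p
    rw [h, sub_self] at this
    exact (mul_eq_zero.1 this).resolve_left hu1
  have hu0 : u ≠ 0 := by
    rintro rfl
    rw [zero_pow hp.ne_zero] at h
    exact zero_ne_one h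
  have hmin : Function.minimalPeriod χ x₀ = p := by
    have h1 : Function.IsPeriodicPt χ p x₀ := hχ x₀
    refine ((Nat.dvd_prime hp).1 h1.minimalPeriod_dvd).resolve_left fun h2 => hx ?_
    exact Function.minimalPeriod_eq_one_iff_isFixedPt.1 h2
  let _ : Module L E := Module.compHom E j
  have hs : ∀ (x : L) (e : E), x • e = j x * e := fun _ _ => rfl
  let R : Module.End L E :=
    { toFun := fun e => e * j x₀
      map_add' := fun a b => add_mul a b _
      map_smul' := fun c a => mul_assoc _ _ _ }
  have hli : LinearIndependent L (fun i : Fin p => u ^ (i : ℕ)) := by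
    refine Module.End.eigenvectors_linearIndependent' R (fun i : Fin p => χ^[i] x₀) ?_ _ ?_
    · intro a b hab
      have := Function.iterate_injOn_Iio_minimalPeriod (f := χ) (x := x₀)
        (by rw [hmin]; exact a.2) (by rw [hmin]; exact b.2) hab
      exact Fin.ext this
    · intro i
      refine ⟨Module.End.mem_eigenspace_iff.2 ?_, pow_ne_zero _ hu0⟩
      exact pow_mul_eq_iterate_mul_pow hu i x₀
  have := Fintype.linearIndependent_iff.1 hli (fun _ => 1) (by
    simp only [one_smul]
    rw [Fin.sum_univ_eq_sum_range (fun i => u ^ i) p, hsum]) ⟨0, hp.pos⟩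
  exact one_ne_zero this

/-- A cyclic algebra of odd prime degree has no anti-endomorphism fixing the cyclic maximal
subfield. -/
theorem false_of_antiendomorphism_of_odd {p : ℕ} (hp : p.Prime) (hodd : Odd p) {x₀ : L}
    (hx : χ x₀ ≠ x₀) (hχ : ∀ x, χ^[p] x = x) (hu : ∀ x, u * j x = j (χ x) * u) (hu0 : u ≠ 0)
    (hj : ∀ e, (∀ x, e * j x = j x * e) → ∃ x, j x = e) (τ : E →+* Eᵐᵒᵖ)
    (hτ : ∀ x, τ (j x) = MulOpposite.op (j x)) : False := by
  let t : E → E := fun e => (τ e).unop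
  have ht : ∀ a b, t (a * b) = t b * t a := fun a b => by simp [t]
  have htj : ∀ x, t (j x) = j x := fun x => by simp [t, hτ]
  have htp : ∀ m, t (u ^ m) = t u ^ m := fun m => by simp [t]
  have ht0 : t u ≠ 0 := by simpa [t] using hu0
  have htu : ∀ x, t u * j (χ x) = j x * t u := by
    intro x
    have h1 := ht u (j x)
    rw [hu, ht, htj, htj] at h1
    exact h1
  have hsurj : ∀ x, ∃ x', χ x' = x := fun x => ⟨χ^[p - 1] x, by
    rw [← Function.iterate_succ_apply' χ, Nat.succ_eq_add_one, Nat.sub_add_cancel hp.one_le, hχ]⟩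
  obtain ⟨y, hy⟩ := hj (u * t u) (fun x => by
    obtain ⟨x, rfl⟩ := hsurj x
    rw [mul_assoc, htu, ← mul_assoc, hu, mul_assoc])
  have hy0 : y ≠ 0 := by
    rintro rfl
    rw [map_zero] at hy
    exact mul_ne_zero hu0 ht0 hy.symm
  obtain ⟨α, hα⟩ := hj (u ^ p) (fun x => by rw [pow_mul_eq_iterate_mul_pow hu, hχ])
  have hα0 : α ≠ 0 := by
    rintro rfl
    rw [map_zero] at hα
    exact pow_ne_zero _ hu0 hα.symm
  have hχα : χ α = α := by
    have h1 : u * u ^ p = u ^ p * u := by rw [← pow_succ', pow_succ]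
    rw [← hα, hu] at h1
    exact j.injective (mul_right_cancel₀ hu0 h1)
  have hχαi : ∀ i, χ^[i] α = α := fun i => Function.iterate_fixed hχα i
  have hsq : α * α = ∏ i ∈ Finset.range p, χ^[i] y := by
    have h1 := pow_mul_pow_eq_prod hu hy.symm p
    rw [← htp, ← hα, htj, ← map_mul] at h1
    exact j.injective h1
  obtain ⟨k, hk⟩ := hodd
  have hpow : ∏ i ∈ Finset.range p, χ^[i] (y ^ k * α⁻¹) = α⁻¹ := by
    have h1 : ∀ i, χ^[i] (y ^ k * α⁻¹) = (χ^[i] y) ^ k * α⁻¹ := by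
      intro i
      rw [← RingHom.coe_pow, map_mul, map_pow, map_inv₀, RingHom.coe_pow, hχαi]
    rw [Finset.prod_congr rfl fun i _ => h1 i, Finset.prod_mul_distrib, Finset.prod_pow, ← hsq,
      Finset.prod_const, Finset.card_range, hk]
    rw [pow_succ, pow_mul, ← mul_assoc, sq, ← mul_pow,
      show α * α * (α⁻¹ * α⁻¹) = 1 by field_simp, one_pow, one_mul]
  refine pow_ne_one_of_semilinear (u := j (y ^ k * α⁻¹) * u) (j := j) hp hx hχ (fun x => ?_) ?_
  · rw [mul_assoc, hu, ← mul_assoc, ← mul_assoc, ← map_mul, ← map_mul, mul_comm (χ x)]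
  · rw [mul_pow_eq_prod_mul_pow hu, hpow, ← hα, ← map_mul, inv_mul_cancel₀ hα0, map_one]

end

section

variable {L C : Type*} [Field L] [DivisionRing C] [Algebra L C]

theorem exists_mul_self_eq_of_finrank_eq_four (h4 : finrank L C = 4)
    (hc : ∀ z : C, (∀ c, c * z = z * c) → ∃ x, z = algebraMap L C x) (p : C) :
    ∃ s t : L, p * p = s • p + algebraMap L C t := by
  have : FiniteDimensional L C := Module.finite_of_finrank_pos (by omega)
  have hpint : IsIntegral L p := Algebra.IsIntegral.isIntegral p
  have hirr : Fact (Irreducible (minpoly L p)) := ⟨minpoly.irreducible hpint⟩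
  let g : AdjoinRoot (minpoly L p) →+* C := Ideal.Quotient.lift _
    (Polynomial.aeval (R := L) p).toRingHom (fun a ha => by
      obtain ⟨b, rfl⟩ := Ideal.mem_span_singleton.1 ha
      change Polynomial.aeval p _ = 0
      rw [map_mul, minpoly.aeval, zero_mul])
  have hg : ∀ f : Polynomial L, g (AdjoinRoot.mk _ f) = Polynomial.aeval p f := fun f => rfl
  let _ : Module (AdjoinRoot (minpoly L p)) C := Module.compHom C g
  have hs : ∀ (a : AdjoinRoot (minpoly L p)) (v : C), a • v = g a * v := fun _ _ => rfl
  have : IsScalarTower L (AdjoinRoot (minpoly L p)) C := ⟨fun c a v => by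
    obtain ⟨f, rfl⟩ := AdjoinRoot.mk_surjective a
    rw [hs, hs, AdjoinRoot.smul_mk, hg, hg, map_smul, smul_mul_assoc]⟩
  have hmul := Module.finrank_mul_finrank L (AdjoinRoot (minpoly L p)) C
  have hdeg : finrank L (AdjoinRoot (minpoly L p)) = (minpoly L p).natDegree := by
    rw [(AdjoinRoot.powerBasis (minpoly.ne_zero hpint)).finrank,
      AdjoinRoot.powerBasis_dim]
  rw [h4, hdeg] at hmul
  have hdvd : (minpoly L p).natDegree ∣ 2 ^ 2 := Dvd.intro _ hmul
  obtain ⟨m, hm, hm'⟩ := (Nat.dvd_prime_pow Nat.prime_two).1 hdvd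
  have hmonic := minpoly.monic hpint
  have haev := minpoly.aeval L p
  rw [Polynomial.aeval_eq_sum_range, hm'] at haev
  have hlead := hmonic.coeff_natDegree
  rw [hm'] at hlead
  interval_cases m
  · norm_num at hlead
    simp only [pow_zero, Finset.sum_range_succ, Finset.range_one, Finset.sum_singleton, pow_one,
      hlead, one_smul] at haev
    have hp : p = algebraMap L C (-(minpoly L p).coeff 0) := by
      rw [map_neg, Algebra.algebraMap_eq_smul_one]
      exact eq_neg_of_add_eq_zero_right haev
    refine ⟨0, (-(minpoly L p).coeff 0) * (-(minpoly L p).coeff 0), ?_⟩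
    rw [map_mul, ← hp, zero_smul, zero_add]
  · norm_num at hlead
    simp only [pow_one, Finset.sum_range_succ, Finset.sum_range_zero, zero_add, pow_zero, hlead,
      one_smul] at haev
    refine ⟨-(minpoly L p).coeff 1, -(minpoly L p).coeff 0, ?_⟩
    rw [map_neg, Algebra.algebraMap_eq_smul_one, ← pow_two, neg_smul, ← neg_add, add_comm (_ • p)]
    exact eq_neg_of_add_eq_zero_right haev
  · exfalso
    rw [hm'] at hmul
    have h1 : finrank (AdjoinRoot (minpoly L p)) C = 1 := by omega
    have h2 := (finrank_eq_one_iff_of_nonzero' (1 : C) one_ne_zero).1 h1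
    have h3 : ∀ c : C, ∃ x, c = algebraMap L C x := fun c => hc c fun e => by
      obtain ⟨a, rfl⟩ := h2 c
      obtain ⟨b, rfl⟩ := h2 e
      rw [hs, hs, mul_one, mul_one, ← map_mul, ← map_mul, mul_comm]
    have h5 : finrank L C = 1 := (finrank_eq_one_iff_of_nonzero' (1 : C) one_ne_zero).2 fun c => by
      obtain ⟨x, rfl⟩ := h3 c
      exact ⟨x, (Algebra.algebraMap_eq_smul_one x).symm⟩
    omega

theorem exists_quaternion_basis [CharZero L] (h4 : finrank L C = 4)
    (hc : ∀ z : C, (∀ c, c * z = z * c) → ∃ x, z = algebraMap L C x) :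
    ∃ p q : C, ∃ β γ : L, p * p = algebraMap L C β ∧ q * q = algebraMap L C γ ∧
      q * p = -(p * q) ∧ p ≠ 0 ∧ q ≠ 0 ∧ (∀ x, p ≠ algebraMap L C x) ∧
      ∀ x, ∃ a b c d : L, x = a • 1 + b • p + c • q + d • (p * q) := by
  have : FiniteDimensional L C := Module.finite_of_finrank_pos (by omega)
  have hC0 : CharZero C := charZero_of_injective_algebraMap (algebraMap L C).injective
  have h20 : (2 : C) ≠ 0 := two_ne_zero
  obtain ⟨p₀, hp₀⟩ : ∃ p : C, ∀ x, p ≠ algebraMap L C x := by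
    by_contra! h
    have h5 : finrank L C = 1 := (finrank_eq_one_iff_of_nonzero' (1 : C) one_ne_zero).2 fun c => by
      obtain ⟨x, rfl⟩ := h c
      exact ⟨x, (Algebra.algebraMap_eq_smul_one x).symm⟩
    omega
  obtain ⟨p, hp, β, hβ⟩ : ∃ p : C, (∀ x, p ≠ algebraMap L C x) ∧ ∃ β, p * p = algebraMap L C β := by
    obtain ⟨s, t, h⟩ := exists_mul_self_eq_of_finrank_eq_four h4 hc p₀
    refine ⟨p₀ - algebraMap L C (s / 2), fun x hx => hp₀ (x + s / 2) ?_, t + s / 2 * (s / 2), ?_⟩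
    · rw [map_add, ← hx, sub_add_cancel]
    · have e1 : s • p₀ = algebraMap L C (s / 2) * p₀ + algebraMap L C (s / 2) * p₀ := by
        rw [← add_mul, ← map_add, add_halves, Algebra.smul_def]
      rw [map_add, map_mul, sub_mul, mul_sub, mul_sub, h, e1, ← Algebra.commutes (s / 2) p₀]
      abel
  have hp0 : p ≠ 0 := fun h => hp 0 (by rw [h, map_zero])
  obtain ⟨y, hy⟩ : ∃ y : C, y * p ≠ p * y := by
    by_contra! h
    obtain ⟨x, hx⟩ := hc p h
    exact hp x hx
  obtain ⟨q, hqdef⟩ : ∃ q, q = y * p - p * y := ⟨_, rfl⟩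
  have hq0 : q ≠ 0 := by rw [hqdef]; exact sub_ne_zero.2 hy
  have hqp : q * p = -(p * q) := by
    have e1 : y * p * p = p * (p * y) := by
      rw [mul_assoc, hβ, ← mul_assoc p p y, hβ, Algebra.commutes]
    rw [hqdef, sub_mul, mul_sub, e1, mul_assoc p y p, neg_sub]
  obtain ⟨γ, hγ⟩ : ∃ γ, q * q = algebraMap L C γ := by
    obtain ⟨s, t, h⟩ := exists_mul_self_eq_of_finrank_eq_four h4 hc q
    have e1 : q * q * p = p * (q * q) := by
      rw [mul_assoc, hqp, mul_neg, ← mul_assoc, hqp, neg_mul, neg_neg, mul_assoc]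
    rw [h, add_mul, mul_add, Algebra.commutes t p, smul_mul_assoc, hqp, mul_smul_comm, smul_neg,
      add_left_inj, neg_eq_iff_add_eq_zero, ← two_mul, mul_eq_zero, or_iff_right h20,
      smul_eq_zero, or_iff_left (mul_ne_zero hp0 hq0)] at e1
    exact ⟨t, by rw [h, e1, zero_smul, zero_add]⟩
  refine ⟨p, q, β, γ, hβ, hγ, hqp, hp0, hq0, hp, ?_⟩
  have hsplit : ∀ v w : C, v * p = p * v → w * p = -(p * w) → v + w = 0 → v = 0 ∧ w = 0 := by
    intro v w hv hw h
    have e1 : p * (v - w) = 0 := by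
      rw [mul_sub, ← hv, sub_eq_add_neg, ← hw, ← add_mul, h, zero_mul]
    have e2 : v - w = 0 := (mul_eq_zero.1 e1).resolve_left hp0
    have e3 : v = w := sub_eq_zero.1 e2
    rw [← e3, ← two_mul, mul_eq_zero, or_iff_right h20] at h
    exact ⟨h, e3 ▸ h⟩
  have hlin : ∀ a b : L, a • (1 : C) + b • p = 0 → a = 0 ∧ b = 0 := by
    intro a b h
    have hb : b = 0 := by
      by_contra hb
      refine hp (-(b⁻¹ * a)) ?_
      rw [add_comm] at h
      have e1 := eq_neg_of_add_eq_zero_left h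
      rw [map_neg, Algebra.algebraMap_eq_smul_one, mul_smul, ← smul_neg, ← e1, inv_smul_smul₀ hb]
    refine ⟨?_, hb⟩
    rw [hb, zero_smul, add_zero, smul_eq_zero] at h
    exact h.resolve_right one_ne_zero
  have hli : LinearIndependent L ![1, p, q, p * q] := by
    rw [Fintype.linearIndependent_iff]
    intro g hg
    simp only [Fin.sum_univ_four, Matrix.cons_val_zero, Matrix.cons_val_one, Matrix.cons_val] at hg
    rw [add_assoc] at hg
    have hv : (g 0 • 1 + g 1 • p) * p = p * (g 0 • 1 + g 1 • p) := by
      rw [add_mul, mul_add]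
      simp
    have hw : (g 2 • q + g 3 • (p * q)) * p = -(p * (g 2 • q + g 3 • (p * q))) := by
      rw [add_mul, mul_add, smul_mul_assoc, smul_mul_assoc, mul_smul_comm, mul_smul_comm, hqp,
        mul_assoc, hqp, mul_neg, smul_neg, smul_neg, neg_add]
    obtain ⟨h1, h2⟩ := hsplit _ _ hv hw hg
    obtain ⟨h3, h5⟩ := hlin _ _ h1
    have e : (g 2 • (1 : C) + g 3 • p) * q = 0 := by
      rw [add_mul, smul_mul_assoc, smul_mul_assoc, one_mul, h2]
    obtain ⟨h6, h7⟩ := hlin _ _ ((mul_eq_zero.1 e).resolve_right hq0)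
    intro i
    fin_cases i <;> assumption
  have hspan := hli.span_eq_top_of_card_eq_finrank' (by rw [h4]; rfl)
  intro x
  have hx : x ∈ Submodule.span L (Set.range ![1, p, q, p * q]) := by rw [hspan]; trivial
  obtain ⟨g, hg⟩ := (Submodule.mem_span_range_iff_exists_fun L).1 hx
  refine ⟨g 0, g 1, g 2, g 3, ?_⟩
  rw [← hg]
  simp [Fin.sum_univ_four]

end

section

variable {E : Type*} [DivisionRing E]

theorem anticommute_mul_mul {x y A B : E} (hxy : Commute x y) (hxB : Commute x B)
    (hyA : Commute y A) (h : B * A = -(A * B)) :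
    (y * B) * (x * A) = -((x * A) * (y * B)) := by
  calc (y * B) * (x * A) = y * (x * B) * A := by rw [hxB.eq]; simp only [mul_assoc]
    _ = (x * y) * (B * A) := by rw [hxy.eq]; simp only [mul_assoc]
    _ = -(x * (A * y) * B) := by rw [h, ← hyA.eq]; simp only [mul_assoc, mul_neg]
    _ = _ := by simp only [mul_assoc]

theorem sum_mul_self_of_anticommute {X Y Z : E} (h1 : Y * X = -(X * Y)) (h2 : Z * X = -(X * Z))
    (h3 : Z * Y = -(Y * Z)) :
    (X + Y + Z) * (X + Y + Z) = X * X + Y * Y + Z * Z := by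
  simp only [add_mul, mul_add, h1, h2, h3]
  abel

theorem pure_quaternion_mul_self {A B α β x y z : E} (hA : A * A = α) (hB : B * B = β)
    (h : B * A = -(A * B)) (hxy : Commute x y) (hxz : Commute x z) (hyz : Commute y z)
    (hxA : Commute x A) (hxB : Commute x B) (hyA : Commute y A) (hyB : Commute y B)
    (hzA : Commute z A) (hzB : Commute z B) :
    (x * A + y * B + z * (A * B)) * (x * A + y * B + z * (A * B)) =
      x * x * α + y * y * β - z * z * (α * β) := by
  have e1 : A * B * A = -(A * (A * B)) := by rw [mul_assoc, h, mul_neg]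
  have e2 : A * B * B = -(B * (A * B)) := by rw [← mul_assoc, h, neg_mul, neg_neg]
  rw [sum_mul_self_of_anticommute (anticommute_mul_mul hxy hxB hyA h)
    (anticommute_mul_mul hxz (hxA.mul_right hxB) hzA e1)
    (anticommute_mul_mul hyz (hyA.mul_right hyB) hzB e2)]
  have sq : ∀ {x A : E}, Commute x A → (x * A) * (x * A) = x * x * (A * A) := by
    intro x A h
    rw [mul_assoc, ← mul_assoc A, ← h.eq]
    simp only [mul_assoc]
  have e3 : A * B * (A * B) = -(α * β) := by
    rw [← mul_assoc, e1, ← hA, ← hB, neg_mul]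
    simp only [mul_assoc]
  rw [sq hxA, sq hyB, sq (hzA.mul_right hzB), e3, hA, hB, mul_neg, ← sub_eq_add_neg]

theorem pure_quaternion_eq_zero [CharZero E] {A B x y z : E} (hA : A ≠ 0) (hB : B ≠ 0)
    (h : B * A = -(A * B)) (hxA : Commute x A) (hxB : Commute x B) (hyA : Commute y A)
    (hyB : Commute y B) (hzA : Commute z A) (hzB : Commute z B)
    (h1 : A * (x * A + y * B + z * (A * B)) = (x * A + y * B + z * (A * B)) * A)
    (h2 : B * (x * A + y * B + z * (A * B)) = (x * A + y * B + z * (A * B)) * B) :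
    x = 0 ∧ y = 0 ∧ z = 0 := by
  have key : ∀ {U V W : E}, U ≠ 0 → U * V = V * U → W * U = -(U * W) →
      U * (V + W) = (V + W) * U → W = 0 := by
    intro U V W hU hV hW h
    rw [mul_add, add_mul, hV, hW, add_right_inj, eq_neg_iff_add_eq_zero, ← two_mul, mul_eq_zero,
      or_iff_right two_ne_zero] at h
    exact (mul_eq_zero.1 h).resolve_left hU
  have cA : A * (x * A) = x * A * A := by rw [← mul_assoc, ← hxA.eq]
  have cB : B * (y * B) = y * B * B := by rw [← mul_assoc, ← hyB.eq]
  have aA : (y * B) * A = -(A * (y * B)) := by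
    rw [mul_assoc, h, mul_neg, ← mul_assoc, hyA.eq, mul_assoc]
  have aA' : (z * (A * B)) * A = -(A * (z * (A * B))) := by
    rw [mul_assoc, mul_assoc A, h, ← mul_assoc A z, ← hzA.eq, mul_neg, mul_neg, mul_assoc]
  have aB : (x * A) * B = -(B * (x * A)) := by
    rw [← mul_assoc, ← hxB.eq, mul_assoc, mul_assoc, h, mul_neg, neg_neg]
  have aB' : (z * (A * B)) * B = -(B * (z * (A * B))) := by
    rw [← mul_assoc B, ← hzB.eq, mul_assoc z B, ← mul_assoc B A, h, neg_mul, mul_neg, neg_neg,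
      mul_assoc z]
  have k1 : y * B + z * (A * B) = 0 := key hA cA (by rw [add_mul, mul_add, aA, aA', neg_add])
    (by rwa [← add_assoc])
  have k2 : x * A + z * (A * B) = 0 := key hB cB (by rw [add_mul, mul_add, aB, aB', neg_add])
    (by rwa [← add_assoc, add_comm (y * B)])
  have k3 : z * (A * B) = 0 := by
    have e : x * A = -(z * (A * B)) := eq_neg_of_add_eq_zero_left k2
    rw [add_assoc, k1, add_zero, e, mul_neg, neg_mul, neg_inj] at h1
    exact key hA (V := 0) (by simp) aA' (by simpa using h1)
  rw [k3, add_zero] at k1 k2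
  exact ⟨(mul_eq_zero.1 k2).resolve_right hA, (mul_eq_zero.1 k1).resolve_right hB,
    (mul_eq_zero.1 k3).resolve_right (mul_ne_zero hA hB)⟩

/-- Two commuting quaternion algebras over a number field cannot generate a division ring. -/
theorem false_of_commuting_quaternions {F : Type*} [Field F] [NumberField F] (J : F →+* E)
    {a b c d : F} {A B R S : E} (hA : A * A = J a) (hB : B * B = J b) (hR : R * R = J c)
    (hS : S * S = J d) (hA0 : A ≠ 0) (hB0 : B ≠ 0) (hR0 : R ≠ 0) (hS0 : S ≠ 0)
    (hAB : B * A = -(A * B)) (hRS : S * R = -(R * S)) (hAR : Commute A R) (hAS : Commute A S)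
    (hBR : Commute B R) (hBS : Commute B S) (hJA : ∀ x, Commute (J x) A)
    (hJB : ∀ x, Commute (J x) B) (hJR : ∀ x, Commute (J x) R) (hJS : ∀ x, Commute (J x) S) :
    False := by
  have : CharZero E := charZero_of_injective_ringHom J.injective
  have ne : ∀ {x : F} {X : E}, X * X = J x → X ≠ 0 → x ≠ 0 := by
    rintro x X h hX rfl
    rw [map_zero] at h
    exact hX (mul_self_eq_zero.1 h)
  have hJJ : ∀ x y, Commute (J x) (J y) := fun x y => by
    rw [commute_iff_eq, ← map_mul, ← map_mul, mul_comm]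
  obtain ⟨x₁, x₂, x₃, y₁, y₂, y₃, hy, heq⟩ := exists_ternary_eq_ternary (ne hA hA0) (ne hB hB0)
    (ne hR hR0) (ne hS hS0)
  obtain ⟨P, hP⟩ : ∃ P, P = J x₁ * A + J x₂ * B + J x₃ * (A * B) := ⟨_, rfl⟩
  obtain ⟨Q, hQ⟩ : ∃ Q, Q = J y₁ * R + J y₂ * S + J y₃ * (R * S) := ⟨_, rfl⟩
  have hPP : P * P = Q * Q := by
    rw [hP, hQ, pure_quaternion_mul_self hA hB hAB (hJJ _ _) (hJJ _ _) (hJJ _ _) (hJA _) (hJB _)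
      (hJA _) (hJB _) (hJA _) (hJB _), pure_quaternion_mul_self hR hS hRS (hJJ _ _) (hJJ _ _)
      (hJJ _ _) (hJR _) (hJS _) (hJR _) (hJS _) (hJR _) (hJS _)]
    simp only [← map_mul, ← map_add, ← map_sub]
    congr 1
    linear_combination heq
  have hQX : ∀ {X : E}, (∀ x, Commute (J x) X) → Commute X R → Commute X S → Commute X Q := by
    intro X h1 h2 h3
    rw [hQ]
    exact (((h1 _).symm.mul_right h2).add_right ((h1 _).symm.mul_right h3)).add_right
      ((h1 _).symm.mul_right (h2.mul_right h3))
  have hQA := hQX hJA hAR hAS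
  have hQB := hQX hJB hBR hBS
  have hJQ : ∀ x, Commute (J x) Q := fun x => hQX (fun y => hJJ y x) (hJR x) (hJS x)
  have hPQ : Commute P Q := by
    rw [hP]
    exact (((hJQ _).mul_left hQA).add_left ((hJQ _).mul_left hQB)).add_left
      ((hJQ _).mul_left (hQA.mul_left hQB))
  have hcases := hPQ.mul_self_eq_mul_self_iff.1 hPP
  have hP' : ∀ {X : E}, Commute X Q → Commute X P := by
    intro X h
    rcases hcases with e | e
    · rwa [e]
    · rw [e]; exact h.neg_right
  obtain ⟨z1, z2, z3⟩ := pure_quaternion_eq_zero hA0 hB0 hAB (hJA x₁) (hJB x₁) (hJA x₂) (hJB x₂)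
    (hJA x₃) (hJB x₃) (by rw [← hP]; exact (hP' hQA).eq) (by rw [← hP]; exact (hP' hQB).eq)
  have hP0 : P = 0 := by rw [hP, z1, z2, z3]; simp
  have hQ0 : Q = 0 := by
    rw [hP0, zero_mul] at hPP
    exact mul_self_eq_zero.1 hPP.symm
  obtain ⟨w1, w2, w3⟩ := pure_quaternion_eq_zero hR0 hS0 hRS (hJR y₁) (hJS y₁) (hJR y₂) (hJS y₂)
    (hJR y₃) (hJS y₃) (by rw [← hQ, hQ0]; simp) (by rw [← hQ, hQ0]; simp)
  simp only [map_eq_zero] at w1 w2 w3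
  simp [w1, w2, w3] at hy

end

section

variable {E L : Type*} [DivisionRing E] [Field L]

/-- An antiendomorphism of a division ring fixing the image of a field pointwise. -/
structure IsAntiendomorphism (j : L →+* E) (t : E → E) : Prop where
  add : ∀ x y, t (x + y) = t x + t y
  mul : ∀ x y, t (x * y) = t y * t x
  fix : ∀ x, t (j x) = j x

/-- The centralizer of the image of a ring homomorphism. -/
def rangeCentralizer (j : L →+* E) : Subring E := Subring.centralizer (Set.range j)

theorem mem_rangeCentralizer {j : L →+* E} {e : E} :
    e ∈ rangeCentralizer j ↔ ∀ x, j x * e = e * j x := by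
  rw [rangeCentralizer, Subring.mem_centralizer_iff]
  simp

theorem map_mem_rangeCentralizer (j : L →+* E) (x : L) : j x ∈ rangeCentralizer j :=
  mem_rangeCentralizer.2 fun y => by rw [← map_mul, ← map_mul, mul_comm]

namespace IsAntiendomorphism

variable {j : L →+* E} {t : E → E}

theorem map_zero (ht : IsAntiendomorphism j t) : t 0 = 0 := by
  have := ht.fix 0
  rwa [_root_.map_zero] at this

theorem map_neg (ht : IsAntiendomorphism j t) (x : E) : t (-x) = -t x := by
  rw [eq_neg_iff_add_eq_zero, ← ht.add, neg_add_cancel, ht.map_zero]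

theorem map_sub (ht : IsAntiendomorphism j t) (x y : E) : t (x - y) = t x - t y := by
  rw [sub_eq_add_neg, ht.add, ht.map_neg, ← sub_eq_add_neg]

theorem map_ne_zero (ht : IsAntiendomorphism j t) {x : E} (hx : x ≠ 0) : t x ≠ 0 := by
  intro h
  have h1 := ht.mul x x⁻¹
  have h2 := ht.fix 1
  rw [map_one] at h2
  rw [mul_inv_cancel₀ hx, h, mul_zero, h2] at h1
  exact one_ne_zero h1

theorem map_mem (ht : IsAntiendomorphism j t) {e : E} (he : e ∈ rangeCentralizer j) :
    t e ∈ rangeCentralizer j := mem_rangeCentralizer.2 fun x => by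
  have := congr_arg t (mem_rangeCentralizer.1 he x)
  rw [ht.mul, ht.mul, ht.fix] at this
  exact this.symm

theorem conj (ht : IsAntiendomorphism j t) {g : E} (hg : g ∈ rangeCentralizer j) (hg0 : g ≠ 0) :
    IsAntiendomorphism j fun x => g⁻¹ * t x * g where
  add x y := by rw [ht.add, mul_add, add_mul]
  mul x y := by
    rw [ht.mul]
    simp only [mul_assoc]
    rw [mul_inv_cancel_left₀ hg0]
  fix x := by
    rw [ht.fix, mul_assoc, mem_rangeCentralizer.1 hg, inv_mul_cancel_left₀ hg0]

theorem exists_map_eq_neg (ht : IsAntiendomorphism j t) {p q : E} {β : L}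
    (hp : p ∈ rangeCentralizer j) (hq : q ∈ rangeCentralizer j) (hp2 : p * p = j β)
    (hqp : q * p = -(p * q)) (hq0 : q ≠ 0) :
    ∃ s, IsAntiendomorphism j s ∧ s p = -p := by
  have hpp : t p * t p = j β := by rw [← ht.mul, hp2, ht.fix]
  by_cases h : t p - p = 0
  · refine ⟨_, ht.conj hq hq0, ?_⟩
    rw [sub_eq_zero.1 h, mul_assoc, show p * q = -(q * p) by rw [hqp, neg_neg],
      mul_neg, inv_mul_cancel_left₀ hq0]
  · refine ⟨_, ht.conj (sub_mem (ht.map_mem hp) hp) h, ?_⟩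
    have e1 : t p * (t p - p) = -((t p - p) * p) := by
      rw [mul_sub, sub_mul, hpp, hp2, neg_sub]
    change (t p - p)⁻¹ * t p * (t p - p) = -p
    rw [mul_assoc, e1, mul_neg, inv_mul_cancel_left₀ h]

theorem exists_map_eq_neg_and_map_eq_neg (ht : IsAntiendomorphism j t) {p q : E} {β γ : L}
    (hp : p ∈ rangeCentralizer j) (hq : q ∈ rangeCentralizer j) (hp2 : p * p = j β)
    (hq2 : q * q = j γ) (hqp : q * p = -(p * q)) (hp0 : p ≠ 0) (hq0 : q ≠ 0) :
    ∃ s, IsAntiendomorphism j s ∧ s p = -p ∧ s q = -q := by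
  obtain ⟨s, hs, hsp⟩ := ht.exists_map_eq_neg hp hq hp2 hqp hq0
  have e0 : s q * p = -(p * s q) := by
    have := congr_arg s hqp
    rw [hs.map_neg, hs.mul, hs.mul, hsp, neg_mul, mul_neg, neg_neg] at this
    exact this.symm
  have e1 : s q * s q = j γ := by rw [← hs.mul, hq2, hs.fix]
  by_cases h : s q * q - j γ = 0
  · refine ⟨_, hs.conj hp hp0, ?_, ?_⟩
    · rw [hsp, mul_neg, inv_mul_cancel₀ hp0, neg_mul, one_mul]
    · have e2 : s q = q := mul_right_cancel₀ hq0 ((sub_eq_zero.1 h).trans hq2.symm)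
      rw [e2, mul_assoc, hqp, mul_neg, inv_mul_cancel_left₀ hp0]
  · have hg := sub_mem (mul_mem (hs.map_mem hq) hq) (map_mem_rangeCentralizer j γ)
    have e2 : p * (s q * q - j γ) = (s q * q - j γ) * p := by
      rw [mul_sub, sub_mul, mem_rangeCentralizer.1 hp, mul_assoc, hqp, mul_neg, ← mul_assoc,
        ← mul_assoc, e0, neg_mul, neg_neg]
    have e3 : s q * (s q * q - j γ) = -((s q * q - j γ) * q) := by
      rw [mul_sub, sub_mul, ← mul_assoc, e1, mul_assoc, hq2, ← mem_rangeCentralizer.1 (hs.map_mem hq),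
        neg_sub]
    refine ⟨_, hs.conj hg h, ?_, ?_⟩
    · change (s q * q - j γ)⁻¹ * s p * (s q * q - j γ) = -p
      rw [hsp, mul_assoc, neg_mul, e2, mul_neg, inv_mul_cancel_left₀ h]
    · change (s q * q - j γ)⁻¹ * s q * (s q * q - j γ) = -q
      rw [mul_assoc, e3, mul_neg, inv_mul_cancel_left₀ h]

theorem exists_add_map_eq (ht : IsAntiendomorphism j t) {p q : E}
    (hp : p ∈ rangeCentralizer j) (hq : q ∈ rangeCentralizer j) (hqp : q * p = -(p * q))
    (hsp : t p = -p) (hsq : t q = -q)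
    (hb : ∀ e ∈ rangeCentralizer j, ∃ a b c d, e = j a + j b * p + j c * q + j d * (p * q)) :
    ∀ e ∈ rangeCentralizer j, ∃ a, e + t e = j a := by
  intro e he
  obtain ⟨a, b, c, d, rfl⟩ := hb e he
  refine ⟨a + a, ?_⟩
  have h1 : p * q * j d = j d * (p * q) := (mem_rangeCentralizer.1 (mul_mem hp hq) d).symm
  rw [ht.add, ht.add, ht.add, ht.mul, ht.mul, ht.mul, ht.mul, ht.fix, ht.fix, ht.fix, ht.fix, hsp,
    hsq, neg_mul_neg, hqp, neg_mul, neg_mul, neg_mul, h1, ← mem_rangeCentralizer.1 hp,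
    ← mem_rangeCentralizer.1 hq, map_add]
  abel

theorem map_map (ht : IsAntiendomorphism j t)
    (H : ∀ e ∈ rangeCentralizer j, ∃ a, e + t e = j a) {e : E} (he : e ∈ rangeCentralizer j) :
    t (t e) = e := by
  obtain ⟨a, ha⟩ := H e he
  have := congr_arg t ha
  rw [ht.add, ht.fix, ← ha, add_comm e, add_right_inj] at this
  exact this

theorem exists_eq_of_map_eq [CharZero L] (H : ∀ e ∈ rangeCentralizer j, ∃ a, e + t e = j a) {e : E}
    (he : e ∈ rangeCentralizer j) (h : t e = e) : ∃ x, e = j x := by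
  have : CharZero E := charZero_of_injective_ringHom j.injective
  obtain ⟨a, ha⟩ := H e he
  refine ⟨a / 2, ?_⟩
  rw [map_div₀, ← ha, h, map_ofNat, eq_div_iff two_ne_zero, mul_two]

theorem exists_mul_self_eq [CharZero L] (ht : IsAntiendomorphism j t)
    (H : ∀ e ∈ rangeCentralizer j, ∃ a, e + t e = j a) {e : E}
    (he : e ∈ rangeCentralizer j) (h : t e = -e) : ∃ x, e * e = j x :=
  exists_eq_of_map_eq H (mul_mem he he) (by rw [ht.mul, h, neg_mul_neg])

theorem eq_zero_of_map_eq_neg [CharZero L] (ht : IsAntiendomorphism j t) {x : L} (h : t (j x) = -j x) :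
    j x = 0 := by
  have : CharZero E := charZero_of_injective_ringHom j.injective
  rwa [ht.fix, eq_neg_iff_add_eq_zero, ← two_mul, mul_eq_zero, or_iff_right two_ne_zero] at h

theorem map_eq_neg_of_mul_self_eq [CharZero L] (ht : IsAntiendomorphism j t)
    (H : ∀ e ∈ rangeCentralizer j, ∃ a, e + t e = j a) {e : E}
    (he : e ∈ rangeCentralizer j) {b : L} (hb : e * e = j b) (hne : ∀ x, e ≠ j x) :
    t e = -e := by
  have : CharZero E := charZero_of_injective_ringHom j.injective
  obtain ⟨a, ha⟩ := H e he
  have h1 : t e = j a - e := eq_sub_of_add_eq' ha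
  have h2 : t e * t e = j b := by rw [← ht.mul, hb, ht.fix]
  have h3 : j a * (j a - (e + e)) = 0 := by
    have h4 : j a * j a - j a * e - (e * j a - e * e) = e * e := by
      rw [← mul_sub, ← mul_sub, ← sub_mul, ← h1, h2, hb]
    rw [← mem_rangeCentralizer.1 he a, ← sub_eq_zero] at h4
    rw [← h4, mul_sub, mul_add]
    abel
  rcases mul_eq_zero.1 h3 with h | h
  · rw [h1, h, zero_sub]
  · exfalso
    obtain ⟨x, hx⟩ := exists_eq_of_map_eq H he (by
      rw [h1, sub_eq_iff_eq_add]; exact sub_eq_zero.1 h)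
    exact hne x hx

end IsAntiendomorphism

end

namespace IsAntiendomorphism

section

variable {E L : Type*} [DivisionRing E] [Field L] {j : L →+* E} {t : E → E} {χ : L →+* L} {v : E}

theorem inv_mul_map_of_semilinear (hχ : ∀ x, χ (χ x) = x) (hv : ∀ x, v * j x = j (χ x) * v)
    (hv0 : v ≠ 0) (x : L) : v⁻¹ * j x = j (χ x) * v⁻¹ := by
  rw [eq_mul_inv_iff_mul_eq₀ hv0, mul_assoc, inv_mul_eq_iff_eq_mul₀ hv0, hv, hχ]

theorem conj_map_of_semilinear (hv : ∀ x, v * j x = j (χ x) * v) (hv0 : v ≠ 0) (x : L) :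
    v * j x * v⁻¹ = j (χ x) := by
  rw [hv, mul_inv_cancel_right₀ hv0]

theorem conj_mem_rangeCentralizer (hχ : ∀ x, χ (χ x) = x) (hv : ∀ x, v * j x = j (χ x) * v)
    (hv0 : v ≠ 0) {e : E} (he : e ∈ rangeCentralizer j) : v * e * v⁻¹ ∈ rangeCentralizer j :=
  mem_rangeCentralizer.2 fun x => by
    have h1 : v * j (χ x) = j x * v := by rw [hv, hχ]
    have h2 := mem_rangeCentralizer.1 he (χ x)
    have h3 := inv_mul_map_of_semilinear hχ hv hv0 x
    rw [mul_assoc (v * e), h3, ← mul_assoc, ← mul_assoc, ← mul_assoc, ← h1, mul_assoc v, h2,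
      ← mul_assoc]

theorem map_mul_map_of_semilinear (ht : IsAntiendomorphism j t) (hχ : ∀ x, χ (χ x) = x)
    (hv : ∀ x, v * j x = j (χ x) * v) (x : L) : t v * j x = j (χ x) * t v := by
  have := congr_arg t (hv (χ x))
  rw [ht.mul, ht.mul, ht.fix, ht.fix, hχ] at this
  exact this.symm

variable [CharZero L]

theorem map_conj_eq_neg (ht : IsAntiendomorphism j t)
    (H : ∀ e ∈ rangeCentralizer j, ∃ a, e + t e = j a) (hχ : ∀ x, χ (χ x) = x)
    (hv : ∀ x, v * j x = j (χ x) * v) (hv0 : v ≠ 0) {e : E} (he : e ∈ rangeCentralizer j)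
    (h : t e = -e) : t (v * e * v⁻¹) = -(v * e * v⁻¹) := by
  by_cases hne : ∃ x, e = j x
  · obtain ⟨x, rfl⟩ := hne
    rw [ht.eq_zero_of_map_eq_neg h]
    simp [ht.map_zero]
  push Not at hne
  obtain ⟨b, hb⟩ := ht.exists_mul_self_eq H he h
  refine ht.map_eq_neg_of_mul_self_eq H (conj_mem_rangeCentralizer hχ hv hv0 he) (b := χ b) ?_ ?_
  · rw [← conj_map_of_semilinear hv hv0 b, ← hb]
    simp only [mul_assoc]
    rw [inv_mul_cancel_left₀ hv0]
  · intro x hx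
    rw [mul_inv_eq_iff_eq_mul₀ hv0] at hx
    have h1 := hv (χ x)
    rw [hχ, ← hx] at h1
    exact hne _ (mul_left_cancel₀ hv0 h1).symm

theorem map_conj (ht : IsAntiendomorphism j t)
    (H : ∀ e ∈ rangeCentralizer j, ∃ a, e + t e = j a) (hχ : ∀ x, χ (χ x) = x)
    (hv : ∀ x, v * j x = j (χ x) * v) (hv0 : v ≠ 0) {e : E} (he : e ∈ rangeCentralizer j) :
    t (v * e * v⁻¹) = v * t e * v⁻¹ := by
  obtain ⟨a, ha⟩ := H e he
  obtain ⟨x, hx⟩ : ∃ x, x = e - j (a / 2) := ⟨_, rfl⟩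
  have hta : t e = j a - e := eq_sub_of_add_eq' ha
  have haa : j a = j (a / 2) + j (a / 2) := by rw [← map_add, add_halves]
  have htx : t x = -x := by
    rw [hx, ht.map_sub, ht.fix, hta, haa]
    abel
  have hxQ : x ∈ rangeCentralizer j := by
    rw [hx]
    exact sub_mem he (map_mem_rangeCentralizer j _)
  have h1 := map_conj_eq_neg ht H hχ hv hv0 hxQ htx
  have h2 : e = x + j (a / 2) := by rw [hx, sub_add_cancel]
  rw [h2, mul_add, add_mul, conj_map_of_semilinear hv hv0, ht.add, ht.fix, h1, ht.add, htx, ht.fix,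
    mul_add, add_mul, conj_map_of_semilinear hv hv0, mul_neg, neg_mul]

theorem exists_map_mul_self_eq (ht : IsAntiendomorphism j t)
    (H : ∀ e ∈ rangeCentralizer j, ∃ a, e + t e = j a)
    (hcent : ∀ z ∈ rangeCentralizer j, (∀ c ∈ rangeCentralizer j, c * z = z * c) → ∃ x, z = j x)
    (hχ : ∀ x, χ (χ x) = x) (hv : ∀ x, v * j x = j (χ x) * v) (hv0 : v ≠ 0) :
    ∃ x, t v * v = j x := by
  have htv := ht.map_mul_map_of_semilinear hχ hv
  refine hcent _ (mem_rangeCentralizer.2 fun x => ?_) fun e he => ?_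
  · rw [mul_assoc, hv, ← mul_assoc, ← mul_assoc, htv, hχ]
  · have h1 : v * t e = v * t e * v⁻¹ * v := by rw [inv_mul_cancel_right₀ hv0]
    have h2 := congr_arg t h1
    rw [ht.mul, ht.mul, map_conj ht H hχ hv hv0 (ht.map_mem he), ht.map_map H he] at h2
    rw [← mul_assoc, h2]
    simp only [mul_assoc]
    rw [inv_mul_cancel₀ hv0, mul_one]

theorem map_map_of_semilinear (ht : IsAntiendomorphism j t)
    (H : ∀ e ∈ rangeCentralizer j, ∃ a, e + t e = j a)
    (hcent : ∀ z ∈ rangeCentralizer j, (∀ c ∈ rangeCentralizer j, c * z = z * c) → ∃ x, z = j x)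
    (hχ : ∀ x, χ (χ x) = x) (hv : ∀ x, v * j x = j (χ x) * v) (hv0 : v ≠ 0) : t (t v) = v := by
  obtain ⟨x, hx⟩ := exists_map_mul_self_eq ht H hcent hχ hv hv0
  have h := congr_arg t hx
  rw [ht.mul, ht.fix, ← hx] at h
  exact mul_left_cancel₀ (ht.map_ne_zero hv0) h

theorem exists_semilinear_map_eq (ht : IsAntiendomorphism j t)
    (H : ∀ e ∈ rangeCentralizer j, ∃ a, e + t e = j a)
    (hcent : ∀ z ∈ rangeCentralizer j, (∀ c ∈ rangeCentralizer j, c * z = z * c) → ∃ x, z = j x)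
    (hχ : ∀ x, χ (χ x) = x) {i : L} (hi : χ i = -i) (hi0 : i ≠ 0)
    (hv : ∀ x, v * j x = j (χ x) * v) (hv0 : v ≠ 0) :
    ∃ y : E, y ≠ 0 ∧ (∀ x, y * j x = j (χ x) * y) ∧ ∃ b, χ b = b ∧ y * y = j b := by
  obtain ⟨y, hy0, hy, hty⟩ : ∃ y : E, y ≠ 0 ∧ (∀ x, y * j x = j (χ x) * y) ∧ t y = y := by
    have htv := ht.map_mul_map_of_semilinear hχ hv
    by_cases h : v + t v = 0
    · refine ⟨j i * v, mul_ne_zero ((_root_.map_ne_zero j).2 hi0) hv0, fun x => ?_, ?_⟩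
      · rw [mul_assoc, hv, ← mul_assoc, ← mul_assoc, ← map_mul, ← map_mul, mul_comm]
      · rw [ht.mul, ht.fix, eq_neg_of_add_eq_zero_right h, neg_mul, hv, hi, _root_.map_neg, neg_mul,
          neg_neg]
    · refine ⟨v + t v, h, fun x => ?_, ?_⟩
      · rw [add_mul, mul_add, hv, htv]
      · rw [ht.add, map_map_of_semilinear ht H hcent hχ hv hv0, add_comm]
  obtain ⟨b, hb⟩ := exists_map_mul_self_eq ht H hcent hχ hy hy0
  rw [hty] at hb
  refine ⟨y, hy0, hy, b, ?_, hb⟩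
  have h1 := hy b
  rw [← hb, ← mul_assoc] at h1
  exact j.injective (by rw [← hb]; exact (mul_right_cancel₀ hy0 h1).symm)

/-- A skew element can be replaced by a skew element which commutes with `y`. -/
theorem exists_commute_semilinear (ht : IsAntiendomorphism j t)
    (H : ∀ e ∈ rangeCentralizer j, ∃ a, e + t e = j a) (hχ : ∀ x, χ (χ x) = x)
    {i : L} (hi : χ i = -i) (hi0 : i ≠ 0) {y : E} {b : L} (hy0 : y ≠ 0)
    (hy : ∀ x, y * j x = j (χ x) * y) (hyb : y * y = j b) {x : E} (hx : x ∈ rangeCentralizer j)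
    (hx0 : x ≠ 0) (htx : t x = -x) :
    ∃ r ∈ rangeCentralizer j, r ≠ 0 ∧ t r = -r ∧ y * r = r * y ∧
      (∃ c, χ c = c ∧ r * r = j c) ∧
      ∀ m ∈ rangeCentralizer j, y * m = m * y → x * m = -(m * x) → r * m = -(m * r) := by
  have : CharZero E := charZero_of_injective_ringHom j.injective
  obtain ⟨z, hz⟩ : ∃ z, z = y * x * y⁻¹ := ⟨_, rfl⟩
  have hzQ : z ∈ rangeCentralizer j := by
    rw [hz]; exact conj_mem_rangeCentralizer hχ hy hy0 hx
  have htz : t z = -z := by rw [hz]; exact map_conj_eq_neg ht H hχ hy hy0 hx htx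
  have hyx : y * x = z * y := by rw [hz, inv_mul_cancel_right₀ hy0]
  have hyz : y * z = x * y := by
    apply mul_right_cancel₀ hy0
    rw [mul_assoc, ← hyx, ← mul_assoc, hyb, mul_assoc, hyb, mem_rangeCentralizer.1 hx]
  have hzm : ∀ m ∈ rangeCentralizer j, y * m = m * y → x * m = -(m * x) → z * m = -(m * z) := by
    intro m _ hm hxm
    apply mul_right_cancel₀ hy0
    rw [mul_assoc, ← hm, ← mul_assoc, ← hyx, mul_assoc, hxm, neg_mul, mul_assoc m, ← hyx, mul_neg,
      ← mul_assoc, hm, mul_assoc]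
  obtain ⟨r, hrQ, hr0, htr, hyr, hrm⟩ : ∃ r ∈ rangeCentralizer j, r ≠ 0 ∧ t r = -r ∧
      y * r = r * y ∧
      ∀ m ∈ rangeCentralizer j, y * m = m * y → x * m = -(m * x) → r * m = -(m * r) := by
    by_cases h : x + z = 0
    · have hsub : x - z ≠ 0 := by
        rw [sub_eq_add_neg, ← eq_neg_of_add_eq_zero_left h, ← two_mul]
        exact mul_ne_zero two_ne_zero hx0
      have hd := sub_mem hx hzQ
      refine ⟨j i * (x - z), mul_mem (map_mem_rangeCentralizer j i) hd,
        mul_ne_zero ((_root_.map_ne_zero j).2 hi0) hsub, ?_, ?_, ?_⟩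
      · rw [ht.mul, ht.map_sub, htx, htz, ht.fix, mem_rangeCentralizer.1 hd]
        noncomm_ring
      · rw [← mul_assoc, hy, hi, mul_assoc, mul_sub, hyx, hyz, _root_.map_neg]
        noncomm_ring
      · intro m hm hym hxm
        rw [mul_assoc, sub_mul, hxm, hzm m hm hym hxm, ← mul_assoc m, ← mem_rangeCentralizer.1 hm]
        noncomm_ring
    · refine ⟨x + z, add_mem hx hzQ, h, ?_, ?_, ?_⟩
      · rw [ht.add, htx, htz, neg_add]
      · rw [mul_add, add_mul, hyx, hyz, add_comm]
      · intro m hm hym hxm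
        rw [add_mul, mul_add, hxm, hzm m hm hym hxm, neg_add]
  obtain ⟨c, hc⟩ := ht.exists_mul_self_eq H hrQ htr
  refine ⟨r, hrQ, hr0, htr, hyr, ⟨c, ?_, hc⟩, hrm⟩
  have h1 := hy c
  rw [← hc, ← mul_assoc, hyr, mul_assoc, hyr, ← mul_assoc] at h1
  exact j.injective (by rw [← hc]; exact (mul_right_cancel₀ hy0 h1).symm)

end

theorem false_of_quadratic {F E L : Type*} [Field F] [NumberField F] [DivisionRing E] [Field L]
    [CharZero L] [Algebra F L] {j : L →+* E} {t : E → E} {χ : L →+* L} {v : E}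
    (ht : IsAntiendomorphism j t) (H : ∀ e ∈ rangeCentralizer j, ∃ a, e + t e = j a)
    (hcent : ∀ z ∈ rangeCentralizer j, (∀ c ∈ rangeCentralizer j, c * z = z * c) → ∃ x, z = j x)
    (hne : ∃ e ∈ rangeCentralizer j, e ≠ 0 ∧ t e = -e)
    (hχ : ∀ x, χ (χ x) = x) (hfix : ∀ x, χ x = x ↔ ∃ a, x = algebraMap F L a)
    {i : L} (hi : χ i = -i) (hi0 : i ≠ 0)
    (hv : ∀ x, v * j x = j (χ x) * v) (hv0 : v ≠ 0) : False := by
  obtain ⟨y, hy0, hy, b, hb, hyb⟩ := exists_semilinear_map_eq ht H hcent hχ hi hi0 hv hv0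
  obtain ⟨p, hpQ, hp0, htp⟩ := hne
  obtain ⟨r, hrQ, hr0, htr, hyr, ⟨c, hc, hrc⟩, -⟩ :=
    exists_commute_semilinear ht H hχ hi hi0 hy0 hy hyb hpQ hp0 htp
  obtain ⟨q, hqQ, hq⟩ : ∃ q ∈ rangeCentralizer j, q * r ≠ r * q := by
    by_contra! h
    obtain ⟨x, rfl⟩ := hcent r hrQ h
    exact hr0 (ht.eq_zero_of_map_eq_neg htr)
  obtain ⟨a, ha⟩ := H q hqQ
  have hts : t (q * r - r * q) = -(q * r - r * q) := by
    rw [ht.map_sub, ht.mul, ht.mul, htr, eq_sub_of_add_eq' ha, mul_sub, sub_mul, mul_neg, neg_mul,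
      neg_mul, mul_neg, ← mem_rangeCentralizer.1 hrQ]
    abel
  have hanti : (q * r - r * q) * r = -(r * (q * r - r * q)) := by
    have h1 : q * r * r = r * (r * q) := by
      rw [mul_assoc, hrc, ← mul_assoc r, hrc, mem_rangeCentralizer.1 hqQ]
    rw [sub_mul, mul_sub, h1, neg_sub, mul_assoc]
  obtain ⟨s, hsQ, hs0, -, hys, ⟨d, hd, hsd⟩, hsm⟩ :=
    exists_commute_semilinear ht H hχ hi hi0 hy0 hy hyb
      (sub_mem (mul_mem hqQ hrQ) (mul_mem hrQ hqQ)) (sub_ne_zero.2 hq) hts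
  have hsr := hsm r hrQ hyr hanti
  obtain ⟨a', ha'⟩ := (hfix (i * i)).1 (by rw [map_mul, hi, neg_mul_neg])
  obtain ⟨b', rfl⟩ := (hfix b).1 hb
  obtain ⟨c', rfl⟩ := (hfix c).1 hc
  obtain ⟨d', rfl⟩ := (hfix d).1 hd
  have hJ : ∀ {m : E}, m ∈ rangeCentralizer j → ∀ x,
      Commute ((j.comp (algebraMap F L)) x) m := fun hm x => mem_rangeCentralizer.1 hm _
  exact false_of_commuting_quaternions (j.comp (algebraMap F L)) (a := a') (A := j i) (B := y)
    (R := r) (S := s) (by rw [← map_mul, ha']; rfl) hyb hrc hsd ((_root_.map_ne_zero j).2 hi0) hy0 hr0 hs0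
    (by rw [hy, hi, _root_.map_neg, neg_mul]) hsr (mem_rangeCentralizer.1 hrQ i)
    (mem_rangeCentralizer.1 hsQ i) hyr hys (hJ (map_mem_rangeCentralizer j i))
    (fun x => by
      have := hy (algebraMap F L x)
      rw [(hfix _).2 ⟨x, rfl⟩] at this
      exact this.symm) (hJ hrQ) (hJ hsQ)

end IsAntiendomorphism

theorem AlgEquiv.iterate_eq_of_prime_finrank {F L : Type*} [Field F] [Field L] [Algebra F L]
    {p : ℕ} (hp : p.Prime) (h : finrank F L = p) {χ : L ≃ₐ[F] L} (hχ : χ ≠ 1) :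
    (∀ x, χ^[p] x = x) ∧ ∀ x, χ x = x → ∃ a, x = algebraMap F L a := by
  have : FiniteDimensional F L := Module.finite_of_finrank_pos (h ▸ hp.pos)
  have := IntermediateField.isSimpleOrder_of_finrank_prime F L (h ▸ hp)
  have hmem : ∀ x, χ x = x → x ∈ IntermediateField.fixedField (Subgroup.zpowers χ) := by
    intro x hx
    rw [IntermediateField.mem_fixedField_iff]
    intro f hf
    obtain ⟨m, rfl⟩ := Subgroup.mem_zpowers_iff.1 hf
    have : χ ∈ MulAction.stabilizer (L ≃ₐ[F] L) x := hx
    exact zpow_mem this m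
  have hbot : IntermediateField.fixedField (Subgroup.zpowers χ) = ⊥ := by
    refine (eq_bot_or_eq_top _).resolve_right fun htop => hχ (AlgEquiv.ext fun x => ?_)
    have hx : x ∈ IntermediateField.fixedField (Subgroup.zpowers χ) := by rw [htop]; trivial
    rw [IntermediateField.mem_fixedField_iff] at hx
    exact hx χ (Subgroup.mem_zpowers χ)
  have hcard := IntermediateField.finrank_fixedField_eq_card (F := F) (E := L) (Subgroup.zpowers χ)
  rw [hbot, IntermediateField.finrank_bot', h, Nat.card_zpowers] at hcard
  refine ⟨fun x => ?_, fun x hx => ?_⟩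
  · have h1 : χ ^ p = 1 := by rw [hcard, pow_orderOf_eq_one]
    rw [← AlgEquiv.coe_pow, h1]
    rfl
  · have := hmem x hx
    rw [hbot, IntermediateField.mem_bot] at this
    obtain ⟨a, ha⟩ := this
    exact ⟨a, ha.symm⟩

theorem false_of_antiendomorphism_of_odd_prime_dvd {K D : Type u} [Field K] [NumberField K]
    [DivisionRing D] [Algebra K D] [FiniteDimensional K D] [Algebra.IsCentral K D] {n p : ℕ}
    (hp : p.Prime) (hodd : Odd p) (hn : finrank K D = n ^ 2) (hn0 : n ≠ 0) (hpn : p ∣ n)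
    (f : D →ₐ[K] Dᵐᵒᵖ) : False := by
  have : Fact p.Prime := ⟨hp⟩
  obtain ⟨F, F', _, _, _, _, _, _, _, _, hfin, ⟨χ, hχ⟩, h1, h2⟩ :=
    exists_cyclic_simpleDim (p := p) (c := 1) hn hn0 (by rwa [pow_one]) one_ne_zero
  obtain ⟨hχp, -⟩ := AlgEquiv.iterate_eq_of_prime_finrank hp hfin hχ
  obtain ⟨E, C, _, _, _, _, j, k, v, τ, hv0, hv, hk, hkQ, hC, -, hτ⟩ :=
    exists_divisionRing_of_simpleDim (r := 1) hn hn0 hfin (by rw [h1, pow_one, mul_one])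
      (by rw [h2]; simp) χ f
  obtain ⟨x₀, hx₀⟩ : ∃ x, χ x ≠ x := by
    by_contra! h
    exact hχ (AlgEquiv.ext h)
  have hC' := (finrank_eq_one_iff_of_nonzero' (1 : C) one_ne_zero).1 (hC.trans (one_pow 2))
  refine false_of_antiendomorphism_of_odd (j := (j : F' →+* E)) (χ := (χ : F' →+* F')) hp hodd
    (x₀ := x₀) hx₀ hχp hv hv0 (fun e he => ?_) τ hτ
  obtain ⟨c, rfl⟩ := hkQ e he
  obtain ⟨x, rfl⟩ := hC' c
  exact ⟨x, by rw [← Algebra.algebraMap_eq_smul_one, hk]; rfl⟩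

theorem false_of_antiendomorphism_of_four_dvd {K D : Type u} [Field K] [NumberField K]
    [DivisionRing D] [Algebra K D] [FiniteDimensional K D] [Algebra.IsCentral K D] {n : ℕ}
    (hn : finrank K D = n ^ 2) (hn0 : n ≠ 0) (h4 : 4 ∣ n) (f : D →ₐ[K] Dᵐᵒᵖ) : False := by
  have : Fact (Nat.Prime 2) := ⟨Nat.prime_two⟩
  obtain ⟨F, F', _, _, _, _, _, _, _, _, hfin, ⟨χ, hχ⟩, h1, h2⟩ :=
    exists_cyclic_simpleDim (p := 2) (c := 2) hn hn0 h4 two_ne_zero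
  have hF0 : CharZero F := charZero_of_injective_algebraMap (algebraMap K F).injective
  have hF'0 : CharZero F' := charZero_of_injective_algebraMap (algebraMap F F').injective
  have hQF : FiniteDimensional ℚ F := FiniteDimensional.trans ℚ K F
  have : NumberField F := { }
  obtain ⟨hχ2, hχF⟩ := AlgEquiv.iterate_eq_of_prime_finrank Nat.prime_two hfin hχ
  obtain ⟨E, C, _, _, _, _, j, k, v, τ, hv0, hv, hk, hkQ, hC, hcent, hτ⟩ :=
    exists_divisionRing_of_simpleDim (r := 2) hn hn0 hfin (by rw [h1, pow_two])
      (by rw [h2]; simp) χ f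
  obtain ⟨x₀, hx₀⟩ : ∃ x, χ x ≠ x := by
    by_contra! h
    exact hχ (AlgEquiv.ext h)
  obtain ⟨p, q, β, γ, hp2, hq2, hqp, hp0, hq0, -, hspan⟩ :=
    exists_quaternion_basis hC hcent
  have hkmem : ∀ c, k c ∈ rangeCentralizer (j : F' →+* E) := fun c =>
    mem_rangeCentralizer.2 fun x => by
      change j x * k c = k c * j x
      rw [← hk, ← map_mul, ← map_mul, Algebra.commutes]
  have hmemk : ∀ e ∈ rangeCentralizer (j : F' →+* E), ∃ c, k c = e := fun e he =>
    hkQ e fun x => (mem_rangeCentralizer.1 he x).symm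
  have ht : IsAntiendomorphism (j : F' →+* E) fun e => (τ e).unop :=
    ⟨fun x y => by simp, fun x y => by simp, fun x => by simpa using congr_arg MulOpposite.unop (hτ x)⟩
  have hp2' : k p * k p = (j : F' →+* E) β := by rw [← map_mul, hp2, hk]; rfl
  have hq2' : k q * k q = (j : F' →+* E) γ := by rw [← map_mul, hq2, hk]; rfl
  have hqp' : k q * k p = -(k p * k q) := by rw [← map_mul, hqp, map_neg, map_mul]
  obtain ⟨s, hs, hsp, hsq⟩ := ht.exists_map_eq_neg_and_map_eq_neg (hkmem p) (hkmem q) hp2' hq2' hqp'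
    ((map_ne_zero k).2 hp0) ((map_ne_zero k).2 hq0)
  have H := hs.exists_add_map_eq (hkmem p) (hkmem q) hqp' hsp hsq fun e he => by
    obtain ⟨x, rfl⟩ := hmemk e he
    obtain ⟨a, b, c, d, rfl⟩ := hspan x
    refine ⟨a, b, c, d, ?_⟩
    simp only [Algebra.smul_def, map_add, map_mul, mul_one, hk]
    rfl
  refine IsAntiendomorphism.false_of_quadratic (F := F) (χ := (χ : F' →+* F')) (i := x₀ - χ x₀) hs H
    (fun z hz h => ?_) ⟨k p, hkmem p, (map_ne_zero k).2 hp0, hsp⟩ hχ2 (fun x => ⟨hχF x, ?_⟩) ?_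
    (sub_ne_zero.2 hx₀.symm) hv hv0
  · obtain ⟨c, rfl⟩ := hmemk z hz
    obtain ⟨x, rfl⟩ := hcent c fun d => k.injective (by rw [map_mul, map_mul, h _ (hkmem d)])
    exact ⟨x, hk x⟩
  · rintro ⟨a, rfl⟩
    exact χ.commutes a
  · change χ (x₀ - χ x₀) = _
    have h3 : χ (χ x₀) = x₀ := hχ2 x₀
    rw [map_sub, h3, neg_sub]

/-- Over a number field, no central division algebra of degree greater than two admits an
antiendomorphism. -/
theorem false_of_antiendomorphism {K D : Type u} [Field K] [NumberField K]
    [DivisionRing D] [Algebra K D] [FiniteDimensional K D] [Algebra.IsCentral K D] {n : ℕ}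
    (hn : finrank K D = n ^ 2) (h2 : 2 < n) (f : D →ₐ[K] Dᵐᵒᵖ) : False := by
  rcases Nat.four_dvd_or_exists_odd_prime_and_dvd_of_two_lt h2 with h4 | ⟨p, hp, hpn, hodd⟩
  · exact false_of_antiendomorphism_of_four_dvd hn (by omega) h4 f
  · exact false_of_antiendomorphism_of_odd_prime_dvd hp hodd hn (by omega) hpn f

end

/-- Let `K` be a number field and `D` a central division `K`-algebra of
degree `d > 2`. Then the genus of `D` is nontrivial: there exists a central division
`K`-algebra `D'` of degree `d` with the same maximal subfields as `D` (a field extension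
`P/K` of degree `d` embeds into `D` iff it embeds into `D'`) but with `D'` not isomorphic
to `D` as a `K`-algebra. -/
theorem genus_nontrivial_over_number_field
    (K : Type) [Field K] [NumberField K] (d : ℕ) (hd : 2 < d)
    (D : CentralDivisionAlgebra K d) :
    ∃ D' : CentralDivisionAlgebra K d,
      (∀ (P : Type) [Field P] [Algebra K P], Module.finrank K P = d →
        ((∃ f : P →ₐ[K] D.carrier, Function.Injective f) ↔
          (∃ f : P →ₐ[K] D'.carrier, Function.Injective f))) ∧
      IsEmpty (D'.carrier ≃ₐ[K] D.carrier) := by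
  have := D.central
  have := D.finite
  refine ⟨⟨D.carrierᵐᵒᵖ, ?_, ?_, ?_⟩, fun P _ _ _ => ⟨?_, ?_⟩, ⟨fun e => ?_⟩⟩
  · refine ⟨fun x hx => ?_⟩
    have hx' : x.unop ∈ Subalgebra.center K D.carrier := by
      rw [Subalgebra.mem_center_iff] at hx ⊢
      intro b
      exact congr_arg MulOpposite.unop (hx (MulOpposite.op b)).symm
    obtain ⟨a, ha⟩ := Algebra.IsCentral.out hx'
    exact ⟨a, MulOpposite.unop_injective ha⟩
  · exact Module.Finite.equiv (MulOpposite.opLinearEquiv K)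
  · rw [← (MulOpposite.opLinearEquiv K).finrank_eq, D.deg]
  · rintro ⟨f, hf⟩
    exact ⟨f.toOpposite fun x y => by rw [commute_iff_eq, ← map_mul, ← map_mul, mul_comm],
      MulOpposite.op_injective.comp hf⟩
  · rintro ⟨f, -⟩
    let f' : P →ₐ[K] D.carrierᵐᵒᵖ := f
    exact ⟨(AlgHom.opComm f').comp (AlgEquiv.toOpposite K P).toAlgHom, RingHom.injective _⟩
  · exact false_of_antiendomorphism D.deg hd e.symm.toAlgHom
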